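/- arXiv:2407.06876 — 10 statements merged into one kernel-verified Lean document; each statement's English description precedes it below -/
import Mathlib

section
/- For every λ > 0 and every x ∈ ℝ³ with x ≠ 0, the (improper/oscillatory) integral of e^{i p·x}/(|p|² + λ) over p ∈ ℝ³ equals 2π² e^{−√λ |x|}/|x|. Equivalently, the inverse Fourier transform of p ↦ 1/(|p|²+λ) on ℝ³ is x ↦ e^{−√λ|x|}/(4π|x|) (with the convention (2π)^{−3}∫ e^{ip·x} · dp). -/
open MeasureTheory Filter Topology

lemma yk_fourier (r : ℝ) (hr : 0 < r) (w : ℝ) :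
    FourierTransform.fourier (fun v : ℝ => ((Real.exp (-(2 * Real.pi * r) * |v|) : ℝ) : ℂ)) w
      = ((1 / Real.pi * (r / (r ^ 2 + w ^ 2)) : ℝ) : ℂ) := by
  rw [Real.fourier_eq']
  have hpi := Real.pi_pos
  have hb : 0 < 2 * Real.pi * r := by positivity
  have e1 : ∀ v ∈ Set.Iic (0:ℝ), Complex.exp (↑(-2 * Real.pi * inner ℝ v w) * Complex.I) •
      ((Real.exp (-(2 * Real.pi * r) * |v|) : ℝ) : ℂ)
      = Complex.exp ((2 * Real.pi * (r - w * Complex.I)) * v) := by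
    intro v hv
    rw [abs_of_nonpos hv]
    push_cast
    rw [smul_eq_mul, ← Complex.exp_add]
    congr 1
    simp
    ring
  have e2 : ∀ v ∈ Set.Ioi (0:ℝ), Complex.exp (↑(-2 * Real.pi * inner ℝ v w) * Complex.I) •
      ((Real.exp (-(2 * Real.pi * r) * |v|) : ℝ) : ℂ)
      = Complex.exp ((2 * Real.pi * (-r - w * Complex.I)) * v) := by
    intro v hv
    rw [abs_of_pos hv]
    push_cast
    rw [smul_eq_mul, ← Complex.exp_add]
    congr 1
    simp
    ring
  have h1 : 0 < (2 * Real.pi * (r - w * Complex.I) : ℂ).re := by simpa using hb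
  have h2 : (2 * Real.pi * (-r - w * Complex.I) : ℂ).re < 0 := by simpa using hb
  rw [← intervalIntegral.integral_Iic_add_Ioi (b := 0)]
  · rw [setIntegral_congr_fun measurableSet_Iic e1, setIntegral_congr_fun measurableSet_Ioi e2,
      integral_exp_mul_complex_Iic h1, integral_exp_mul_complex_Ioi h2]
    have n1 : (r - w * Complex.I : ℂ) ≠ 0 := fun h => hr.ne' (by simpa using congrArg Complex.re h)
    have n2 : (-r - w * Complex.I : ℂ) ≠ 0 := fun h => hr.ne' (by simpa using congrArg Complex.re h)
    have n3 : (r ^ 2 + w ^ 2 : ℂ) ≠ 0 := by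
      have : (r ^ 2 + w ^ 2 : ℝ) ≠ 0 := by positivity
      exact_mod_cast this
    have n4 : (Real.pi : ℂ) ≠ 0 := by exact_mod_cast hpi.ne'
    push_cast
    simp only [mul_zero, Complex.exp_zero]
    field_simp
    ring_nf
    simp only [Complex.I_sq]
    ring
  · exact (integrableOn_congr_fun e1 measurableSet_Iic).2 (integrableOn_exp_mul_complex_Iic h1 0)
  · exact (integrableOn_congr_fun e2 measurableSet_Ioi).2 (integrableOn_exp_mul_complex_Ioi h2 0)

lemma yk_integrable_exp (b : ℝ) (hb : 0 < b) : Integrable (fun v : ℝ => Real.exp (-b * |v|)) := by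
  rw [← integrableOn_univ, ← Set.Iic_union_Ioi (a := (0:ℝ))]
  apply IntegrableOn.union
  · refine (integrableOn_congr_fun ?_ measurableSet_Iic).2 (integrableOn_exp_mul_Iic hb 0)
    intro v hv
    simp [abs_of_nonpos (show v ≤ 0 from hv)]
  · refine (integrableOn_congr_fun ?_ measurableSet_Ioi).2 (integrableOn_exp_mul_Ioi (neg_neg_of_pos hb) 0)
    intro v hv
    simp [abs_of_pos (show 0 < v from hv)]

lemma yk_integrable_lor (r : ℝ) (hr : 0 < r) : Integrable (fun s : ℝ => r / (r ^ 2 + s ^ 2)) := by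
  have := (integrable_inv_one_add_sq.comp_div hr.ne').const_mul (1 / r)
  refine this.congr (Eventually.of_forall fun s => ?_)
  simp
  field_simp

lemma yk_lorentz (r a : ℝ) (hr : 0 < r) (ha : 0 < a) :
    ∫ s in Set.Ioi (0:ℝ), Real.cos (a * s) * (r / (r ^ 2 + s ^ 2))
      = Real.pi / 2 * Real.exp (-(r * a)) := by
  have hpi := Real.pi_pos
  set f : ℝ → ℂ := fun v : ℝ => ((Real.exp (-(2 * Real.pi * r) * |v|) : ℝ) : ℂ) with hf
  have hF : FourierTransform.fourier f = fun w => ((1 / Real.pi * (r / (r ^ 2 + w ^ 2)) : ℝ) : ℂ) :=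
    funext (yk_fourier r hr)
  have hfi : Integrable f := (yk_integrable_exp _ (by positivity)).ofReal
  have hFi : Integrable (FourierTransform.fourier f) := by
    rw [hF]; exact ((yk_integrable_lor r hr).const_mul _).ofReal
  have hc : Continuous f := by rw [hf]; fun_prop
  have key := congrFun (hc.fourierInv_fourier_eq hfi hFi) (a / (2 * Real.pi))
  rw [hF, Real.fourierInv_eq'] at key
  have hint : Integrable (fun w : ℝ => Real.cos (a * w) * (r / (r ^ 2 + w ^ 2))) := by
    refine (yk_integrable_lor r hr).bdd_mul (c := 1) ?_ ?_
    · exact Continuous.aestronglyMeasurable (by fun_prop)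
    · exact Eventually.of_forall fun s => by simpa using Real.abs_cos_le_one _
  have k2 := congrArg Complex.re key
  rw [← RCLike.re_eq_complex_re, ← integral_re] at k2
  · have e : ∀ w : ℝ, RCLike.re (Complex.exp (↑(2 * Real.pi * inner ℝ w (a / (2 * Real.pi))) * Complex.I) •
        ((1 / Real.pi * (r / (r ^ 2 + w ^ 2)) : ℝ) : ℂ))
        = 1 / Real.pi * (Real.cos (a * |w|) * (r / (r ^ 2 + |w| ^ 2))) := by
      intro w
      have : 2 * Real.pi * inner ℝ w (a / (2 * Real.pi)) = a * w := by
        simp; field_simp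
      rw [this, smul_eq_mul, RCLike.re_eq_complex_re, Complex.re_mul_ofReal, Complex.exp_ofReal_mul_I_re]
      rw [sq_abs]
      rcases abs_choice w with h | h <;> rw [h]
      · ring
      · rw [mul_neg, Real.cos_neg]; ring
    simp only [e] at k2
    rw [integral_const_mul, integral_comp_abs (f := fun w => Real.cos (a * w) * (r / (r ^ 2 + w ^ 2)))] at k2
    rw [hf] at k2
    simp only [RCLike.re_eq_complex_re, Complex.ofReal_re] at k2
    rw [abs_of_pos (by positivity), show -(2 * Real.pi * r) * (a / (2 * Real.pi)) = -(r * a) by field_simp] at k2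
    rw [← k2, ← mul_assoc, ← mul_assoc, show Real.pi / 2 * (1 / Real.pi) * 2 = 1 by field_simp, one_mul]
  · rw [← integrable_norm_iff]
    · have := (((yk_integrable_lor r hr).const_mul (1 / Real.pi)).norm)
      refine this.congr (Eventually.of_forall fun s => ?_)
      simp only [smul_eq_mul, norm_mul, Complex.norm_exp_ofReal_mul_I, one_mul, Complex.norm_real]
    · refine AEStronglyMeasurable.fun_smul ?_ ?_
      · exact Continuous.aestronglyMeasurable (by fun_prop)
      · exact ((yk_integrable_lor r hr).const_mul (1 / Real.pi)).ofReal.aestronglyMeasurable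

lemma yk_laplace (a t : ℝ) (ht : 0 < t) :
    ∫ s in Set.Ioi (0:ℝ), Real.cos (a * s) * Real.exp (-t * s) = t / (t ^ 2 + a ^ 2) := by
  have h1 : (-t + a * Complex.I : ℂ).re < 0 := by simpa using ht
  have h := congrArg Complex.re (integral_exp_mul_complex_Ioi h1 0)
  rw [← RCLike.re_eq_complex_re, ← integral_re (integrableOn_exp_mul_complex_Ioi h1 0)] at h
  have e : ∀ s : ℝ, RCLike.re (Complex.exp ((-t + a * Complex.I : ℂ) * s))
      = Real.cos (a * s) * Real.exp (-t * s) := by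
    intro s
    rw [RCLike.re_eq_complex_re, Complex.exp_re]
    simp [mul_comm]
  simp only [e] at h
  rw [h, RCLike.re_eq_complex_re]
  simp [Complex.div_re, Complex.normSq_apply]
  ring

lemma yk_inner (r s M : ℝ) (hr : 0 < r) :
    ∫ t in (0:ℝ)..M, Real.sin (t * r) * Real.exp (-t * s)
      = r / (r ^ 2 + s ^ 2) - Real.exp (-M * s) * (r * Real.cos (M * r) + s * Real.sin (M * r)) / (r ^ 2 + s ^ 2) := by
  have hd : r ^ 2 + s ^ 2 ≠ 0 := by positivity
  rw [intervalIntegral.integral_eq_sub_of_hasDerivAt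
    (f := fun t => -(Real.exp (-t * s) * (r * Real.cos (t * r) + s * Real.sin (t * r)) / (r ^ 2 + s ^ 2)))]
  · simp; ring
  · intro t _
    have hE : HasDerivAt (fun t : ℝ => Real.exp (-t * s)) (Real.exp (-t * s) * (-1 * s)) t :=
      (((hasDerivAt_id t).neg.mul_const s)).exp
    have hC : HasDerivAt (fun t : ℝ => Real.cos (t * r)) (-Real.sin (t * r) * (1 * r)) t :=
      ((hasDerivAt_id t).mul_const r).cos
    have hS : HasDerivAt (fun t : ℝ => Real.sin (t * r)) (Real.cos (t * r) * (1 * r)) t :=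
      ((hasDerivAt_id t).mul_const r).sin
    have := ((hE.mul ((hC.const_mul r).add (hS.const_mul s))).div_const (r ^ 2 + s ^ 2)).neg
    refine this.congr_deriv ?_
    simp only [Pi.add_apply]
    field_simp
    ring
  · exact Continuous.intervalIntegrable (by fun_prop) _ _

lemma yk_fubini (r a M : ℝ) (hr : 0 < r) (hM : 0 < M) :
    ∫ t in (0:ℝ)..M, Real.sin (t * r) * (t / (t ^ 2 + a ^ 2))
      = ∫ s in Set.Ioi (0:ℝ), Real.cos (a * s) *
        ∫ t in (0:ℝ)..M, Real.sin (t * r) * Real.exp (-t * s) := by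
  have h1 : ∫ t in (0:ℝ)..M, Real.sin (t * r) * (t / (t ^ 2 + a ^ 2))
      = ∫ t in (0:ℝ)..M, ∫ s in Set.Ioi (0:ℝ),
        Real.cos (a * s) * (Real.sin (t * r) * Real.exp (-t * s)) := by
    rw [intervalIntegral.integral_of_le hM.le, intervalIntegral.integral_of_le hM.le]
    refine setIntegral_congr_fun measurableSet_Ioc fun t ht => ?_
    change Real.sin (t * r) * (t / (t ^ 2 + a ^ 2)) = ∫ s in Set.Ioi (0:ℝ),
        Real.cos (a * s) * (Real.sin (t * r) * Real.exp (-t * s))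
    rw [← yk_laplace a t ht.1, ← integral_const_mul]
    congr 1; ext s; ring
  rw [h1, intervalIntegral.integral_of_le hM.le, integral_integral_swap]
  · simp only [intervalIntegral.integral_of_le hM.le, integral_const_mul]
  · have hmeas : AEStronglyMeasurable (Function.uncurry fun (t s : ℝ) => Real.cos (a * s) * (Real.sin (t * r) * Real.exp (-t * s)))
        ((volume.restrict (Set.Ioc 0 M)).prod (volume.restrict (Set.Ioi 0))) :=
      Continuous.aestronglyMeasurable (by unfold Function.uncurry; fun_prop)
    have hsec : ∀ t : ℝ, 0 < t → Integrable (fun s => Real.exp (-t * s)) (volume.restrict (Set.Ioi 0)) :=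
      fun t ht => integrableOn_exp_mul_Ioi (neg_neg_of_pos ht) 0
    have hb : ∀ t s : ℝ, ‖Real.cos (a * s) * (Real.sin (t * r) * Real.exp (-t * s))‖ ≤ |t * r| * Real.exp (-t * s) := by
      intro t s
      rw [norm_mul, norm_mul, Real.norm_eq_abs, Real.norm_eq_abs, Real.norm_eq_abs, Real.abs_exp]
      have := Real.abs_cos_le_one (a * s)
      have := Real.abs_sin_le_abs (x := t * r)
      have := Real.exp_pos (-t * s)
      calc _ ≤ 1 * (|t * r| * Real.exp (-t * s)) := by gcongr
        _ = _ := one_mul _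
    have hi : ∀ t : ℝ, 0 < t → Integrable (fun s => Real.cos (a * s) * (Real.sin (t * r) * Real.exp (-t * s))) (volume.restrict (Set.Ioi 0)) := by
      intro t ht
      refine ((hsec t ht).const_mul |t * r|).mono' (Continuous.aestronglyMeasurable (by fun_prop)) ?_
      exact Eventually.of_forall fun s => hb t s
    rw [integrable_prod_iff hmeas]
    refine ⟨(ae_restrict_iff' measurableSet_Ioc).2 (Eventually.of_forall fun t ht => hi t ht.1), ?_⟩
    refine Integrable.mono' (g := fun _ => r) (integrableOn_const (by simp)) hmeas.norm.integral_prod_right' ?_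
    refine (ae_restrict_iff' measurableSet_Ioc).2 (Eventually.of_forall fun t ht => ?_)
    rw [Real.norm_of_nonneg (integral_nonneg fun _ => norm_nonneg _)]
    calc _ ≤ ∫ s in Set.Ioi (0:ℝ), |t * r| * Real.exp (-t * s) :=
          integral_mono (hi t ht.1).norm ((hsec t ht.1).const_mul _) (fun s => hb t s)
      _ = r := by
        have ht := ht.1
        rw [integral_const_mul, integral_exp_mul_Ioi (neg_neg_of_pos ht), abs_of_pos (by positivity)]
        simp
        field_simp

lemma yk_lim (r a : ℝ) (hr : 0 < r) (ha : 0 < a) :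
    Tendsto (fun M : ℝ => ∫ t in (0:ℝ)..M, Real.sin (t * r) * (t / (t ^ 2 + a ^ 2))) atTop
      (𝓝 (Real.pi / 2 * Real.exp (-(r * a)))) := by
  rw [tendsto_iff_norm_sub_tendsto_zero]
  have hz : Tendsto (fun M : ℝ => (2 / r) * M⁻¹) atTop (𝓝 0) := by
    simpa using tendsto_inv_atTop_zero.const_mul (2 / r)
  refine squeeze_zero' (Eventually.of_forall fun _ => norm_nonneg _) ?_ hz
  filter_upwards [eventually_gt_atTop 0] with M hM
  have hE : Integrable (fun s => Real.exp (-M * s)) (volume.restrict (Set.Ioi 0)) :=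
    integrableOn_exp_mul_Ioi (neg_neg_of_pos hM) 0
  have hL : Integrable (fun w : ℝ => Real.cos (a * w) * (r / (r ^ 2 + w ^ 2))) (volume.restrict (Set.Ioi 0)) := by
    refine (yk_integrable_lor r hr).integrableOn.bdd_mul (c := 1) ?_ ?_
    · exact Continuous.aestronglyMeasurable (by fun_prop)
    · exact Eventually.of_forall fun s => by simpa using Real.abs_cos_le_one _
  have hbd : ∀ s ∈ Set.Ioi (0:ℝ), ‖Real.cos (a * s) * (-(Real.exp (-M * s) * (r * Real.cos (M * r) + s * Real.sin (M * r)) / (r ^ 2 + s ^ 2)))‖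
      ≤ 2 / r * Real.exp (-M * s) := by
    intro s hs
    have hs : 0 < s := hs
    have hd : 0 < r ^ 2 + s ^ 2 := by positivity
    rw [norm_mul, norm_neg, norm_div, norm_mul, Real.norm_eq_abs, Real.norm_eq_abs, Real.norm_eq_abs, Real.norm_eq_abs,
      Real.abs_exp, abs_of_pos hd]
    have h1 := Real.abs_cos_le_one (a * s)
    have h2 : |r * Real.cos (M * r) + s * Real.sin (M * r)| ≤ r + s := by
      refine (abs_add_le _ _).trans ?_
      rw [abs_mul, abs_mul, abs_of_pos hr, abs_of_pos hs]
      have := Real.abs_cos_le_one (M * r)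
      have := Real.abs_sin_le_one (M * r)
      nlinarith
    have h3 : (r + s) / (r ^ 2 + s ^ 2) ≤ 2 / r := by
      rw [div_le_div_iff₀ hd hr]
      nlinarith [sq_nonneg (r - s), sq_nonneg s]
    calc _ ≤ 1 * (Real.exp (-M * s) * (r + s) / (r ^ 2 + s ^ 2)) := by gcongr
      _ = (r + s) / (r ^ 2 + s ^ 2) * Real.exp (-M * s) := by ring
      _ ≤ _ := by gcongr
  have hR : Integrable (fun s => Real.cos (a * s) * (-(Real.exp (-M * s) * (r * Real.cos (M * r) + s * Real.sin (M * r)) / (r ^ 2 + s ^ 2)))) (volume.restrict (Set.Ioi 0)) := by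
    refine (hE.const_mul (2 / r)).mono' ?_ ((ae_restrict_iff' measurableSet_Ioi).2 (Eventually.of_forall hbd))
    refine Continuous.aestronglyMeasurable ?_
    have : ∀ s : ℝ, r ^ 2 + s ^ 2 ≠ 0 := fun s => by positivity
    fun_prop (disch := assumption)
  rw [yk_fubini r a M hr hM, ← yk_lorentz r a hr ha]
  have : ∀ s : ℝ, Real.cos (a * s) * ∫ t in (0:ℝ)..M, Real.sin (t * r) * Real.exp (-t * s)
    = Real.cos (a * s) * (r / (r ^ 2 + s ^ 2)) + Real.cos (a * s) * (-(Real.exp (-M * s) * (r * Real.cos (M * r) + s * Real.sin (M * r)) / (r ^ 2 + s ^ 2))) := by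
    intro s; rw [yk_inner r s M hr]; ring
  simp only [this]
  rw [integral_add hL hR, add_sub_cancel_left]
  refine (norm_integral_le_of_norm_le (hE.const_mul (2 / r)) ((ae_restrict_iff' measurableSet_Ioi).2 (Eventually.of_forall hbd))).trans ?_
  rw [integral_const_mul, integral_exp_mul_Ioi (neg_neg_of_pos hM)]
  simp

lemma yk_isom (x : EuclideanSpace ℝ (Fin 3)) :
    ∃ e : WithLp 2 (ℝ × ℂ) ≃ₗᵢ[ℝ] EuclideanSpace ℝ (Fin 3), e (WithLp.toLp 2 (‖x‖, 0)) = x := by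
  have hd : Module.finrank ℝ (WithLp 2 (ℝ × ℂ)) = 3 := by
    rw [(WithLp.linearEquiv 2 ℝ (ℝ × ℂ)).finrank_eq, Module.finrank_prod]
    simp [Complex.finrank_real_complex]
  let e0 : WithLp 2 (ℝ × ℂ) ≃ₗᵢ[ℝ] EuclideanSpace ℝ (Fin 3) :=
    ((stdOrthonormalBasis ℝ (WithLp 2 (ℝ × ℂ))).reindex (finCongr hd)).repr
  refine ⟨e0.trans (Submodule.reflection (Submodule.span ℝ {e0 (WithLp.toLp 2 (‖x‖, 0)) - x})ᗮ), ?_⟩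
  rw [LinearIsometryEquiv.trans_apply]
  apply Submodule.reflection_sub
  rw [e0.norm_map]
  have := WithLp.prod_norm_sq_eq_of_L2 (WithLp.toLp 2 ((‖x‖ : ℝ), (0:ℂ)))
  simp at this
  simp

noncomputable def ykh (lam M t y : ℝ) : ℝ := if t ^ 2 + y ^ 2 < M ^ 2 then 1 / (t ^ 2 + y ^ 2 + lam) else 0

lemma yk_red1 (lam : ℝ) (hlam : 0 < lam) (x : EuclideanSpace ℝ (Fin 3)) (M : ℝ) (hM : 0 < M) :
    (∫ p in Metric.ball (0 : EuclideanSpace ℝ (Fin 3)) M,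
          Complex.exp (Complex.I * Complex.ofReal (inner ℝ p x : ℝ)) /
            Complex.ofReal (‖p‖ ^ 2 + lam))
     = ∫ t : ℝ, Complex.exp (Complex.I * ((t * ‖x‖ : ℝ) : ℂ)) * ((∫ z : ℂ, ykh lam M t ‖z‖ : ℝ) : ℂ) := by
  obtain ⟨e, he⟩ := yk_isom x
  have mp : MeasurePreserving (fun q : ℝ × ℂ => e (WithLp.toLp 2 q)) volume volume :=
    e.measurePreserving.comp (WithLp.volume_preserving_toLp ℝ ℂ)
  have me : MeasurableEmbedding (fun q : ℝ × ℂ => e (WithLp.toLp 2 q)) :=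
    e.toMeasurableEquiv.measurableEmbedding.comp (MeasurableEquiv.toLp 2 (ℝ × ℂ)).measurableEmbedding
  have hn : ∀ q : ℝ × ℂ, ‖e (WithLp.toLp 2 q)‖ ^ 2 = q.1 ^ 2 + ‖q.2‖ ^ 2 := by
    intro q
    rw [e.norm_map, WithLp.prod_norm_sq_eq_of_L2]
    simp
  have hi : ∀ q : ℝ × ℂ, inner ℝ (e (WithLp.toLp 2 q)) x = q.1 * ‖x‖ := by
    intro q
    conv_lhs => rw [← he]
    rw [e.inner_map_map, WithLp.prod_inner_apply]
    simp [mul_comm]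
  set F : EuclideanSpace ℝ (Fin 3) → ℂ := fun p => Complex.exp (Complex.I * Complex.ofReal (inner ℝ p x : ℝ)) /
            Complex.ofReal (‖p‖ ^ 2 + lam) with hF
  have hFc : Continuous F := by
    have : ∀ p : EuclideanSpace ℝ (Fin 3), Complex.ofReal (‖p‖ ^ 2 + lam) ≠ 0 := fun p => by
      have : ‖p‖ ^ 2 + lam ≠ 0 := by positivity
      exact_mod_cast this
    rw [hF]
    refine Continuous.div ?_ ?_ this <;> fun_prop
  have hFi : IntegrableOn F (Metric.ball 0 M) :=
    (hFc.locallyIntegrable.integrableOn_isCompact (isCompact_closedBall 0 M)).mono_set Metric.ball_subset_closedBall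
  have hFi2 := (mp.integrableOn_comp_preimage me).2 hFi
  rw [← mp.setIntegral_preimage_emb me]
  have hset : MeasurableSet ((fun q : ℝ × ℂ => e (WithLp.toLp 2 q)) ⁻¹' Metric.ball 0 M) :=
    me.measurable measurableSet_ball
  rw [← integrable_indicator_iff hset] at hFi2
  rw [← integral_indicator hset]
  have hind : (((fun q : ℝ × ℂ => e (WithLp.toLp 2 q)) ⁻¹' Metric.ball 0 M).indicator
      (F ∘ fun q : ℝ × ℂ => e (WithLp.toLp 2 q))) = fun q : ℝ × ℂ =>
        Complex.exp (Complex.I * ((q.1 * ‖x‖ : ℝ) : ℂ)) * ((ykh lam M q.1 ‖q.2‖ : ℝ) : ℂ) := by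
    ext q
    have hmem : q ∈ ((fun q : ℝ × ℂ => e (WithLp.toLp 2 q)) ⁻¹' Metric.ball 0 M) ↔ q.1 ^ 2 + ‖q.2‖ ^ 2 < M ^ 2 := by
      rw [Set.mem_preimage, mem_ball_zero_iff, ← hn, sq_lt_sq₀ (norm_nonneg _) hM.le]
    unfold ykh
    by_cases hq : q.1 ^ 2 + ‖q.2‖ ^ 2 < M ^ 2
    · rw [Set.indicator_of_mem (hmem.2 hq), if_pos hq]
      simp only [Function.comp, hF, hi, hn]
      push_cast
      ring
    · rw [Set.indicator_of_notMem (fun h => hq (hmem.1 h)), if_neg hq]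
      simp
  rw [hind] at hFi2
  change ∫ q, (((fun q : ℝ × ℂ => e (WithLp.toLp 2 q)) ⁻¹' Metric.ball 0 M).indicator
      (F ∘ fun q : ℝ × ℂ => e (WithLp.toLp 2 q))) q = _
  rw [hind, Measure.volume_eq_prod, integral_prod _ hFi2]
  congr 1
  ext t
  simp only
  rw [integral_const_mul]
  congr 1
  exact integral_ofReal (𝕜 := ℂ) (f := fun z : ℂ => ykh lam M t ‖z‖)

lemma yk_radial (lam : ℝ) (hlam : 0 < lam) (M t : ℝ) (hM : 0 < M) :
    ∫ z : ℂ, ykh lam M t ‖z‖ =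
      (Set.Ioc (-M) M).indicator (fun t => Real.pi * (Real.log (M ^ 2 + lam) - Real.log (t ^ 2 + lam))) t := by
  rw [integral_fun_norm_addHaar volume (ykh lam M t)]
  have hv : (volume : Measure ℂ).real (Metric.ball 0 1) = Real.pi := by
    simp [Measure.real, Complex.volume_ball]
  rw [hv, Complex.finrank_real_complex]
  simp only [smul_eq_mul, nsmul_eq_mul, Nat.cast_ofNat, Nat.add_one_sub_one, pow_one]
  by_cases ht : t ∈ Set.Ioc (-M) M
  · rw [Set.indicator_of_mem ht]
    have h0 : 0 ≤ M ^ 2 - t ^ 2 := by nlinarith [ht.1, ht.2]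
    set R := Real.sqrt (M ^ 2 - t ^ 2) with hR
    have hR2 : R ^ 2 = M ^ 2 - t ^ 2 := Real.sq_sqrt h0
    have hR0 : 0 ≤ R := Real.sqrt_nonneg _
    have e1 : ∫ y in Set.Ioi (0:ℝ), y * ykh lam M t y = ∫ y in Set.Ioo (0:ℝ) R, y / (t ^ 2 + y ^ 2 + lam) := by
      rw [← integral_indicator measurableSet_Ioi, ← integral_indicator measurableSet_Ioo]
      congr 1
      ext y
      unfold ykh
      by_cases hy : 0 < y
      · rw [Set.indicator_of_mem (show y ∈ Set.Ioi 0 from hy)]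
        by_cases hy2 : y < R
        · rw [Set.indicator_of_mem (show y ∈ Set.Ioo 0 R from ⟨hy, hy2⟩), if_pos (by nlinarith)]
          ring
        · rw [Set.indicator_of_notMem (fun h => hy2 h.2), if_neg (by nlinarith)]
          ring
      · rw [Set.indicator_of_notMem (show y ∉ Set.Ioi 0 from hy), Set.indicator_of_notMem (fun h => hy h.1)]
    rw [e1, ← integral_Ioc_eq_integral_Ioo, ← intervalIntegral.integral_of_le hR0]
    rw [intervalIntegral.integral_eq_sub_of_hasDerivAt (f := fun y => Real.log (t ^ 2 + y ^ 2 + lam) / 2)]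
    · rw [hR2, show t ^ 2 + (M ^ 2 - t ^ 2) + lam = M ^ 2 + lam by ring, show t ^ 2 + 0 ^ 2 + lam = t ^ 2 + lam by ring]
      ring
    · intro y _
      have hne : t ^ 2 + y ^ 2 + lam ≠ 0 := by positivity
      have := (((((hasDerivAt_id y).pow 2).const_add (t ^ 2)).add_const lam).log hne).div_const 2
      refine this.congr_deriv ?_
      simp
      ring
    · have : ∀ y : ℝ, t ^ 2 + y ^ 2 + lam ≠ 0 := fun y => by positivity
      exact Continuous.intervalIntegrable (by fun_prop (disch := assumption)) _ _
  · rw [Set.indicator_of_notMem ht]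
    have : ∀ y : ℝ, ykh lam M t y = 0 := by
      intro y
      unfold ykh
      rw [if_neg]
      intro h
      have : t ^ 2 < M ^ 2 := by nlinarith [sq_nonneg y]
      have := abs_lt_of_sq_lt_sq this hM.le
      rw [abs_lt] at this
      exact ht ⟨this.1, this.2.le⟩
    simp [this]

lemma yk_red2 (lam : ℝ) (hlam : 0 < lam) (r : ℝ) (hr : 0 < r) (M : ℝ) (hM : 0 < M) :
    ∫ t : ℝ, Complex.exp (Complex.I * ((t * r : ℝ) : ℂ)) * ((∫ z : ℂ, ykh lam M t ‖z‖ : ℝ) : ℂ)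
     = ((4 * Real.pi / r * ∫ t in (0:ℝ)..M, Real.sin (t * r) * (t / (t ^ 2 + lam)) : ℝ) : ℂ) := by
  set g : ℝ → ℝ := fun t => Real.pi * (Real.log (M ^ 2 + lam) - Real.log (t ^ 2 + lam)) with hg
  have hp : ∀ y : ℝ, y ^ 2 + lam ≠ 0 := fun y => by positivity
  have hgc : Continuous g := by rw [hg]; fun_prop (disch := assumption)
  have e1 : ∀ t : ℝ, Complex.exp (Complex.I * ((t * r : ℝ) : ℂ)) * ((∫ z : ℂ, ykh lam M t ‖z‖ : ℝ) : ℂ)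
      = (Set.Ioc (-M) M).indicator (fun t : ℝ => Complex.exp (Complex.I * ((t * r : ℝ) : ℂ)) * (g t : ℂ)) t := by
    intro t
    rw [yk_radial lam hlam M t hM]
    by_cases ht : t ∈ Set.Ioc (-M) M
    · rw [Set.indicator_of_mem ht, Set.indicator_of_mem ht]
    · rw [Set.indicator_of_notMem ht, Set.indicator_of_notMem ht]; simp
  simp only [e1]
  rw [integral_indicator measurableSet_Ioc, ← intervalIntegral.integral_of_le (by linarith)]
  set k : ℝ → ℂ := fun t : ℝ => Complex.exp (Complex.I * ((t * r : ℝ) : ℂ)) * (g t : ℂ) with hk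
  have hkc : Continuous k := by rw [hk]; fun_prop
  have e2 : ∫ t in (-M)..M, k t = ∫ t in (0:ℝ)..M, ((2 * (Real.cos (t * r) * g t) : ℝ) : ℂ) := by
    rw [← intervalIntegral.integral_add_adjacent_intervals (b := 0) (hkc.intervalIntegrable _ _) (hkc.intervalIntegrable _ _)]
    have := intervalIntegral.integral_comp_neg (a := 0) (b := M) k
    rw [neg_zero] at this
    rw [← this, ← intervalIntegral.integral_add]
    · congr 1
      ext t
      simp only [hk, hg]
      rw [neg_sq, ← add_mul]
      push_cast
      rw [Complex.cos]
      ring_nf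
    · exact Continuous.intervalIntegrable (by fun_prop) _ _
    · exact Continuous.intervalIntegrable (by fun_prop) _ _
  rw [e2, intervalIntegral.integral_ofReal, intervalIntegral.integral_const_mul]
  congr 1
  have hg' : ∀ t : ℝ, HasDerivAt g (-(2 * Real.pi * (t / (t ^ 2 + lam)))) t := by
    intro t
    have := ((((((hasDerivAt_id t).pow 2).add_const lam).log (hp t))).const_sub (Real.log (M ^ 2 + lam))).const_mul Real.pi
    refine this.congr_deriv ?_
    simp
    ring
  have hs' : ∀ t : ℝ, HasDerivAt (fun t => Real.sin (t * r) / r) (Real.cos (t * r)) t := by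
    intro t
    have := (((hasDerivAt_id t).mul_const r).sin).div_const r
    refine this.congr_deriv ?_
    simp
    field_simp
  have ibp := intervalIntegral.integral_mul_deriv_eq_deriv_mul (a := 0) (b := M) (fun t _ => hg' t) (fun t _ => hs' t)
    (Continuous.intervalIntegrable (by fun_prop (disch := assumption)) _ _)
    (Continuous.intervalIntegrable (by fun_prop) _ _)
  have hgM : g M = 0 := by simp [hg]
  have c1 : ∫ t in (0:ℝ)..M, Real.cos (t * r) * g t = ∫ t in (0:ℝ)..M, g t * Real.cos (t * r) := by
    congr 1; ext t; ring
  have c2 : ∫ t in (0:ℝ)..M, -(2 * Real.pi * (t / (t ^ 2 + lam))) * (Real.sin (t * r) / r)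
      = -(2 * Real.pi / r) * ∫ t in (0:ℝ)..M, Real.sin (t * r) * (t / (t ^ 2 + lam)) := by
    rw [← intervalIntegral.integral_const_mul]
    congr 1; ext t; ring
  rw [c1, ibp, c2, hgM]
  simp
  ring

/-- The inverse Fourier transform of `p ↦ 1/(|p|²+λ)` on `ℝ³` is the Yukawa potential:
for `λ > 0` and `x ≠ 0`, the improper integral (limit over balls) of
`e^{i p·x}/(|p|² + λ)` equals `2π² e^{−√λ|x|}/|x|`. -/
theorem stmt_0 (lam : ℝ) (hlam : 0 < lam) (x : EuclideanSpace ℝ (Fin 3)) (hx : x ≠ 0) :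
    Tendsto (fun M : ℝ =>
        ∫ p in Metric.ball (0 : EuclideanSpace ℝ (Fin 3)) M,
          Complex.exp (Complex.I * Complex.ofReal (inner ℝ p x : ℝ)) /
            Complex.ofReal (‖p‖ ^ 2 + lam))
      atTop
      (𝓝 (Complex.ofReal (2 * Real.pi ^ 2 * Real.exp (-Real.sqrt lam * ‖x‖) / ‖x‖))) := by
  have hr : 0 < ‖x‖ := norm_pos_iff.2 hx
  have h := ((yk_lim ‖x‖ (Real.sqrt lam) hr (Real.sqrt_pos.2 hlam)).const_mul (4 * Real.pi / ‖x‖)).ofReal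
  rw [Real.sq_sqrt hlam.le] at h
  have hv : (4 * Real.pi / ‖x‖ * (Real.pi / 2 * Real.exp (-(‖x‖ * Real.sqrt lam))))
      = 2 * Real.pi ^ 2 * Real.exp (-Real.sqrt lam * ‖x‖) / ‖x‖ := by
    rw [show -(‖x‖ * Real.sqrt lam) = -Real.sqrt lam * ‖x‖ by ring]
    ring
  rw [hv] at h
  refine Tendsto.congr' ?_ h
  filter_upwards [eventually_gt_atTop 0] with M hM
  rw [yk_red1 lam hlam x M hM, yk_red2 lam hlam ‖x‖ hr M hM]
end

section
/- Let λ > 0 and let f : ℝ³ → ℂ be a Schwartz function. Define u(x) = (1/(4π)) ∫_{ℝ³} g^λ(x−y) f(y) dy. Then u is twice continuously differentiable and satisfies −Δu(x) + λ u(x) = f(x) for every x ∈ ℝ³. -/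
open MeasureTheory Filter Topology

abbrev E3 := EuclideanSpace ℝ (Fin 3)

lemma conv_int {V : Type} [NormedAddCommGroup V] [NormedSpace ℝ V]
    {g : E3 → ℝ} (hg : Integrable g) (F : SchwartzMap E3 V) (x : E3) :
    Integrable (fun y => g y • F (x - y)) := by
  refine hg.smul_bdd (C := SchwartzMap.seminorm ℝ 0 0 F) ?_ ?_
  · exact (F.continuous.comp (by fun_prop)).aestronglyMeasurable
  · exact Eventually.of_forall fun y => F.norm_le_seminorm ℝ _

lemma conv_hasFDerivAt {V : Type} [NormedAddCommGroup V] [NormedSpace ℝ V] [CompleteSpace V]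
    {g : E3 → ℝ} (hg : Integrable g) (F : SchwartzMap E3 V) (x : E3) :
    HasFDerivAt (fun x => ∫ y, g y • F (x - y))
      (∫ y, g y • SchwartzMap.fderivCLM ℝ E3 V F (x - y)) x := by
  refine hasFDerivAt_integral_of_dominated_of_fderiv_le
    (bound := fun y => ‖g y‖ * SchwartzMap.seminorm ℝ 0 0 (SchwartzMap.fderivCLM ℝ E3 V F))
    (s := Set.univ) (F' := fun x y => g y • SchwartzMap.fderivCLM ℝ E3 V F (x - y)) univ_mem ?_ ?_ ?_ ?_ ?_ ?_
  · exact Eventually.of_forall fun x => (conv_int hg F x).aestronglyMeasurable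
  · exact conv_int hg F x
  · exact (conv_int hg _ x).aestronglyMeasurable
  · refine Eventually.of_forall fun y z _ => ?_
    rw [norm_smul]
    gcongr
    exact SchwartzMap.norm_le_seminorm ℝ _ _
  · exact hg.norm.mul_const _
  · refine Eventually.of_forall fun y z _ => ?_
    have h1 : HasFDerivAt F (fderiv ℝ F (z - y)) (z - y) := (F.differentiable _).hasFDerivAt
    have h2 : HasFDerivAt (fun z : E3 => z - y) (ContinuousLinearMap.id ℝ E3) z :=
      (hasFDerivAt_id z).sub_const y
    exact (h1.comp z h2).const_smul (g y)

lemma conv_contDiff {g : E3 → ℝ} (hg : Integrable g) (n : ℕ) :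
    ∀ {V : Type} [NormedAddCommGroup V] [NormedSpace ℝ V] [CompleteSpace V]
    (F : SchwartzMap E3 V), ContDiff ℝ n (fun x => ∫ y, g y • F (x - y)) := by
  induction n with
  | zero =>
    intro V _ _ _ F
    rw [Nat.cast_zero, contDiff_zero]
    exact continuous_iff_continuousAt.2 fun x => (conv_hasFDerivAt hg F x).continuousAt
  | succ n ih =>
    intro V _ _ _ F
    rw [Nat.cast_succ]
    exact contDiff_succ_iff_hasFDerivAt.2 ⟨_, ih (SchwartzMap.fderivCLM ℝ E3 V F), conv_hasFDerivAt hg F⟩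

open LineDeriv in
lemma conv_fderiv {V : Type} [NormedAddCommGroup V] [NormedSpace ℝ V] [CompleteSpace V]
    {g : E3 → ℝ} (hg : Integrable g) (F : SchwartzMap E3 V) (x e : E3) :
    fderiv ℝ (fun x => ∫ y, g y • F (x - y)) x e = ∫ y, g y • (∂_{e} F) (x - y) := by
  rw [(conv_hasFDerivAt hg F x).fderiv, ContinuousLinearMap.integral_apply (conv_int hg _ x)]
  rfl

lemma g_int {k : ℝ} (hk : 0 < k) : Integrable (fun y : E3 => Real.exp (-k * ‖y‖) / ‖y‖) := by
  have := (integrable_fun_norm_addHaar (volume : Measure E3)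
    (f := fun r => Real.exp (-k * r) / r)).2
  apply this
  have h := integrableOn_rpow_mul_exp_neg_mul_rpow (p := 1) (s := 1) (b := k) (by norm_num) (by norm_num) hk
  refine h.congr_fun ?_ measurableSet_Ioi
  intro r hr
  have : r ≠ 0 := ne_of_gt hr
  simp
  field_simp

lemma hasDerivAt_aux (r : ℝ) : HasDerivAt (fun r : ℝ => (1/3) * (r / √(r^2+1))^3)
    (r^2 * (1/(√(r^2+1))^5)) r := by
  have hp : 0 < r^2+1 := by positivity
  have hs : 0 < √(r^2+1) := by positivity
  have h1 : HasDerivAt (fun r : ℝ => r^2+1) (2*r) r := by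
    simpa using (hasDerivAt_pow 2 r).add_const (1:ℝ)
  have h2 := (((hasDerivAt_id r).div (h1.sqrt hp.ne') hs.ne').pow 3).const_mul (1/3 : ℝ)
  refine h2.congr_deriv ?_
  have h3 : √(r^2+1)^2 = r^2+1 := Real.sq_sqrt hp.le
  simp only [id, Pi.div_apply]
  generalize √(r^2+1) = s at *
  simp
  field_simp
  rw [h3]; ring

lemma tendsto_aux : Tendsto (fun r : ℝ => (1/3) * (r / √(r^2+1))^3) atTop (𝓝 (1/3)) := by
  have h : Tendsto (fun r : ℝ => √(1 - 1/(r^2+1))) atTop (𝓝 (√(1-0))) := by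
    refine (Real.continuous_sqrt.tendsto _).comp (tendsto_const_nhds.sub ?_)
    refine tendsto_const_nhds.div_atTop ?_
    exact tendsto_atTop_add_const_right _ _ (tendsto_pow_atTop (by norm_num))
  have h2 : Tendsto (fun r : ℝ => r / √(r^2+1)) atTop (𝓝 1) := by
    simp at h
    refine h.congr' ?_
    filter_upwards [eventually_gt_atTop 0] with r hr
    have : (1 - (r^2+1)⁻¹ : ℝ) = r^2/(r^2+1) := by field_simp; ring
    rw [this, Real.sqrt_div (by positivity), Real.sqrt_sq hr.le]
  simpa using (h2.pow 3).const_mul (1/3 : ℝ)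

lemma sig_int : Integrable (fun y : E3 => 1 / (√(‖y‖^2+1))^5) := by
  apply (integrable_fun_norm_addHaar (volume : Measure E3) (f := fun r => 1 / (√(r^2+1))^5)).2
  have := integrableOn_Ioi_deriv_of_nonneg' (a := 0) (fun x _ => hasDerivAt_aux x) (fun x _ => by positivity) tendsto_aux
  simpa using this

lemma sig_val : ∫ y : E3, 1 / (√(‖y‖^2+1))^5 = 4 * Real.pi / 3 := by
  have := integral_fun_norm_addHaar (volume : Measure E3) (f := fun r => 1 / (√(r^2+1))^5)
  rw [this]
  have := integral_Ioi_of_hasDerivAt_of_nonneg' (a := 0) (fun x _ => hasDerivAt_aux x) (fun x _ => by positivity) tendsto_aux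
  simp only [finrank_euclideanSpace, Fintype.card_fin, smul_eq_mul, Nat.add_one_sub_one]
  rw [this, Measure.real, EuclideanSpace.volume_ball_fin_three]
  simp
  rw [ENNReal.toReal_ofReal (by positivity)]
  ring

noncomputable def GG (k s : ℝ) : ℝ := Real.exp (-k * s) / s
noncomputable def AA (k s : ℝ) : ℝ := -(Real.exp (-k * s) * (k / s^2 + 1 / s^3))
noncomputable def BB (k s : ℝ) : ℝ := Real.exp (-k * s) * (k^2 / s^3 + 3 * k / s^4 + 3 / s^5)
noncomputable def SS (ε : ℝ) (y : E3) : ℝ := √(‖y‖^2 + ε^2)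

lemma GG_deriv (k : ℝ) {s : ℝ} (hs : 0 < s) : HasDerivAt (GG k) (s * AA k s) s := by
  have h1 : HasDerivAt (fun s => Real.exp (-k * s)) (Real.exp (-k * s) * (-k)) s := by
    simpa using ((hasDerivAt_id s).const_mul (-k)).exp
  refine (h1.div (hasDerivAt_id s) hs.ne').congr_deriv ?_
  simp only [AA, id]
  field_simp
  ring

lemma AA_deriv (k : ℝ) {s : ℝ} (hs : 0 < s) : HasDerivAt (AA k) (s * BB k s) s := by
  have h1 : HasDerivAt (fun s => Real.exp (-k * s)) (Real.exp (-k * s) * (-k)) s := by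
    simpa using ((hasDerivAt_id s).const_mul (-k)).exp
  have h2 : HasDerivAt (fun s : ℝ => k / s^2 + 1 / s^3) (-2 * k / s^3 - 3 / s^4) s := by
    refine (((hasDerivAt_const s k).div (hasDerivAt_pow 2 s) (by positivity)).add
      ((hasDerivAt_const s (1:ℝ)).div (hasDerivAt_pow 3 s) (by positivity))).congr_deriv ?_
    simp
    field_simp
    ring
  refine (h1.mul h2).neg.congr_deriv ?_
  simp only [BB]
  field_simp
  ring

lemma SS_pos {ε : ℝ} (hε : 0 < ε) (y : E3) : 0 < SS ε y := by
  unfold SS; positivity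

lemma SS_ge {ε : ℝ} (hε : 0 < ε) (y : E3) : ε ≤ SS ε y :=
  Real.le_sqrt_of_sq_le (by nlinarith [sq_nonneg ‖y‖])

lemma norm_le_SS (ε : ℝ) (y : E3) : ‖y‖ ≤ SS ε y :=
  Real.le_sqrt_of_sq_le (by nlinarith [sq_nonneg ε])

lemma SS_sq (ε : ℝ) (y : E3) : SS ε y ^ 2 = ‖y‖^2 + ε^2 := Real.sq_sqrt (by positivity)

lemma SS_cont (ε : ℝ) : Continuous (SS ε) := by
  unfold SS; fun_prop

lemma SS_deriv {ε : ℝ} (hε : 0 < ε) (y : E3) :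
    HasFDerivAt (SS ε) ((1 / SS ε y) • innerSL ℝ y) y := by
  have h1 : HasFDerivAt (fun y : E3 => ‖y‖^2 + ε^2) (2 • innerSL ℝ y) y :=
    ((hasStrictFDerivAt_norm_sq y).hasFDerivAt).add_const _
  have h2 := h1.sqrt (by positivity)
  refine h2.congr_fderiv ?_
  ext v
  simp [SS]
  ring

lemma chain {ε : ℝ} (hε : 0 < ε) (y : E3) {φ : ℝ → ℝ} {c : ℝ}
    (h : HasDerivAt φ (SS ε y * c) (SS ε y)) :
    HasFDerivAt (fun y => φ (SS ε y)) (c • innerSL ℝ y) y := by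
  refine (h.comp_hasFDerivAt y (SS_deriv hε y)).congr_fderiv ?_
  have := SS_pos hε y
  ext v
  simp
  field_simp

lemma bdd_int {V : Type} [NormedAddCommGroup V] [NormedSpace ℝ V]
    {φ : E3 → ℝ} (hc : Continuous φ) {C : ℝ} (hb : ∀ y, |φ y| ≤ C)
    (F : SchwartzMap E3 V) (x : E3) :
    Integrable (fun y => φ y • F (x - y)) := by
  have h : Integrable (fun y => F (x - y)) := F.integrable.comp_sub_left x
  exact h.bdd_smul C hc.aestronglyMeasurable (Eventually.of_forall hb)

open LineDeriv in
lemma ibp {φ φ' : E3 → ℝ} {e : E3} (hc : Continuous φ) (hc' : Continuous φ') {C C' : ℝ}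
    (hb : ∀ y, |φ y| ≤ C) (hb' : ∀ y, |φ' y| ≤ C')
    (hd : ∀ y, HasLineDerivAt ℝ φ (φ' y) y e) (F : SchwartzMap E3 ℂ) (x : E3) :
    ∫ y, φ y • (∂_{e} F) (x - y) = ∫ y, φ' y • F (x - y) := by
  have h := integral_bilinear_hasLineDerivAt_right_eq_neg_left_of_integrable
    (μ := (volume : Measure E3)) (f := φ) (f' := φ') (g := fun y => F (x - y))
    (g' := fun y => -((∂_{e} F) (x - y))) (v := e) (B := ContinuousLinearMap.lsmul ℝ ℝ)
    (bdd_int hc' hb' F x) (by simpa using (bdd_int hc hb (∂_{e} F) x).neg) (bdd_int hc hb F x)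
    (fun y _ => hd y) ?_
  · simpa [integral_neg] using h
  · intro y _
    have h1 : HasFDerivAt F (fderiv ℝ F (x - y)) (x - y) := (F.differentiable _).hasFDerivAt
    have h2 : HasFDerivAt (fun z : E3 => x - z) (-ContinuousLinearMap.id ℝ E3) y :=
      (hasFDerivAt_id y).const_sub x
    have h3 : HasLineDerivAt ℝ (fun y => F (x - y)) _ y e := (h1.comp y h2).hasLineDerivAt e
    simpa [SchwartzMap.lineDerivOp_apply_eq_fderiv] using h3

noncomputable abbrev ee (i : Fin 3) : E3 := EuclideanSpace.single i 1

lemma coord_le (y : E3) (i : Fin 3) : |y i| ≤ ‖y‖ := by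
  simpa using PiLp.norm_apply_le y i

section
variable {k ε : ℝ} (hk : 0 < k) (hε : 0 < ε)

lemma GG_bd (hk : 0 < k) (hε : 0 < ε) {s : ℝ} (hs : ε ≤ s) : |GG k s| ≤ 1 / ε := by
  have h0 : 0 < s := hε.trans_le hs
  have he : Real.exp (-k * s) ≤ 1 := Real.exp_le_one_iff.2 (by nlinarith)
  unfold GG
  rw [abs_of_nonneg (by positivity)]
  gcongr

lemma AA_bd (hk : 0 < k) (hε : 0 < ε) {s : ℝ} (hs : ε ≤ s) : |AA k s| ≤ k / ε^2 + 1 / ε^3 := by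
  have h0 : 0 < s := hε.trans_le hs
  have he : Real.exp (-k * s) ≤ 1 := Real.exp_le_one_iff.2 (by nlinarith)
  unfold AA
  rw [abs_neg, abs_of_nonneg (by positivity)]
  calc _ ≤ 1 * (k / s^2 + 1 / s^3) := by gcongr
    _ ≤ _ := by rw [one_mul]; gcongr

lemma AA_bd' (hk : 0 < k) (hε : 0 < ε) {s : ℝ} (hs : ε ≤ s) : |AA k s| * s ≤ k / ε + 1 / ε^2 := by
  have h0 : 0 < s := hε.trans_le hs
  have he : Real.exp (-k * s) ≤ 1 := Real.exp_le_one_iff.2 (by nlinarith)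
  unfold AA
  rw [abs_neg, abs_of_nonneg (by positivity)]
  calc _ ≤ 1 * (k / s^2 + 1 / s^3) * s := by gcongr
    _ = k / s + 1 / s^2 := by field_simp
    _ ≤ _ := by gcongr

lemma BB_bd (hk : 0 < k) (hε : 0 < ε) {s : ℝ} (hs : ε ≤ s) :
    |BB k s| * s^2 ≤ k^2 / ε + 3 * k / ε^2 + 3 / ε^3 := by
  have h0 : 0 < s := hε.trans_le hs
  have he : Real.exp (-k * s) ≤ 1 := Real.exp_le_one_iff.2 (by nlinarith)
  unfold BB
  rw [abs_of_nonneg (by positivity)]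
  calc _ ≤ 1 * (k^2 / s^3 + 3 * k / s^4 + 3 / s^5) * s^2 := by gcongr
    _ = k^2 / s + 3 * k / s^2 + 3 / s^3 := by field_simp
    _ ≤ _ := by gcongr

lemma GG_cont (hε : 0 < ε) : Continuous (fun y => GG k (SS ε y)) := by
  have := fun y => (SS_pos hε y).ne'
  have := SS_cont ε
  unfold GG; fun_prop (disch := simp [*])

lemma AA_cont (hε : 0 < ε) : Continuous (fun y => AA k (SS ε y)) := by
  have := fun y => (SS_pos hε y).ne'
  have := SS_cont ε
  unfold AA; fun_prop (disch := simp [*])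

lemma BB_cont (hε : 0 < ε) : Continuous (fun y => BB k (SS ε y)) := by
  have := fun y => (SS_pos hε y).ne'
  have := SS_cont ε
  unfold BB; fun_prop (disch := simp [*])

open LineDeriv in
lemma ibp2 (hk : 0 < k) (hε : 0 < ε) (F : SchwartzMap E3 ℂ) (x : E3) (i : Fin 3) :
    ∫ y, GG k (SS ε y) • (∂_{ee i} (∂_{ee i} F)) (x - y) =
      ∫ y, (BB k (SS ε y) * (y i)^2 + AA k (SS ε y)) • F (x - y) := by
  have b1 : ∀ y : E3, |AA k (SS ε y) * y i| ≤ k / ε + 1 / ε^2 := fun y => by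
    rw [abs_mul]
    refine le_trans ?_ (AA_bd' hk hε (SS_ge hε y))
    gcongr
    exact (coord_le y i).trans (norm_le_SS ε y)
  have b2 : ∀ y : E3, |BB k (SS ε y) * (y i)^2 + AA k (SS ε y)| ≤
      (k^2 / ε + 3 * k / ε^2 + 3 / ε^3) + (k / ε^2 + 1 / ε^3) := fun y => by
    refine (abs_add_le _ _).trans (add_le_add ?_ (AA_bd hk hε (SS_ge hε y)))
    rw [abs_mul, abs_pow]
    refine le_trans ?_ (BB_bd hk hε (SS_ge hε y))
    gcongr
    exact (coord_le y i).trans (norm_le_SS ε y)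
  have cc : Continuous fun y : E3 => y i := by fun_prop
  have c1 : Continuous fun y : E3 => AA k (SS ε y) * y i := (AA_cont hε).mul cc
  have c2 : Continuous fun y : E3 => BB k (SS ε y) * (y i)^2 + AA k (SS ε y) :=
    ((BB_cont hε).mul (cc.pow 2)).add (AA_cont hε)
  have d1 : ∀ y, HasLineDerivAt ℝ (fun y => GG k (SS ε y)) (AA k (SS ε y) * y i) y (ee i) := ?_
  have d2 : ∀ y : E3, HasLineDerivAt ℝ (fun y : E3 => AA k (SS ε y) * y i)
    (BB k (SS ε y) * (y i)^2 + AA k (SS ε y)) y (ee i) := ?_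
  rw [ibp (GG_cont hε) c1 (fun y => GG_bd hk hε (SS_ge hε y)) b1 d1, ibp c1 c2 b1 b2 d2]
  · intro y
    have h1 := chain hε y (AA_deriv k (SS_pos hε y))
    have h2 : HasFDerivAt (fun y : E3 => y i) (EuclideanSpace.proj i : E3 →L[ℝ] ℝ) y :=
      (EuclideanSpace.proj i : E3 →L[ℝ] ℝ).hasFDerivAt
    have h3 : HasLineDerivAt ℝ (fun y : E3 => AA k (SS ε y) * y i) _ y (ee i) :=
      (h1.mul h2).hasLineDerivAt (ee i)
    refine (congrArg (fun c => HasLineDerivAt ℝ (fun y : E3 => AA k (SS ε y) * y i) c y (ee i)) ?_).mp h3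
    simp [ee, EuclideanSpace.inner_single_right]
    ring
  · intro y
    have h1 := (chain hε y (GG_deriv k (SS_pos hε y))).hasLineDerivAt (ee i)
    refine (congrArg (fun c => HasLineDerivAt ℝ (fun y : E3 => GG k (SS ε y)) c y (ee i)) ?_).mp h1
    simp [ee, EuclideanSpace.inner_single_right]

open LineDeriv in
lemma reg_id (hk : 0 < k) (hε : 0 < ε) (F : SchwartzMap E3 ℂ) (x : E3) :
    ∫ y, GG k (SS ε y) • (k^2 • F (x - y) - ∑ i, (∂_{ee i} (∂_{ee i} F)) (x - y)) =
      ∫ y, (ε^2 * BB k (SS ε y)) • F (x - y) := by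
  have cc : ∀ i, Continuous fun y : E3 => y i := fun i => by fun_prop
  have b2 : ∀ i, ∀ y : E3, |BB k (SS ε y) * (y i)^2 + AA k (SS ε y)| ≤
      (k^2 / ε + 3 * k / ε^2 + 3 / ε^3) + (k / ε^2 + 1 / ε^3) := fun i y => by
    refine (abs_add_le _ _).trans (add_le_add ?_ (AA_bd hk hε (SS_ge hε y)))
    rw [abs_mul, abs_pow]
    refine le_trans ?_ (BB_bd hk hε (SS_ge hε y))
    gcongr
    exact (coord_le y i).trans (norm_le_SS ε y)
  have hI : ∀ H : SchwartzMap E3 ℂ, Integrable (fun y => GG k (SS ε y) • H (x - y)) := fun H =>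
    bdd_int (GG_cont hε) (fun y => GG_bd hk hε (SS_ge hε y)) H x
  have hJ : ∀ i, Integrable (fun y : E3 =>
      (BB k (SS ε y) * (y i)^2 + AA k (SS ε y)) • F (x - y)) := fun i =>
    bdd_int (((BB_cont hε).mul ((cc i).pow 2)).add (AA_cont hε)) (b2 i) F x
  have e1 : ∀ y, GG k (SS ε y) • (k^2 • F (x - y) - ∑ i, (∂_{ee i} (∂_{ee i} F)) (x - y)) =
      k^2 • (GG k (SS ε y) • F (x - y)) -
        ∑ i, GG k (SS ε y) • (∂_{ee i} (∂_{ee i} F)) (x - y) := fun y => by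
    rw [smul_sub, Finset.smul_sum, smul_comm]
  simp_rw [e1]
  rw [integral_sub, integral_smul, integral_finsetSum]
  · simp_rw [ibp2 hk hε]
    rw [← integral_smul, ← integral_finsetSum, ← integral_sub]
    · refine integral_congr_ae (Eventually.of_forall fun y => ?_)
      simp only
      rw [← Finset.sum_smul, smul_smul, ← sub_smul]
      congr 1
      have h0 := SS_pos hε y
      have h1 := SS_sq ε y
      rw [EuclideanSpace.real_norm_sq_eq] at h1
      simp only [Fin.sum_univ_three] at h1 ⊢
      have h2 : k^2 * GG k (SS ε y) = SS ε y ^ 2 * BB k (SS ε y) + 3 * AA k (SS ε y) := by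
        simp only [GG, AA, BB]
        field_simp
        ring
      rw [h2, h1]
      ring
    · exact (hI F).smul (k^2)
    · exact integrable_finsetSum _ fun i _ => hJ i
    · exact fun i _ => hJ i
  · exact fun i _ => hI _
  · exact (hI F).smul (k^2)
  · exact integrable_finsetSum _ fun i _ => hI _

lemma scaled (hε : 0 < ε) (F : SchwartzMap E3 ℂ) (x : E3) :
    ∫ y, (ε^2 * BB k (SS ε y)) • F (x - y) =
    ∫ z, (Real.exp (-(k * ε * √(‖z‖^2+1))) * ((k * ε * √(‖z‖^2+1))^2 + 3 * (k * ε * √(‖z‖^2+1)) + 3)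
      * (1 / √(‖z‖^2+1)^5)) • F (x - ε • z) := by
  have h := Measure.integral_comp_smul (volume : Measure E3)
    (fun y => (ε^5 * BB k (SS ε y)) • F (x - y)) ε
  have h2 : ∫ y, (ε^5 * BB k (SS ε y)) • F (x - y) =
      ε^3 • ∫ y, (ε^2 * BB k (SS ε y)) • F (x - y) := by
    rw [← integral_smul]
    congr 1; ext1 y
    rw [smul_smul]; ring_nf
  rw [h2, smul_smul] at h
  have h3 : |(ε ^ Module.finrank ℝ E3)⁻¹| * ε^3 = 1 := by
    rw [abs_of_pos (by positivity)]
    simp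
    field_simp
  rw [h3, one_smul] at h
  rw [← h]
  congr 1; ext1 z
  congr 1
  have : SS ε (ε • z) = ε * √(‖z‖^2+1) := by
    rw [SS, norm_smul, Real.norm_of_nonneg hε.le,
      show (ε * ‖z‖)^2 + ε^2 = ε^2 * (‖z‖^2+1) by ring, Real.sqrt_mul (by positivity),
      Real.sqrt_sq hε.le]
  rw [this, BB]
  have : 0 < √(‖z‖^2+1) := by positivity
  generalize √(‖z‖^2+1) = s at *
  rw [show -k * (ε * s) = -(k * ε * s) by ring]
  field_simp
end

lemma exp_bd {t : ℝ} (ht : 0 ≤ t) : Real.exp (-t) * (t^2 + 3 * t + 3) ≤ 3 := by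
  rw [Real.exp_neg, inv_mul_le_iff₀ (Real.exp_pos t)]
  nlinarith [Real.quadratic_le_exp_of_nonneg ht]

lemma lim_right {k : ℝ} (hk : 0 < k) (F : SchwartzMap E3 ℂ) (x : E3) :
    Tendsto (fun ε : ℝ => ∫ y, (ε^2 * BB k (SS ε y)) • F (x - y)) (𝓝[>] 0)
      (𝓝 ((4 * Real.pi) • F x)) := by
  have hlim : (4 * Real.pi) • F x = ∫ z : E3, (3 * (1 / √(‖z‖^2+1)^5)) • F x := by
    rw [integral_smul_const, integral_const_mul, sig_val]
    congr 1; ring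
  rw [hlim]
  have hF := F.continuous
  have : Tendsto (fun ε : ℝ => ∫ z, (Real.exp (-(k * ε * √(‖z‖^2+1))) *
      ((k * ε * √(‖z‖^2+1))^2 + 3 * (k * ε * √(‖z‖^2+1)) + 3)
      * (1 / √(‖z‖^2+1)^5)) • F (x - ε • z)) (𝓝[>] 0)
      (𝓝 (∫ z : E3, (3 * (1 / √(‖z‖^2+1)^5)) • F x)) := by
    refine tendsto_integral_filter_of_dominated_convergence
      (fun z => (3 * (1 / √(‖z‖^2+1)^5)) * SchwartzMap.seminorm ℝ 0 0 F) ?_ ?_ ?_ ?_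
    · refine Eventually.of_forall fun ε => Continuous.aestronglyMeasurable ?_
      have : ∀ z : E3, √(‖z‖^2+1) ^ 5 ≠ 0 := fun z => by positivity
      fun_prop (disch := assumption)
    · filter_upwards [self_mem_nhdsWithin] with ε hε
      have hε : 0 < ε := hε
      refine Eventually.of_forall fun z => ?_
      rw [norm_smul, Real.norm_of_nonneg (by positivity)]
      gcongr
      · exact exp_bd (by positivity)
      · exact F.norm_le_seminorm ℝ _
    · exact (sig_int.const_mul 3).mul_const _
    · refine Eventually.of_forall fun z => ?_
      have hc : Continuous (fun ε : ℝ => (Real.exp (-(k * ε * √(‖z‖^2+1))) *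
        ((k * ε * √(‖z‖^2+1))^2 + 3 * (k * ε * √(‖z‖^2+1)) + 3)
        * (1 / √(‖z‖^2+1)^5)) • F (x - ε • z)) := by fun_prop
      have := (hc.tendsto 0).mono_left (nhdsWithin_le_nhds (s := Set.Ioi 0))
      simpa using this
  refine this.congr' ?_
  filter_upwards [self_mem_nhdsWithin] with ε hε
  exact (scaled hε F x).symm

lemma lim_left {k : ℝ} (hk : 0 < k) {H : E3 → ℂ} (hc : Continuous H)
    {C : ℝ} (hb : ∀ y, ‖H y‖ ≤ C) :
    Tendsto (fun ε : ℝ => ∫ y, GG k (SS ε y) • H y) (𝓝[>] 0)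
      (𝓝 (∫ y, GG k ‖y‖ • H y)) := by
  refine tendsto_integral_filter_of_dominated_convergence (fun y => GG k ‖y‖ * C) ?_ ?_ ?_ ?_
  · filter_upwards [self_mem_nhdsWithin] with ε hε
    exact ((GG_cont hε).smul hc).aestronglyMeasurable
  · filter_upwards [self_mem_nhdsWithin] with ε hε
    have hε : 0 < ε := hε
    have h0 : ∀ᵐ y : E3, y ≠ 0 := Measure.ae_ne volume 0
    filter_upwards [h0] with y hy
    have hy : 0 < ‖y‖ := norm_pos_iff.2 hy
    have h1 := SS_pos hε y
    have h2 := norm_le_SS ε y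
    have h3 : 0 ≤ GG k (SS ε y) := by unfold GG; positivity
    rw [norm_smul, Real.norm_of_nonneg h3]
    have h4 : GG k (SS ε y) ≤ GG k ‖y‖ := by
      unfold GG
      gcongr ?_ / ?_
      apply Real.exp_le_exp.2
      nlinarith
    exact mul_le_mul h4 (hb y) (norm_nonneg _) (h3.trans h4)
  · exact (g_int hk).mul_const _
  · have h0 : ∀ᵐ y : E3, y ≠ 0 := Measure.ae_ne volume 0
    filter_upwards [h0] with y hy
    have hy : 0 < ‖y‖ := norm_pos_iff.2 hy
    have h1 : Tendsto (fun ε => SS ε y) (𝓝[>] 0) (𝓝 ‖y‖) := by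
      have hc : Continuous (fun ε => SS ε y) := by unfold SS; fun_prop
      have := (hc.tendsto 0).mono_left (nhdsWithin_le_nhds (s := Set.Ioi 0))
      simpa [SS] using this
    exact (((GG_deriv k hy).continuousAt.tendsto).comp h1).smul_const _

open LineDeriv in
lemma main_id {k : ℝ} (hk : 0 < k) (F : SchwartzMap E3 ℂ) (x : E3) :
    ∫ y, GG k ‖y‖ • (k^2 • F (x - y) - ∑ i, (∂_{ee i} (∂_{ee i} F)) (x - y)) =
      (4 * Real.pi) • F x := by
  let K : SchwartzMap E3 ℂ := k^2 • F - ∑ i, ∂_{ee i} (∂_{ee i} F)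
  have hK : ∀ y, K y = k^2 • F y - ∑ i, (∂_{ee i} (∂_{ee i} F)) y := fun y => by
    simp [K]
  have h := lim_left hk (H := fun y => K (x - y)) (K.continuous.comp (by fun_prop))
    (C := SchwartzMap.seminorm ℝ 0 0 K) (fun y => K.norm_le_seminorm ℝ _)
  simp only [hK] at h
  refine tendsto_nhds_unique h ((lim_right hk F x).congr' ?_)
  filter_upwards [self_mem_nhdsWithin] with ε hε
  exact (reg_id hk hε F x).symm

/-- For `λ > 0`, `(1/(4π)) g^λ` with `g^λ(x) = e^{−√λ|x|}/|x|` is a fundamental solution of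
`−Δ + λ` on `ℝ³`: the convolution `u = (1/(4π)) g^λ ∗ f` with a Schwartz `f` is `C²` and
satisfies `−Δu + λu = f`, where the Laplacian is the sum of second partial derivatives. -/
theorem stmt_1 (lam : ℝ) (hlam : 0 < lam)
    (f : SchwartzMap (EuclideanSpace ℝ (Fin 3)) ℂ)
    (u : EuclideanSpace ℝ (Fin 3) → ℂ)
    (hu : ∀ x, u x = (1 / (4 * Real.pi)) •
      ∫ y : EuclideanSpace ℝ (Fin 3),
        Complex.ofReal (Real.exp (-Real.sqrt lam * ‖x - y‖) / ‖x - y‖) * f y) :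
    ContDiff ℝ 2 u ∧
      ∀ x, -(∑ i : Fin 3,
          fderiv ℝ (fun z => fderiv ℝ u z (EuclideanSpace.single i 1)) x
            (EuclideanSpace.single i 1)) + (lam : ℂ) * u x = f x := by
  classical
  have hk : 0 < √lam := Real.sqrt_pos.2 hlam
  have hg : Integrable (fun y : E3 => GG (√lam) ‖y‖) := g_int hk
  have hu' : u = fun x => (1 / (4 * Real.pi)) • ∫ y, GG (√lam) ‖y‖ • f (x - y) := by
    ext1 x
    rw [hu x]
    congr 1
    rw [← integral_sub_left_eq_self _ volume x]
    refine integral_congr_ae (Eventually.of_forall fun y => ?_)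
    simp only [sub_sub_cancel, GG, Complex.real_smul]
  have hfd : ∀ (c : ℝ) (F : SchwartzMap E3 ℂ) (z e : E3),
      fderiv ℝ (fun x => c • ∫ y, GG (√lam) ‖y‖ • F (x - y)) z e =
        c • ∫ y, GG (√lam) ‖y‖ • (LineDeriv.lineDerivOp e F) (z - y) := by
    intro c F z e
    have h1 := (conv_hasFDerivAt hg F z)
    have h2 : HasFDerivAt (fun x => c • ∫ y, GG (√lam) ‖y‖ • F (x - y)) _ z := h1.const_smul c
    rw [h2.fderiv, ← conv_fderiv hg, h1.fderiv]
    rfl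
  subst hu'
  refine ⟨(conv_contDiff hg 2 f).const_smul _, fun x => ?_⟩
  simp_rw [hfd]
  have hm := main_id hk f x
  rw [Real.sq_sqrt hlam.le] at hm
  simp_rw [smul_sub, Finset.smul_sum] at hm
  rw [integral_sub, integral_finsetSum] at hm
  · simp_rw [smul_comm _ lam] at hm
    rw [integral_smul] at hm
    rw [← Finset.smul_sum, ← Complex.real_smul, smul_comm lam, neg_add_eq_sub, ← smul_sub, hm, smul_smul]
    rw [one_div_mul_cancel (by positivity), one_smul]
  · exact fun i _ => conv_int hg _ x
  · simp_rw [smul_comm _ lam]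
    exact (conv_int hg f x).smul lam
  · exact integrable_finsetSum _ fun i _ => conv_int hg _ x
end

section
/- For every a > 0, the integral ∫_0^∞ (1/p) · ln((p + a)/|p − a|) dp converges and equals π²/2. -/
open MeasureTheory

lemma aux_sum : HasSum (fun n : ℕ => (2 : ℝ) / (2 * n + 1) ^ 2) (Real.pi ^ 2 / 4) := by
  have h := hasSum_zeta_two
  have he : HasSum (fun n : ℕ => (1 : ℝ) / ((2 * n : ℕ) : ℝ) ^ 2) (Real.pi ^ 2 / 24) := by
    have := h.mul_left (1 / 4 : ℝ)
    convert! this using 1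
    · funext n
      push_cast
      rw [mul_pow, div_mul_div_comm]
      norm_num
    · ring
  have hs : Summable (fun n : ℕ => (1 : ℝ) / ((2 * n + 1 : ℕ) : ℝ) ^ 2) :=
    h.summable.comp_injective (i := fun n : ℕ => 2 * n + 1) (fun a b hab => by simpa using hab)
  have h3 := HasSum.even_add_odd (f := fun n : ℕ => (1 : ℝ) / (n : ℝ) ^ 2) he hs.hasSum
  have h4 := h3.unique h
  have h5 := hs.hasSum.mul_left 2
  convert! h5 using 1
  · funext n
    push_cast
    ring
  · linarith

noncomputable def auxF (x : ℝ) : ℝ := (1 / x) * Real.log ((x + 1) / |x - 1|)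

lemma auxF_meas : Measurable auxF := by
  unfold auxF
  have : Measurable (fun x : ℝ => |x - 1|) := by
    exact (continuous_abs.comp (continuous_id.sub continuous_const)).measurable
  fun_prop

lemma auxF_hasSum {x : ℝ} (hx : x ∈ Set.Ioo (0 : ℝ) 1) :
    HasSum (fun n : ℕ => (2 / (2 * n + 1)) * x ^ (2 * n)) (auxF x) := by
  obtain ⟨h0, h1⟩ := hx
  have h := (Real.hasSum_log_sub_log_of_abs_lt_one (x := x)
    (by rw [abs_of_pos h0]; exact h1)).mul_left (1 / x)
  convert! h using 1
  · funext n
    rw [pow_succ]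
    field_simp
  · unfold auxF
    rw [abs_of_neg (by linarith), Real.log_div (by linarith) (by linarith)]
    ring_nf

lemma aux_term (n : ℕ) : ∫⁻ x in Set.Ioo (0 : ℝ) 1, ENNReal.ofReal ((2 / (2 * n + 1)) * x ^ (2 * n))
    = ENNReal.ofReal ((2 : ℝ) / (2 * n + 1) ^ 2) := by
  rw [← ofReal_integral_eq_lintegral_ofReal]
  · congr 1
    rw [← integral_Ioc_eq_integral_Ioo, ← intervalIntegral.integral_of_le zero_le_one]
    rw [intervalIntegral.integral_const_mul, integral_pow]
    push_cast
    simp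
    field_simp
  · have : Continuous (fun x : ℝ => (2 / (2 * (n : ℝ) + 1)) * x ^ (2 * n)) := by fun_prop
    exact (this.integrableOn_Icc (a := 0) (b := 1)).mono_set Set.Ioo_subset_Icc_self
  · exact Filter.Eventually.of_forall fun x => by
      have := (even_two_mul n).pow_nonneg x
      simp only [Pi.zero_apply]
      positivity

lemma auxF_nonneg {x : ℝ} (hx : x ∈ Set.Ioo (0 : ℝ) 1) : 0 ≤ auxF x :=
  (auxF_hasSum hx).nonneg fun n => by
    have := hx.1
    positivity

lemma aux_lint : ∫⁻ x in Set.Ioo (0 : ℝ) 1, ENNReal.ofReal (auxF x)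
    = ENNReal.ofReal (Real.pi ^ 2 / 4) := by
  have h1 : ∫⁻ x in Set.Ioo (0 : ℝ) 1, ENNReal.ofReal (auxF x)
    = ∫⁻ x in Set.Ioo (0 : ℝ) 1, ∑' n : ℕ, ENNReal.ofReal ((2 / (2 * n + 1)) * x ^ (2 * n)) := by
    apply setLIntegral_congr_fun measurableSet_Ioo
    intro x hx
    have := auxF_hasSum hx
    simp only
    rw [← ENNReal.ofReal_tsum_of_nonneg _ this.summable, this.tsum_eq]
    intro n
    have := hx.1
    positivity
  rw [h1, lintegral_tsum (fun n => by fun_prop)]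
  simp_rw [aux_term]
  rw [← ENNReal.ofReal_tsum_of_nonneg _ aux_sum.summable, aux_sum.tsum_eq]
  intro n
  positivity

lemma auxF_int1 : IntegrableOn auxF (Set.Ioo 0 1) := by
  have hnn : 0 ≤ᵐ[volume.restrict (Set.Ioo (0 : ℝ) 1)] auxF :=
    (ae_restrict_iff' measurableSet_Ioo).2 (Filter.Eventually.of_forall fun x hx => auxF_nonneg hx)
  apply (lintegral_ofReal_ne_top_iff_integrable auxF_meas.aestronglyMeasurable hnn).1
  rw [aux_lint]
  exact ENNReal.ofReal_ne_top

lemma auxF_val1 : ∫ x in Set.Ioo (0 : ℝ) 1, auxF x = Real.pi ^ 2 / 4 := by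
  have hnn : 0 ≤ᵐ[volume.restrict (Set.Ioo (0 : ℝ) 1)] auxF :=
    (ae_restrict_iff' measurableSet_Ioo).2 (Filter.Eventually.of_forall fun x hx => auxF_nonneg hx)
  rw [integral_eq_lintegral_of_nonneg_ae hnn auxF_meas.aestronglyMeasurable, aux_lint,
    ENNReal.toReal_ofReal (by positivity)]

lemma aux_image : (fun x : ℝ => x⁻¹) '' Set.Ioo 0 1 = Set.Ioi 1 := by
  rw [Set.image_inv_eq_inv, Set.inv_Ioo_0_left one_pos, inv_one]

lemma aux_deriv : ∀ x ∈ Set.Ioo (0 : ℝ) 1,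
    HasDerivWithinAt (fun x : ℝ => x⁻¹) (-(x ^ 2)⁻¹) (Set.Ioo 0 1) x := fun x hx =>
  (hasDerivAt_inv hx.1.ne').hasDerivWithinAt

lemma aux_eq : Set.EqOn (fun x : ℝ => |(-(x ^ 2)⁻¹)| • auxF x⁻¹) auxF (Set.Ioo 0 1) := by
  intro x hx
  obtain ⟨h0, h1⟩ := hx
  have e1 : x⁻¹ - 1 = (1 - x) / x := by field_simp
  have e2 : x⁻¹ + 1 = (x + 1) / x := by field_simp; ring
  simp only [auxF, smul_eq_mul]
  rw [e1, e2, abs_neg, abs_of_pos (by positivity : 0 < (x ^ 2)⁻¹), abs_div, abs_of_pos h0,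
    div_div_div_cancel_right₀ h0.ne', abs_sub_comm 1 x]
  field_simp

lemma auxF_int2 : IntegrableOn auxF (Set.Ioi 1) := by
  rw [← aux_image, integrableOn_image_iff_integrableOn_abs_deriv_smul measurableSet_Ioo aux_deriv
    inv_injective.injOn, integrableOn_congr_fun aux_eq measurableSet_Ioo]
  exact auxF_int1

lemma auxF_val2 : ∫ x in Set.Ioi (1 : ℝ), auxF x = Real.pi ^ 2 / 4 := by
  rw [← aux_image, integral_image_eq_integral_abs_deriv_smul measurableSet_Ioo aux_deriv
    inv_injective.injOn, setIntegral_congr_fun measurableSet_Ioo aux_eq]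
  exact auxF_val1

lemma auxF_int : IntegrableOn auxF (Set.Ioi 0) := by
  rw [← Set.Ioc_union_Ioi_eq_Ioi (zero_le_one' ℝ)]
  exact ((integrableOn_Ioc_iff_integrableOn_Ioo).2 auxF_int1).union auxF_int2

lemma auxF_val : ∫ x in Set.Ioi (0 : ℝ), auxF x = Real.pi ^ 2 / 2 := by
  rw [← Set.Ioc_union_Ioi_eq_Ioi (zero_le_one' ℝ), setIntegral_union (Set.Ioc_disjoint_Ioi le_rfl)
    measurableSet_Ioi ((integrableOn_Ioc_iff_integrableOn_Ioo).2 auxF_int1) auxF_int2,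
    integral_Ioc_eq_integral_Ioo, auxF_val1, auxF_val2]
  ring

/-- For every `a > 0`, `∫_0^∞ (1/p) ln((p+a)/|p−a|) dp = π²/2`, the integral being convergent. -/
theorem stmt_3 (a : ℝ) (ha : 0 < a) :
    IntegrableOn (fun p : ℝ => (1 / p) * Real.log ((p + a) / |p - a|)) (Set.Ioi 0) ∧
    ∫ p in Set.Ioi (0 : ℝ), (1 / p) * Real.log ((p + a) / |p - a|) = Real.pi ^ 2 / 2 := by
  have key : (fun p : ℝ => (1 / p) * Real.log ((p + a) / |p - a|))
      = fun p => a⁻¹ * auxF (a⁻¹ * p) := by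
    funext p
    have e1 : a⁻¹ * p - 1 = (p - a) / a := by field_simp
    have e2 : a⁻¹ * p + 1 = (p + a) / a := by field_simp
    unfold auxF
    rw [e1, e2, abs_div, abs_of_pos ha, div_div_div_cancel_right₀ ha.ne', ← mul_assoc]
    congr 1
    field_simp
  have hi : 0 < a⁻¹ := inv_pos.2 ha
  constructor
  · rw [key]
    apply Integrable.const_mul
    have := (integrableOn_Ioi_comp_mul_left_iff auxF 0 hi).2 (by rw [mul_zero]; exact auxF_int)
    exact this
  · rw [key, integral_const_mul, integral_comp_mul_left_Ioi auxF 0 hi, mul_zero, auxF_val]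
    simp only [smul_eq_mul, inv_inv]
    field_simp
end

section
/- Let h : ℝ³ → ℂ be a Schwartz function with Fourier transform ĥ. Then ∫_{ℝ³}∫_{ℝ³} ĥ(k) · conj(ĥ(k')) / |k − k'| dk dk' = 4π ∫_{ℝ³} |h(x)|² / |x|² dx (both sides being finite). -/
open MeasureTheory

local notation "E3" => EuclideanSpace ℝ (Fin 3)

lemma aux_norm_int (n : ℕ) (hn : n ≤ 2) :
    IntegrableOn (fun x : E3 => 1 / ‖x‖ ^ n) (Metric.ball 0 1) := by
  rw [integrableOn_fun_norm_addHaar volume (f := fun y : ℝ => 1 / y ^ n)]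
  simp only [finrank_euclideanSpace, Fintype.card_fin, smul_eq_mul]
  have : IntegrableOn (fun y : ℝ => y ^ (2 - n)) (Set.Ioo 0 1) :=
    ((by fun_prop : Continuous (fun y : ℝ => y ^ (2 - n))).integrableOn_Icc).mono_set
      Set.Ioo_subset_Icc_self
  refine this.congr_fun ?_ measurableSet_Ioo
  intro y hy
  have hy0 : y ≠ 0 := hy.1.ne'
  show y ^ (2 - n) = y ^ (3 - 1) * (1 / y ^ n)
  rw [pow_sub₀ y hy0 hn]; simp [div_eq_mul_inv]

lemma aux_ind_bound (n : ℕ) (x : E3) :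
    1 / ‖x‖ ^ n ≤ (Metric.ball (0 : E3) 1).indicator (fun x => 1 / ‖x‖ ^ n) x + 1 := by
  by_cases hx : x ∈ Metric.ball (0 : E3) 1
  · simp [hx]
  · rw [Set.indicator_of_notMem hx, zero_add]
    have : 1 ≤ ‖x‖ := by simpa using hx
    rw [div_le_one (by positivity)]
    exact one_le_pow₀ this

lemma aux_int_h (h : SchwartzMap E3 ℂ) :
    Integrable (fun x : E3 => ‖h x‖ ^ 2 / ‖x‖ ^ 2) := by
  obtain ⟨C, hC⟩ : ∃ C, ∀ x, ‖h x‖ ≤ C := by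
    obtain ⟨C, hC⟩ := h.decay 0 0
    exact ⟨C, fun x => by simpa using hC.2 x⟩
  have h1 := (aux_norm_int 2 le_rfl).integrable_indicator Metric.isOpen_ball.measurableSet
  have hsq : Integrable (fun x => ‖h x‖ ^ 2) := by
    have := h.memLp 2 (μ := volume)
    exact this.integrable_norm_pow (by norm_num)
  refine ((h1.const_mul (C ^ 2)).add hsq).mono' ?_ ?_
  · have := h.continuous.measurable
    exact (by fun_prop : Measurable fun x : E3 => ‖h x‖ ^ 2 / ‖x‖ ^ 2).aestronglyMeasurable
  · filter_upwards with x
    have hb := aux_ind_bound 2 x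
    rw [Real.norm_of_nonneg (by positivity)]
    have h0 : 0 ≤ (Metric.ball (0 : E3) 1).indicator (fun x => 1 / ‖x‖ ^ 2) x :=
      Set.indicator_nonneg (fun _ _ => by positivity) _
    have hsqb : ‖h x‖ ^ 2 ≤ C ^ 2 := by gcongr; exact hC x
    simp only [Pi.add_apply]
    calc ‖h x‖ ^ 2 / ‖x‖ ^ 2 = ‖h x‖ ^ 2 * (1 / ‖x‖ ^ 2) := by ring
      _ ≤ ‖h x‖ ^ 2 * ((Metric.ball (0 : E3) 1).indicator (fun x => 1 / ‖x‖ ^ 2) x + 1) := by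
        gcongr
      _ ≤ _ := by
        rw [mul_add, mul_one]; gcongr

lemma aux_int_f (f : E3 → ℂ) (hc : Continuous f) (hi : Integrable f) (C : ℝ)
    (hC : ∀ x, ‖f x‖ ≤ C) :
    Integrable (fun z : E3 × E3 =>
      f z.1 * (starRingEnd ℂ) (f z.2) / Complex.ofReal ‖z.1 - z.2‖) := by
  have h1 := (aux_norm_int 1 one_le_two).integrable_indicator Metric.isOpen_ball.measurableSet
  have hA : Integrable (fun z : E3 × E3 => ‖f z.1‖ * ‖f z.2‖) := hi.norm.mul_prod hi.norm
  have hB : Integrable (fun z : E3 × E3 =>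
      (Metric.ball (0 : E3) 1).indicator (fun x => 1 / ‖x‖ ^ 1) (z.1 - z.2) * ‖f z.2‖) := by
    have h2 := h1.mul_prod hi.norm
    exact (measurePreserving_sub_prod (volume : Measure E3) (volume : Measure E3)).integrable_comp_of_integrable h2
  refine ((hB.const_mul C).add hA).mono' ?_ ?_
  · have := hc.measurable
    refine Measurable.aestronglyMeasurable ?_
    have h3 : Measurable fun z : E3 × E3 => (starRingEnd ℂ) (f z.2) :=
      (Complex.continuous_conj.comp hc).measurable.comp measurable_snd
    fun_prop
  · filter_upwards with z
    have hb := aux_ind_bound 1 (z.1 - z.2)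
    have h0 : 0 ≤ (Metric.ball (0 : E3) 1).indicator (fun x => 1 / ‖x‖ ^ 1) (z.1 - z.2) :=
      Set.indicator_nonneg (fun _ _ => by positivity) _
    simp only [Pi.add_apply, norm_div, norm_mul, RCLike.norm_conj, Complex.norm_real, norm_norm]
    set I := (Metric.ball (0 : E3) 1).indicator (fun x => 1 / ‖x‖ ^ 1) (z.1 - z.2)
    calc ‖f z.1‖ * ‖f z.2‖ / ‖z.1 - z.2‖ = ‖f z.1‖ * ‖f z.2‖ * (1 / ‖z.1 - z.2‖ ^ 1) := by ring
      _ ≤ ‖f z.1‖ * ‖f z.2‖ * (I + 1) := by gcongr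
      _ = ‖f z.1‖ * (I * ‖f z.2‖) + ‖f z.1‖ * ‖f z.2‖ := by ring
      _ ≤ _ := by gcongr; exact hC _

lemma aux_exp (r : ℝ) (hr : 0 < r) :
    IntegrableOn (fun b : ℝ => Real.exp (-b * r ^ 2)) (Set.Ioi 0) ∧
    ∫ b in Set.Ioi (0 : ℝ), Real.exp (-b * r ^ 2) = 1 / r ^ 2 := by
  have h : -(r ^ 2) < 0 := by have := pow_pos hr 2; linarith
  have h1 := integrableOn_exp_mul_Ioi h 0
  have h2 := integral_exp_mul_Ioi h 0
  have e : ∀ b : ℝ, -b * r ^ 2 = -(r ^ 2) * b := fun b => by ring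
  simp only [e]
  exact ⟨h1, h2.trans (by simp)⟩

lemma aux_ker (r : ℝ) (hr : 0 < r) :
    IntegrableOn (fun b : ℝ => (Real.pi / b) ^ (3 / 2 : ℝ) * Real.exp (-r ^ 2 / (4 * b)))
      (Set.Ioi 0) ∧
    ∫ b in Set.Ioi (0 : ℝ), (Real.pi / b) ^ (3 / 2 : ℝ) * Real.exp (-r ^ 2 / (4 * b))
      = 2 * Real.pi ^ 2 / r := by
  have hp : (-2 : ℝ) ≠ 0 := by norm_num
  have key : ∀ s ∈ Set.Ioi (0 : ℝ), (|(-2 : ℝ)| * s ^ ((-2 : ℝ) - 1)) •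
      ((Real.pi / (s ^ (-2 : ℝ))) ^ (3 / 2 : ℝ) * Real.exp (-r ^ 2 / (4 * s ^ (-2 : ℝ))))
      = (2 * Real.pi ^ (3 / 2 : ℝ)) * Real.exp (-(r ^ 2 / 4) * s ^ 2) := by
    intro s hs
    have hs : 0 < s := hs
    have e1 : (Real.pi / (s ^ (-2 : ℝ))) = Real.pi * s ^ (2 : ℝ) := by
      rw [Real.rpow_neg hs.le]; simp
    have e2 : -r ^ 2 / (4 * s ^ (-2 : ℝ)) = -(r ^ 2 / 4) * s ^ 2 := by
      rw [Real.rpow_neg hs.le, Real.rpow_two]; field_simp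
    rw [e2, e1, Real.mul_rpow Real.pi_pos.le (by positivity), ← Real.rpow_mul hs.le]
    have e3 : s ^ ((-2 : ℝ) - 1) * s ^ ((2 : ℝ) * (3 / 2)) = 1 := by
      rw [← Real.rpow_add hs]; norm_num
    rw [show |(-2 : ℝ)| = 2 by norm_num, smul_eq_mul]
    linear_combination (2 * Real.pi ^ (3 / 2 : ℝ) * Real.exp (-(r ^ 2 / 4) * s ^ 2)) * e3
  constructor
  · rw [← integrableOn_Ioi_comp_rpow_iff _ hp]
    refine IntegrableOn.congr_fun ?_ (fun s hs => (key s hs).symm) measurableSet_Ioi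
    exact ((integrable_exp_neg_mul_sq (by positivity : 0 < r ^ 2 / 4)).const_mul _).integrableOn
  · rw [← integral_comp_rpow_Ioi _ hp, setIntegral_congr_fun measurableSet_Ioi key,
      integral_const_mul, integral_gaussian_Ioi]
    have : Real.pi / (r ^ 2 / 4) = Real.pi * (2 / r) ^ 2 := by field_simp; norm_num
    rw [this, Real.sqrt_mul Real.pi_pos.le, Real.sqrt_sq (by positivity), Real.sqrt_eq_rpow]
    have e : Real.pi ^ (3 / 2 : ℝ) * Real.pi ^ (1 / 2 : ℝ) = Real.pi ^ 2 := by
      rw [← Real.rpow_add Real.pi_pos]; norm_num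
    rw [← e]; ring

noncomputable def KK (b r : ℝ) : ℝ := (Real.pi / b) ^ (3 / 2 : ℝ) * Real.exp (-r ^ 2 / (4 * b))

lemma KK_nonneg (b r : ℝ) (hb : 0 < b) : 0 ≤ KK b r := by
  have := Real.pi_pos
  unfold KK; positivity

lemma aux_gauss (b : ℝ) (hb : 0 < b) (w : E3) :
    ∫ x : E3, Complex.exp (-(b : ℂ) * (‖x‖ : ℂ) ^ 2 + Complex.I * (inner ℝ w x : ℝ))
      = (KK b ‖w‖ : ℝ) := by
  rw [GaussianFourier.integral_cexp_neg_mul_sq_norm_add (by simpa using hb)]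
  unfold KK
  push_cast
  rw [Complex.ofReal_cpow (by have := Real.pi_pos; positivity)]
  simp

lemma aux_gint (b : ℝ) (hb : 0 < b) :
    Integrable (fun x : E3 => Real.exp (-b * ‖x‖ ^ 2)) := by
  have := (GaussianFourier.integrable_cexp_neg_mul_sq_norm_add (V := E3) (b := (b : ℂ))
    (by simpa using hb) 0 0).norm
  refine this.congr ?_
  filter_upwards with x
  simp [Complex.norm_exp, ← Complex.ofReal_pow]

lemma aux_swap (f g : E3 → ℂ) (hc : Continuous f) (hi : Integrable f)
    (hg : ∀ x, g x = ∫ k, f k * Complex.exp (Complex.I * (inner ℝ k x : ℝ)))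
    (b : ℝ) (hb : 0 < b) :
    ∫ z : E3 × E3, f z.1 * (starRingEnd ℂ) (f z.2) * (KK b ‖z.1 - z.2‖ : ℝ)
      = ((∫ x : E3, ‖g x‖ ^ 2 * Real.exp (-b * ‖x‖ ^ 2) : ℝ) : ℂ) := by
  set F : E3 × E3 → E3 → ℂ := fun z x => f z.1 * (starRingEnd ℂ) (f z.2) *
    Complex.exp (-(b : ℂ) * (‖x‖ : ℂ) ^ 2 + Complex.I * (inner ℝ (z.1 - z.2) x : ℝ)) with hF
  have hcs : Continuous fun k => (starRingEnd ℂ) (f k) := Complex.continuous_conj.comp hc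
  have hFint : Integrable (Function.uncurry F)
      ((volume : Measure (E3 × E3)).prod (volume : Measure E3)) := by
    have h1 : Integrable (fun z : E3 × E3 => ‖f z.1‖ * ‖f z.2‖) := hi.norm.mul_prod hi.norm
    refine (h1.mul_prod (aux_gint b hb)).mono' ?_ ?_
    · refine Continuous.aestronglyMeasurable ?_
      have h3 : Continuous fun z : (E3 × E3) × E3 => (starRingEnd ℂ) (f z.1.2) :=
        hcs.comp (by fun_prop)
      simp only [Function.uncurry_def, hF]
      fun_prop
    · filter_upwards with z
      simp [Function.uncurry_def, hF, Complex.norm_exp, ← Complex.ofReal_pow]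
  calc _ = ∫ z : E3 × E3, ∫ x : E3, F z x := by
        refine integral_congr_ae ?_
        filter_upwards with z
        simp only [hF]
        rw [integral_const_mul, aux_gauss b hb]
    _ = ∫ x : E3, ∫ z : E3 × E3, F z x := integral_integral_swap hFint
    _ = ∫ x : E3, ((‖g x‖ ^ 2 * Real.exp (-b * ‖x‖ ^ 2) : ℝ) : ℂ) := by
        refine integral_congr_ae ?_
        filter_upwards with x
        have e : ∀ z : E3 × E3, F z x = (Real.exp (-b * ‖x‖ ^ 2) : ℂ) *
            ((f z.1 * Complex.exp (Complex.I * (inner ℝ z.1 x : ℝ))) *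
            (starRingEnd ℂ) (f z.2 * Complex.exp (Complex.I * (inner ℝ z.2 x : ℝ)))) := by
          intro z
          simp only [hF, map_mul, ← Complex.exp_conj, Complex.conj_I, Complex.conj_ofReal,
            inner_sub_left, Complex.ofReal_sub]
          push_cast
          rw [show -(b : ℂ) * (‖x‖ : ℂ) ^ 2 + Complex.I * ((inner ℝ z.1 x : ℝ) - (inner ℝ z.2 x : ℝ))
            = -(b : ℂ) * (‖x‖ : ℂ) ^ 2 + Complex.I * (inner ℝ z.1 x : ℝ)
              + -Complex.I * (inner ℝ z.2 x : ℝ) by ring, Complex.exp_add, Complex.exp_add]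
          ring
        simp_rw [e]
        rw [integral_const_mul, Measure.volume_eq_prod, integral_prod_mul
          (fun k => f k * Complex.exp (Complex.I * (inner ℝ k x : ℝ)))
          (fun k => (starRingEnd ℂ) (f k * Complex.exp (Complex.I * (inner ℝ k x : ℝ)))),
          integral_conj, ← hg, Complex.mul_conj, Complex.normSq_eq_norm_sq]
        push_cast; ring
    _ = _ := integral_ofReal

lemma aux_diag : ∀ᵐ z : E3 × E3, z.1 - z.2 ≠ 0 := by
  have := (measurePreserving_sub_prod (volume : Measure E3) (volume : Measure E3)).quasiMeasurePreserving.ae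
    (p := fun z => z.1 ≠ 0) ?_
  · exact this
  · have h0 : ∀ᵐ x : E3, x ≠ 0 := by simp [ae_iff]
    exact Measure.quasiMeasurePreserving_fst.ae h0

lemma aux_main (f g : E3 → ℂ) (hc : Continuous f) (hi : Integrable f)
    (hg : ∀ x, g x = ∫ k, f k * Complex.exp (Complex.I * (inner ℝ k x : ℝ)))
    (hgc : Continuous g)
    (h1 : Integrable (fun z : E3 × E3 =>
      f z.1 * (starRingEnd ℂ) (f z.2) / Complex.ofReal ‖z.1 - z.2‖))
    (h2 : Integrable (fun x : E3 => ‖g x‖ ^ 2 / ‖x‖ ^ 2)) :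
    (2 * Real.pi ^ 2 : ℝ) * ∫ z : E3 × E3,
        f z.1 * (starRingEnd ℂ) (f z.2) / Complex.ofReal ‖z.1 - z.2‖
      = ((∫ x : E3, ‖g x‖ ^ 2 / ‖x‖ ^ 2 : ℝ) : ℂ) := by
  have hcs : Continuous fun k => (starRingEnd ℂ) (f k) := Complex.continuous_conj.comp hc
  have hI1 : Integrable (Function.uncurry fun (z : E3 × E3) (b : ℝ) =>
      f z.1 * (starRingEnd ℂ) (f z.2) * (KK b ‖z.1 - z.2‖ : ℝ))
      ((volume : Measure (E3 × E3)).prod (volume.restrict (Set.Ioi 0))) := by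
    rw [integrable_prod_iff]
    · constructor
      · filter_upwards [aux_diag] with z hz
        have hk : Integrable (fun b : ℝ => KK b ‖z.1 - z.2‖) (volume.restrict (Set.Ioi 0)) :=
          (aux_ker ‖z.1 - z.2‖ (norm_pos_iff.2 hz)).1
        exact (hk.ofReal (𝕜 := ℂ)).const_mul (f z.1 * (starRingEnd ℂ) (f z.2))
      · refine (h1.norm.const_mul (2 * Real.pi ^ 2)).congr ?_
        filter_upwards [aux_diag] with z hz
        have := (aux_ker ‖z.1 - z.2‖ (norm_pos_iff.2 hz)).2
        have e : ∀ b ∈ Set.Ioi (0 : ℝ), ‖f z.1 * (starRingEnd ℂ) (f z.2) * (KK b ‖z.1 - z.2‖ : ℝ)‖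
            = ‖f z.1‖ * ‖f z.2‖ * ((Real.pi / b) ^ (3 / 2 : ℝ) * Real.exp (-‖z.1 - z.2‖ ^ 2 / (4 * b))) := by
          intro b hb
          rw [norm_mul, norm_mul, RCLike.norm_conj, Complex.norm_real,
            Real.norm_of_nonneg (KK_nonneg b _ hb), KK]
        simp only [Function.uncurry_apply_pair]
        rw [setIntegral_congr_fun measurableSet_Ioi e, integral_const_mul, this]
        simp only [norm_div, norm_mul, RCLike.norm_conj, Complex.norm_real, norm_norm]
        ring
    · refine Measurable.aestronglyMeasurable ?_
      have h3 : Measurable fun z : (E3 × E3) × ℝ => (starRingEnd ℂ) (f z.1.2) :=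
        hcs.measurable.comp (by fun_prop)
      have h4 := hc.measurable
      simp only [Function.uncurry_def, KK]
      fun_prop
  have hI2 : Integrable (Function.uncurry fun (x : E3) (b : ℝ) =>
      ‖g x‖ ^ 2 * Real.exp (-b * ‖x‖ ^ 2))
      ((volume : Measure E3).prod (volume.restrict (Set.Ioi 0))) := by
    have h0 : ∀ᵐ x : E3, x ≠ 0 := by simp [ae_iff]
    rw [integrable_prod_iff]
    · constructor
      · filter_upwards [h0] with x hx
        exact ((aux_exp ‖x‖ (norm_pos_iff.2 hx)).1).const_mul (‖g x‖ ^ 2)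
      · refine h2.congr ?_
        filter_upwards [h0] with x hx
        have := (aux_exp ‖x‖ (norm_pos_iff.2 hx)).2
        have e : ∀ b : ℝ, ‖‖g x‖ ^ 2 * Real.exp (-b * ‖x‖ ^ 2)‖ = 
           ‖g x‖ ^ 2 * Real.exp (-b * ‖x‖ ^ 2) := fun b => Real.norm_of_nonneg (by positivity)
        simp only [Function.uncurry_apply_pair, e]
        rw [integral_const_mul, this]
        ring
    · refine Continuous.aestronglyMeasurable ?_
      simp only [Function.uncurry_def]
      fun_prop
  calc _ = ∫ z : E3 × E3, ∫ b in Set.Ioi (0 : ℝ),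
          f z.1 * (starRingEnd ℂ) (f z.2) * (KK b ‖z.1 - z.2‖ : ℝ) := by
        rw [← integral_const_mul]
        refine integral_congr_ae ?_
        filter_upwards [aux_diag] with z hz
        have := (aux_ker ‖z.1 - z.2‖ (norm_pos_iff.2 hz)).2
        rw [integral_const_mul, integral_complex_ofReal]
        simp only [KK]
        rw [this]
        push_cast; ring
    _ = ∫ b in Set.Ioi (0 : ℝ), ∫ z : E3 × E3,
          f z.1 * (starRingEnd ℂ) (f z.2) * (KK b ‖z.1 - z.2‖ : ℝ) := integral_integral_swap hI1
    _ = ∫ b in Set.Ioi (0 : ℝ), ((∫ x : E3, ‖g x‖ ^ 2 * Real.exp (-b * ‖x‖ ^ 2) : ℝ) : ℂ) :=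
        setIntegral_congr_fun measurableSet_Ioi fun b hb => aux_swap f g hc hi hg b hb
    _ = ((∫ b in Set.Ioi (0 : ℝ), ∫ x : E3, ‖g x‖ ^ 2 * Real.exp (-b * ‖x‖ ^ 2) : ℝ) : ℂ) :=
        integral_ofReal
    _ = ((∫ x : E3, ∫ b in Set.Ioi (0 : ℝ), ‖g x‖ ^ 2 * Real.exp (-b * ‖x‖ ^ 2) : ℝ) : ℂ) := by
        rw [integral_integral_swap hI2]
    _ = _ := by
        congr 1
        refine integral_congr_ae ?_
        have h0 : ∀ᵐ x : E3, x ≠ 0 := by simp [ae_iff]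
        filter_upwards [h0] with x hx
        rw [integral_const_mul, (aux_exp ‖x‖ (norm_pos_iff.2 hx)).2]
        ring



/-- Plancherel-type identity for the Riesz kernel `1/|k−k'|` in dimension three:
for a Schwartz function `h` with Fourier transform
`ĥ(k) = (2π)^{−3/2} ∫ e^{−ik·x} h(x) dx`, one has
`∫∫ ĥ(k) conj(ĥ(k'))/|k−k'| dk dk' = 4π ∫ |h(x)|²/|x|² dx`, both sides being finite. -/
theorem stmt_4 (h : SchwartzMap (EuclideanSpace ℝ (Fin 3)) ℂ)
    (hhat : EuclideanSpace ℝ (Fin 3) → ℂ)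
    (hdef : ∀ k, hhat k = ((2 * Real.pi : ℝ) ^ (-(3 : ℝ) / 2)) •
      ∫ x : EuclideanSpace ℝ (Fin 3),
        Complex.exp (-Complex.I * Complex.ofReal (inner ℝ k x : ℝ)) * h x) :
    Integrable (fun z : EuclideanSpace ℝ (Fin 3) × EuclideanSpace ℝ (Fin 3) =>
      hhat z.1 * (starRingEnd ℂ) (hhat z.2) / Complex.ofReal ‖z.1 - z.2‖) ∧
    Integrable (fun x : EuclideanSpace ℝ (Fin 3) => ‖h x‖ ^ 2 / ‖x‖ ^ 2) ∧
    ∫ z : EuclideanSpace ℝ (Fin 3) × EuclideanSpace ℝ (Fin 3),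
        hhat z.1 * (starRingEnd ℂ) (hhat z.2) / Complex.ofReal ‖z.1 - z.2‖
      = Complex.ofReal (4 * Real.pi *
          ∫ x : EuclideanSpace ℝ (Fin 3), ‖h x‖ ^ 2 / ‖x‖ ^ 2) := by
  have hpi := Real.pi_pos
  set G : SchwartzMap E3 ℂ := FourierTransform.fourier h with hG
  set c : ℝ := (2 * Real.pi : ℝ) ^ (-(3 : ℝ) / 2) with hcdef
  have hR : (2 * Real.pi)⁻¹ ≠ 0 := by positivity
  have hh : ∀ k, hhat k = c • G ((2 * Real.pi)⁻¹ • k) := by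
    intro k
    rw [hdef, hG, SchwartzMap.fourier_coe, Real.fourier_eq']
    congr 1
    refine integral_congr_ae ?_
    filter_upwards with x
    rw [smul_eq_mul, inner_smul_right, real_inner_comm]
    congr 2
    push_cast
    field_simp
  have hfun : hhat = fun k => c • G ((2 * Real.pi)⁻¹ • k) := funext hh
  have hc : Continuous hhat := by
    rw [hfun]; have := G.continuous; fun_prop
  have hi : Integrable hhat := by
    rw [hfun]
    exact ((integrable_comp_smul_iff volume _ hR).2 G.integrable).smul c
  obtain ⟨C, hC⟩ : ∃ C, ∀ x, ‖hhat x‖ ≤ C := by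
    obtain ⟨C, hC⟩ := G.decay 0 0
    refine ⟨|c| * C, fun x => ?_⟩
    rw [hh, norm_smul, Real.norm_eq_abs]
    gcongr
    simpa using hC.2 _
  have h1 := aux_int_f hhat hc hi C hC
  have h2 := aux_int_h h
  refine ⟨h1, h2, ?_⟩
  have hg : ∀ x, ((c * (2 * Real.pi) ^ 3 : ℝ) : ℂ) * h x =
      ∫ k, hhat k * Complex.exp (Complex.I * (inner ℝ k x : ℝ)) := by
    intro x
    have hinv : h x = ∫ k, Complex.exp (2 * Real.pi * (inner ℝ k x : ℝ) * Complex.I) * G k := by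
      have : h = FourierTransformInv.fourierInv G := by simp [hG]
      conv_lhs => rw [this]
      rw [SchwartzMap.fourierInv_coe, Real.fourierInv_eq']
      simp
    have e : ∀ k : E3, hhat k * Complex.exp (Complex.I * (inner ℝ k x : ℝ)) = (c : ℂ) *
        (fun k => Complex.exp (2 * Real.pi * (inner ℝ k x : ℝ) * Complex.I) * G k)
          ((2 * Real.pi)⁻¹ • k) := by
      intro k
      rw [hh, Complex.real_smul]
      have : (2 * Real.pi * (inner ℝ ((2 * Real.pi)⁻¹ • k) x : ℝ) * Complex.I : ℂ)
        = Complex.I * (inner ℝ k x : ℝ) := by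
        rw [real_inner_smul_left]
        push_cast
        field_simp
      simp only [this]
      ring
    simp_rw [e]
    rw [integral_const_mul, Measure.integral_comp_smul volume
      (fun k : E3 => Complex.exp (2 * Real.pi * (inner ℝ k x : ℝ) * Complex.I) * G k), ← hinv]
    rw [finrank_euclideanSpace, Fintype.card_fin, abs_of_pos (by positivity), Complex.real_smul]
    push_cast
    field_simp
  have hcsq : (c * (2 * Real.pi) ^ 3) ^ 2 = (2 * Real.pi) ^ 3 := by
    have : c ^ 2 * (2 * Real.pi) ^ 3 = 1 := by
      rw [hcdef, ← Real.rpow_natCast, ← Real.rpow_natCast, ← Real.rpow_mul (by positivity),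
        ← Real.rpow_add (by positivity)]
      norm_num
    linear_combination (2 * Real.pi) ^ 3 * this
  have e2 : ∀ x : E3, ‖((c * (2 * Real.pi) ^ 3 : ℝ) : ℂ) * h x‖ ^ 2 / ‖x‖ ^ 2 =
      (2 * Real.pi) ^ 3 * (‖h x‖ ^ 2 / ‖x‖ ^ 2) := by
    intro x
    rw [norm_mul, Complex.norm_real, mul_pow, Real.norm_eq_abs, sq_abs, hcsq]
    ring
  have main := aux_main hhat (fun x => ((c * (2 * Real.pi) ^ 3 : ℝ) : ℂ) * h x) hc hi hg
    (by have := h.continuous; fun_prop) h1 (by simp only [e2]; exact h2.const_mul _)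
  simp only [e2] at main
  rw [integral_const_mul] at main
  have hne : ((2 * Real.pi ^ 2 : ℝ) : ℂ) ≠ 0 := by
    exact_mod_cast (by positivity : (2 * Real.pi ^ 2 : ℝ) ≠ 0)
  apply mul_left_cancel₀ hne
  rw [main]
  push_cast
  ring
end

section
/- Let h : ℝ³ → ℂ be a Schwartz function whose Fourier transform ĥ is real and nonnegative. Then ∫_{ℝ⁹} ĥ(k) ĥ(k') / (|p − k|² · |p − k'|²) dp dk dk' ≤ 16 π⁴ (‖h‖²_{L²(ℝ³)} + ‖∇h‖²_{L²(ℝ³)}). -/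
open MeasureTheory Set Filter Topology
open scoped ENNReal FourierTransform

lemma hardy_pt (h : SchwartzMap (EuclideanSpace ℝ (Fin 3)) ℂ) (x : EuclideanSpace ℝ (Fin 3))
    (hx : x ≠ 0) :
    ‖h x‖ₑ ≤ ‖x‖ₑ * ∫⁻ s in Ioi (1:ℝ), ‖fderiv ℝ h (s • x)‖ₑ := by
  by_cases hfin : ∫⁻ s in Ioi (1:ℝ), ‖fderiv ℝ h (s • x)‖ₑ = ⊤
  · rw [hfin, ENNReal.mul_top (by simpa using hx)]; exact le_top
  have hcf : Continuous (fderiv ℝ h) := (h.smooth 1).continuous_fderiv (by simp)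
  have hc : Continuous fun s : ℝ => fderiv ℝ h (s • x) := by fun_prop
  have hd : ∀ s : ℝ, HasDerivAt (fun s : ℝ => h (s • x)) (fderiv ℝ h (s • x) x) s := by
    intro s
    have h1 : HasDerivAt (fun s : ℝ => s • x) x s := by
      simpa using (hasDerivAt_id s).smul_const x
    exact (h.differentiableAt.hasFDerivAt (x := s • x)).comp_hasDerivAt s h1
  have hi : IntegrableOn (fun s : ℝ => fderiv ℝ h (s • x)) (Ioi 1) :=
    ⟨hc.aestronglyMeasurable, lt_top_iff_ne_top.2 hfin⟩
  have hi2 : IntegrableOn (fun s : ℝ => fderiv ℝ h (s • x) x) (Ioi 1) :=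
    hi.apply_continuousLinearMap x
  have ht : Tendsto (fun s : ℝ => h (s • x)) atTop (𝓝 0) := by
    have h1 : Tendsto (fun s : ℝ => s • x) atTop (cocompact _) := by
      rw [← Metric.cobounded_eq_cocompact, ← tendsto_norm_atTop_iff_cobounded]
      simp only [norm_smul]
      exact (tendsto_norm_atTop_atTop).atTop_mul_const (norm_pos_iff.2 hx)
    exact (zero_at_infty h).comp h1
  have hF := integral_Ioi_of_hasDerivAt_of_tendsto' (fun s _ => hd s) hi2 ht
  simp only [one_smul, zero_sub] at hF
  calc ‖h x‖ₑ = ‖∫ s in Ioi (1:ℝ), fderiv ℝ h (s • x) x‖ₑ := by rw [hF, enorm_neg]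
    _ ≤ ∫⁻ s in Ioi (1:ℝ), ‖fderiv ℝ h (s • x) x‖ₑ := enorm_integral_le_lintegral_enorm _
    _ ≤ ∫⁻ s in Ioi (1:ℝ), ‖x‖ₑ * ‖fderiv ℝ h (s • x)‖ₑ := by
        refine lintegral_mono fun s => ?_
        rw [mul_comm]
        exact ContinuousLinearMap.le_opENorm _ _
    _ = _ := by rw [lintegral_const_mul]; exact hc.enorm.measurable

lemma cs_pt (g : ℝ → ℝ≥0∞) (hg : Measurable g) :
    (∫⁻ s in Ioi (1:ℝ), g s) ^ 2 ≤
      2 * ∫⁻ s in Ioi (1:ℝ), ENNReal.ofReal (s ^ (3/2:ℝ)) * g s ^ 2 := by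
  have h2 : ∫⁻ s in Ioi (1:ℝ), ENNReal.ofReal (s ^ (-3/4:ℝ)) ^ (2:ℝ) = 2 := by
    have : ∀ s ∈ Ioi (1:ℝ), ENNReal.ofReal (s ^ (-3/4:ℝ)) ^ (2:ℝ) = ENNReal.ofReal (s ^ (-3/2:ℝ)) := by
      intro s hs
      have hs0 : (0:ℝ) < s := lt_trans one_pos hs
      rw [ENNReal.ofReal_rpow_of_pos (by positivity), ← Real.rpow_mul hs0.le]
      norm_num
    rw [setLIntegral_congr_fun measurableSet_Ioi this, ← ofReal_integral_eq_lintegral_ofReal,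
      integral_Ioi_rpow_of_lt (by norm_num) one_pos]
    · norm_num
    · exact integrableOn_Ioi_rpow_of_lt (by norm_num) one_pos
    · filter_upwards [ae_restrict_mem measurableSet_Ioi] with s hs
      have hs0 : (0:ℝ) < s := lt_trans one_pos hs
      simp only [Pi.zero_apply]; positivity
  have e1 : ∫⁻ s in Ioi (1:ℝ), g s = ∫⁻ s in Ioi (1:ℝ),
      ((fun s => ENNReal.ofReal (s ^ (-3/4:ℝ))) * (fun s => ENNReal.ofReal (s ^ (3/4:ℝ)) * g s)) s := by
    apply setLIntegral_congr_fun measurableSet_Ioi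
    intro s hs
    have hs0 : (0:ℝ) < s := lt_trans one_pos hs
    simp only [Pi.mul_apply]
    rw [← mul_assoc, ← ENNReal.ofReal_mul (by positivity), ← Real.rpow_add hs0]
    norm_num
  have hh := ENNReal.lintegral_mul_le_Lp_mul_Lq (volume.restrict (Ioi (1:ℝ)))
    Real.HolderConjugate.two_two
    (f := fun s => ENNReal.ofReal (s ^ (-3/4:ℝ))) (g := fun s => ENNReal.ofReal (s ^ (3/4:ℝ)) * g s)
    (by fun_prop) (by fun_prop)
  rw [← e1, h2] at hh
  have e3 : ∫⁻ s in Ioi (1:ℝ), (ENNReal.ofReal (s ^ (3/4:ℝ)) * g s) ^ (2:ℝ) =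
      ∫⁻ s in Ioi (1:ℝ), ENNReal.ofReal (s ^ (3/2:ℝ)) * g s ^ 2 := by
    apply setLIntegral_congr_fun measurableSet_Ioi
    intro s hs
    have hs0 : (0:ℝ) < s := lt_trans one_pos hs
    simp only
    rw [ENNReal.mul_rpow_of_nonneg _ _ (by norm_num), ENNReal.ofReal_rpow_of_pos (by positivity),
      ← Real.rpow_mul hs0.le]
    norm_num
  rw [e3] at hh
  calc _ ≤ _ := pow_le_pow_left' hh 2
    _ = _ := by
      rw [mul_pow, ← ENNReal.rpow_natCast, ← ENNReal.rpow_natCast, ← ENNReal.rpow_mul,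
        ← ENNReal.rpow_mul]
      norm_num

lemma lint_scale {V : Type*} [NormedAddCommGroup V] [NormedSpace ℝ V] [FiniteDimensional ℝ V]
    [MeasurableSpace V] [BorelSpace V] (μ : Measure V) [μ.IsAddHaarMeasure] (r : ℝ) (hr : 0 < r)
    (f : V → ℝ≥0∞) (hf : Measurable f) :
    ∫⁻ x, f (r • x) ∂μ = ENNReal.ofReal ((r ^ Module.finrank ℝ V)⁻¹) * ∫⁻ x, f x ∂μ := by
  rw [← lintegral_map hf (measurable_const_smul r), Measure.map_addHaar_smul _ hr.ne',
    lintegral_smul_measure, abs_of_pos (by positivity), smul_eq_mul]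

lemma hardy (h : SchwartzMap (EuclideanSpace ℝ (Fin 3)) ℂ) :
    ∫⁻ x, ‖h x‖ₑ ^ 2 * (‖x‖ₑ⁻¹) ^ 2 ≤ 4 * ∫⁻ x, ‖fderiv ℝ h x‖ₑ ^ 2 := by
  have hcf : Continuous (fderiv ℝ h) := (h.smooth 1).continuous_fderiv (by simp)
  have h0 : ∀ᵐ x : EuclideanSpace ℝ (Fin 3), x ≠ 0 := by
    simp [ae_iff]
  calc _ ≤ ∫⁻ x : EuclideanSpace ℝ (Fin 3), 2 * ∫⁻ s in Ioi (1:ℝ),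
        ENNReal.ofReal (s ^ (3/2:ℝ)) * ‖fderiv ℝ h (s • x)‖ₑ ^ 2 := by
        apply lintegral_mono_ae
        filter_upwards [h0] with x hx
        refine le_trans ?_ (cs_pt _ (by
          have : Continuous fun s : ℝ => fderiv ℝ h (s • x) := by fun_prop
          exact this.enorm.measurable))
        rw [← mul_pow]
        gcongr
        rw [← div_eq_mul_inv]
        apply ENNReal.div_le_of_le_mul
        rw [mul_comm]
        exact hardy_pt h x hx
    _ = 2 * ∫⁻ s in Ioi (1:ℝ), ∫⁻ x : EuclideanSpace ℝ (Fin 3), 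
        ENNReal.ofReal (s ^ (3/2:ℝ)) * ‖fderiv ℝ h (s • x)‖ₑ ^ 2 := by
        have hm : Measurable (fun p : EuclideanSpace ℝ (Fin 3) × ℝ => 
           ENNReal.ofReal (p.2 ^ (3/2:ℝ)) * ‖fderiv ℝ h (p.2 • p.1)‖ₑ ^ 2) := by
          have h1 : Continuous fun p : EuclideanSpace ℝ (Fin 3) × ℝ => fderiv ℝ h (p.2 • p.1) := by
            fun_prop
          have := h1.enorm.measurable
          fun_prop
        rw [lintegral_const_mul]
        · rw [lintegral_lintegral_swap]
          exact hm.aemeasurable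
        · exact hm.lintegral_prod_right'
    _ = 2 * ∫⁻ s in Ioi (1:ℝ), ENNReal.ofReal (s ^ (-3/2:ℝ)) * ∫⁻ x, ‖fderiv ℝ h x‖ₑ ^ 2 := by
        congr 1
        apply setLIntegral_congr_fun measurableSet_Ioi
        intro s hs
        have hs0 : (0:ℝ) < s := lt_trans one_pos hs
        have hm : Measurable fun x => ‖fderiv ℝ h x‖ₑ ^ 2 := (hcf.enorm.measurable).pow_const 2
        simp only
        rw [lintegral_const_mul, lint_scale volume s hs0 (fun x => ‖fderiv ℝ h x‖ₑ ^ 2) hm, ← mul_assoc,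
          ← ENNReal.ofReal_mul (by positivity)]
        · congr 2
          rw [← Real.rpow_natCast, ← Real.rpow_neg hs0.le, ← Real.rpow_add hs0]
          simp; norm_num
        · exact hm.comp (measurable_const_smul s)
    _ = _ := by
        rw [lintegral_mul_const _ (by fun_prop), ← ofReal_integral_eq_lintegral_ofReal,
          integral_Ioi_rpow_of_lt (by norm_num) one_pos, ← mul_assoc]
        · norm_num
        · exact integrableOn_Ioi_rpow_of_lt (by norm_num) one_pos
        · filter_upwards [ae_restrict_mem measurableSet_Ioi] with s hs
          have hs0 : (0:ℝ) < s := lt_trans one_pos hs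
          simp only [Pi.zero_apply]; positivity

lemma int_phys (x : EuclideanSpace ℝ (Fin 3)) (hx : x ≠ 0) :
    ∫⁻ t in Ioi (0:ℝ), ENNReal.ofReal (t ^ (-1/2:ℝ)) * ENNReal.ofReal (Real.exp (-(Real.pi * t) * ‖x‖^2))
      = ‖x‖ₑ⁻¹ := by
  have hn := norm_pos_iff.2 hx
  have hr : 0 < Real.pi * ‖x‖^2 := by positivity
  have key := Real.integral_rpow_mul_exp_neg_mul_Ioi (a := 1/2) (by norm_num) hr
  have e : ∀ t ∈ Ioi (0:ℝ), ENNReal.ofReal (t ^ (-1/2:ℝ)) * ENNReal.ofReal (Real.exp (-(Real.pi * t) * ‖x‖^2)) 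
     = ENNReal.ofReal (t ^ ((1/2:ℝ) - 1) * Real.exp (-(Real.pi * ‖x‖^2 * t))) := by
    intro t (ht : 0 < t)
    rw [← ENNReal.ofReal_mul (by positivity)]
    congr 3
    · norm_num
    · ring
  rw [Real.Gamma_one_half_eq, ← Real.sqrt_eq_rpow, one_div (Real.pi * _), Real.sqrt_inv,
    Real.sqrt_mul Real.pi_nonneg, Real.sqrt_sq hn.le] at key
  have hpi : √Real.pi ≠ 0 := by positivity
  have key2 : ∫ t in Ioi (0:ℝ), t ^ ((1/2:ℝ) - 1) * Real.exp (-(Real.pi * ‖x‖^2 * t)) = ‖x‖⁻¹ := by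
    rw [key]; field_simp
  rw [setLIntegral_congr_fun measurableSet_Ioi e, ← ofReal_integral_eq_lintegral_ofReal, key2,
    ENNReal.ofReal_inv_of_pos hn, ofReal_norm]
  · by_contra hcon
    rw [integral_undef hcon] at key2
    exact (inv_pos.2 hn).ne key2
  · filter_upwards [ae_restrict_mem measurableSet_Ioi] with s hs
    have hs0 : (0:ℝ) < s := hs
    simp only [Pi.zero_apply]; positivity

lemma int_four (q : EuclideanSpace ℝ (Fin 3)) :
    ENNReal.ofReal (1 / ‖q‖^2) ≤ ENNReal.ofReal Real.pi * 
    ∫⁻ t in Ioi (0:ℝ), ENNReal.ofReal (t ^ (-1/2:ℝ)) * 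
      ENNReal.ofReal (t ^ (-3/2:ℝ) * Real.exp (-Real.pi * ‖q‖^2 / t)) := by
  rcases eq_or_ne q 0 with rfl | hq
  · simp
  have hn := norm_pos_iff.2 hq
  set a := Real.pi * ‖q‖^2 with ha
  have hr : 0 < a := by positivity
  have e : ∀ t ∈ Ioi (0:ℝ), ENNReal.ofReal (t ^ (-1/2:ℝ)) * 
      ENNReal.ofReal (t ^ (-3/2:ℝ) * Real.exp (-Real.pi * ‖q‖^2 / t))
     = ENNReal.ofReal ((t^2)⁻¹ * Real.exp (-a / t)) := by
    intro t (ht : 0 < t)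
    rw [← ENNReal.ofReal_mul (by positivity), ← mul_assoc, ← Real.rpow_add ht]
    congr 3
    · rw [← Real.rpow_natCast, ← Real.rpow_neg ht.le]; norm_num
    · rw [ha, neg_mul]
  have hd : ∀ t ∈ Ioi (0:ℝ), HasDerivAt (fun t => a⁻¹ * Real.exp (-a / t)) ((t^2)⁻¹ * Real.exp (-a / t)) t := by
    intro t (ht : 0 < t)
    have h1 : HasDerivAt (fun t : ℝ => -a / t) (a / t^2) t := by
      have := (hasDerivAt_inv ht.ne').const_mul (-a)
      simp only [div_eq_mul_inv]
      exact this.congr_deriv (by ring)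
    convert! (h1.exp.const_mul a⁻¹) using 1
    field_simp
  have hpos : ∀ t ∈ Ioi (0:ℝ), 0 ≤ (t^2)⁻¹ * Real.exp (-a / t) := by
    intro t (ht : 0 < t); positivity
  have hz : (fun t => a⁻¹ * Real.exp (-a / t)) 0 = a⁻¹ := by simp
  have hlim : Tendsto (fun t => a⁻¹ * Real.exp (-a / t)) atTop (𝓝 (a⁻¹ * Real.exp 0)) := by
    refine Tendsto.const_mul _ ((Real.continuous_exp.tendsto 0).comp ?_)
    exact tendsto_const_nhds.div_atTop tendsto_id
  -- limit at 0+
  have hlim0 : Tendsto (fun t => a⁻¹ * Real.exp (-a / t)) (𝓝[>] 0) (𝓝 0) := by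
    have : Tendsto (fun t : ℝ => -a / t) (𝓝[>] 0) atBot := by
      simp only [div_eq_mul_inv]
      exact tendsto_inv_nhdsGT_zero.const_mul_atTop_of_neg (by linarith)
    simpa using (Real.tendsto_exp_atBot.comp this).const_mul a⁻¹
  have hcont : ContinuousWithinAt (Function.update (fun t => a⁻¹ * Real.exp (-a / t)) 0 0) (Ici 0) 0 := by
    rw [continuousWithinAt_update_same]
    simpa using hlim0
  have hd' : ∀ t ∈ Ioi (0:ℝ), HasDerivAt (Function.update (fun t => a⁻¹ * Real.exp (-a / t)) 0 0)
      ((t^2)⁻¹ * Real.exp (-a / t)) t := by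
    intro t (ht : 0 < t)
    refine (hd t ht).congr_of_eventuallyEq ?_
    filter_upwards [isOpen_ne.mem_nhds ht.ne'] with y hy
    exact Function.update_of_ne hy _ _
  have hlim' : Tendsto (Function.update (fun t => a⁻¹ * Real.exp (-a / t)) 0 0) atTop
      (𝓝 (a⁻¹ * Real.exp 0)) := by
    refine hlim.congr' ?_
    filter_upwards [eventually_gt_atTop 0] with y hy
    rw [Function.update_of_ne hy.ne']
  have hint : IntegrableOn (fun t => (t^2)⁻¹ * Real.exp (-a / t)) (Ioi 0) :=
    integrableOn_Ioi_deriv_of_nonneg hcont hd' hpos hlim'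
  have key : ∫ t in Ioi (0:ℝ), (t^2)⁻¹ * Real.exp (-a / t) = a⁻¹ := by
    have := integral_Ioi_of_hasDerivAt_of_nonneg hcont hd' hpos hlim'
    simpa using this
  rw [setLIntegral_congr_fun measurableSet_Ioi e, ← ofReal_integral_eq_lintegral_ofReal hint, key,
    ← ENNReal.ofReal_mul Real.pi_nonneg]
  · apply ENNReal.ofReal_le_ofReal
    rw [ha]; field_simp; rfl
  · filter_upwards [ae_restrict_mem measurableSet_Ioi] with s hs
    exact hpos s hs

lemma gauss_tg (b : ℝ) (hb : 0 ≤ b) :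
    (fun x : EuclideanSpace ℝ (Fin 3) => ((Real.exp (-b * ‖x‖^2) : ℝ) : ℂ)).HasTemperateGrowth := by
  have h1 : (Real.exp ∘ (fun x : EuclideanSpace ℝ (Fin 3) => (-b) * ‖x‖^2)).HasTemperateGrowth := by
    apply Function.HasTemperateGrowth.comp' (t := Iic 0)
    · rintro _ ⟨x, rfl⟩
      simp only [mem_Iic]
      have := mul_nonneg hb (sq_nonneg ‖x‖); linarith
    · exact uniqueDiffOn_Iic 0
    · exact Real.contDiff_exp.contDiffOn
    · intro N
      refine ⟨0, 1, zero_le_one, fun n _ x hx => ?_⟩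
      rw [norm_iteratedFDerivWithin_eq_norm_iteratedDerivWithin,
        iteratedDerivWithin_eq_iteratedDeriv (uniqueDiffOn_Iic 0) Real.contDiff_exp.contDiffAt hx]
      simpa [iteratedDeriv_eq_iterate] using hx
    · exact (Function.HasTemperateGrowth.const (-b)).mul (by fun_prop)
  exact Function.HasTemperateGrowth.comp Function.Complex.hasTemperateGrowth_ofReal h1

noncomputable def hgs (h : SchwartzMap (EuclideanSpace ℝ (Fin 3)) ℂ) (t : ℝ) :
    SchwartzMap (EuclideanSpace ℝ (Fin 3)) ℂ :=
  SchwartzMap.smulLeftCLM ℂ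
    (fun x : EuclideanSpace ℝ (Fin 3) => ((Real.exp (-(Real.pi * t) * ‖x‖^2) : ℝ) : ℂ)) h

lemma hgs_apply (h : SchwartzMap (EuclideanSpace ℝ (Fin 3)) ℂ) {t : ℝ} (ht : 0 < t) (x) :
    hgs h t x = ((Real.exp (-(Real.pi * t) * ‖x‖^2) : ℝ) : ℂ) * h x := by
  rw [hgs, SchwartzMap.smulLeftCLM_apply_apply (gauss_tg _ (by positivity)), smul_eq_mul]

lemma fourier_hgs (h : SchwartzMap (EuclideanSpace ℝ (Fin 3)) ℂ) {t : ℝ} (ht : 0 < t)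
    (η : EuclideanSpace ℝ (Fin 3)) :
    𝓕 (hgs h t) η = ∫ ξ, ((t ^ (-3/2:ℝ) * Real.exp (-Real.pi * ‖η - ξ‖^2 / t) : ℝ) : ℂ) * 𝓕 h ξ := by
  have hb : 0 < ((Real.pi * t : ℝ) : ℂ).re := by rw [Complex.ofReal_re]; positivity
  have J := GaussianFourier.integrable_cexp_neg_mul_sq_norm_add hb (2 * Real.pi * Complex.I) η
  have key := VectorFourier.integral_fourierIntegral_smul_eq_flip (L := innerₗ (EuclideanSpace ℝ (Fin 3)))
      (μ := volume) (ν := volume)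
      Real.continuous_fourierChar continuous_inner J (𝓕 h).integrable
  have e1 : ∀ ξ, VectorFourier.fourierIntegral Real.fourierChar volume (innerₗ (EuclideanSpace ℝ (Fin 3)))
     (fun v => Complex.exp (-((Real.pi * t : ℝ) : ℂ) * ‖v‖ ^ 2 + 2 * Real.pi * Complex.I * (inner ℝ η v : ℝ))) ξ
     = ((t ^ (-3/2:ℝ) * Real.exp (-Real.pi * ‖η - ξ‖^2 / t) : ℝ) : ℂ) := by
    intro ξ
    have := fourier_gaussian_innerProductSpace' hb η ξ
    refine Eq.trans this ?_
    have h3 : ((Real.pi : ℂ) / ((Real.pi * t : ℝ) : ℂ)) = ((t⁻¹ : ℝ) : ℂ) := by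
      push_cast; field_simp
    have h4 : ((Module.finrank ℝ (EuclideanSpace ℝ (Fin 3)) : ℂ) / 2) = (((3/2 : ℝ)) : ℂ) := by
      simp
    rw [h3, h4, ← Complex.ofReal_cpow (by positivity), Real.inv_rpow ht.le, ← Real.rpow_neg ht.le]
    rw [Complex.ofReal_mul (t ^ (-3/2:ℝ)), Complex.ofReal_exp]
    congr 2
    · norm_num
    · push_cast; field_simp
  have e2 : ∀ v, VectorFourier.fourierIntegral Real.fourierChar volume (innerₗ (EuclideanSpace ℝ (Fin 3))).flip
     (⇑(𝓕 h : SchwartzMap (EuclideanSpace ℝ (Fin 3)) ℂ)) v = h (-v) := by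
    intro v
    have h1 : 𝓕⁻ (𝓕 h) (-v) = h (-v) := by simp
    rw [← h1, SchwartzMap.fourierInv_coe, Real.fourierInv_eq_fourier_neg, neg_neg, flip_innerₗ]
    rfl
  simp only [e1, e2, smul_eq_mul] at key
  have e3 : 𝓕 (hgs h t) η = 𝓕 (⇑(hgs h t)) η := by rw [SchwartzMap.fourier_coe]
  rw [key, e3, Real.fourier_eq', ← integral_neg_eq_self]
  congr 1; ext v
  rw [hgs_apply h ht, smul_eq_mul, ← mul_assoc, Complex.ofReal_exp, ← Complex.exp_add]
  congr 2
  rw [norm_neg, inner_neg_left, real_inner_comm]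
  push_cast; ring

lemma fourier_lint (h : SchwartzMap (EuclideanSpace ℝ (Fin 3)) ℂ) 
    (him : ∀ ξ, (𝓕 h ξ).im = 0) (hre : ∀ ξ, 0 ≤ (𝓕 h ξ).re) {t : ℝ} (ht : 0 < t)
    (η : EuclideanSpace ℝ (Fin 3)) :
    (𝓕 (hgs h t) η).im = 0 ∧ 0 ≤ (𝓕 (hgs h t) η).re ∧ 
    ∫⁻ ξ, ENNReal.ofReal (𝓕 h ξ).re * ENNReal.ofReal (t ^ (-3/2:ℝ) * Real.exp (-Real.pi * ‖η - ξ‖^2 / t))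
      = ENNReal.ofReal (𝓕 (hgs h t) η).re := by
  have hr : ∀ ξ, 𝓕 h ξ = ((𝓕 h ξ).re : ℂ) := fun ξ => Complex.ext rfl (by simp [him])
  have e : 𝓕 (hgs h t) η = ((∫ ξ, (𝓕 h ξ).re * (t ^ (-3/2:ℝ) * Real.exp (-Real.pi * ‖η - ξ‖^2 / t)) : ℝ) : ℂ) := by
    rw [fourier_hgs h ht, ← integral_complex_ofReal]
    congr 1; ext ξ
    conv_lhs => rw [hr ξ]
    push_cast; ring
  have hnn : ∀ ξ, 0 ≤ (𝓕 h ξ).re * (t ^ (-3/2:ℝ) * Real.exp (-Real.pi * ‖η - ξ‖^2 / t)) := by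
    intro ξ; have := hre ξ; positivity
  refine ⟨by rw [e, Complex.ofReal_im], by rw [e, Complex.ofReal_re]; exact integral_nonneg hnn, ?_⟩
  rw [e, Complex.ofReal_re, ofReal_integral_eq_lintegral_ofReal]
  · congr 1; ext ξ; rw [ENNReal.ofReal_mul (hre ξ)]
  · refine Integrable.mul_bdd (c := t ^ (-3/2:ℝ)) (𝓕 h).integrable.re (Continuous.aestronglyMeasurable (by fun_prop)) ?_
    refine ae_of_all _ fun ξ => ?_
    rw [Real.norm_of_nonneg (by positivity)]
    refine mul_le_of_le_one_right (by positivity) (Real.exp_le_one_iff.2 ?_)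
    apply div_nonpos_of_nonpos_of_nonneg _ ht.le
    have := mul_nonneg Real.pi_nonneg (sq_nonneg ‖η - ξ‖); linarith
  · exact ae_of_all _ hnn

lemma planch (h : SchwartzMap (EuclideanSpace ℝ (Fin 3)) ℂ) 
    (him : ∀ ξ, (𝓕 h ξ).im = 0) (hre : ∀ ξ, 0 ≤ (𝓕 h ξ).re) {t s : ℝ} (ht : 0 < t) (hs : 0 < s) :
    ∫⁻ η, (∫⁻ ξ, ENNReal.ofReal (𝓕 h ξ).re * ENNReal.ofReal (t ^ (-3/2:ℝ) * Real.exp (-Real.pi * ‖η - ξ‖^2 / t))) *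
      (∫⁻ ξ, ENNReal.ofReal (𝓕 h ξ).re * ENNReal.ofReal (s ^ (-3/2:ℝ) * Real.exp (-Real.pi * ‖η - ξ‖^2 / s)))
     = ∫⁻ x, ‖h x‖ₑ ^ 2 * (ENNReal.ofReal (Real.exp (-(Real.pi * t) * ‖x‖^2)) * 
         ENNReal.ofReal (Real.exp (-(Real.pi * s) * ‖x‖^2))) := by
  have A := fun η => fourier_lint h him hre ht η
  have B := fun η => fourier_lint h him hre hs η
  have P := SchwartzMap.integral_inner_fourier_fourier (hgs h t) (hgs h s)
  have e1 : ∀ η, (inner ℂ (𝓕 (hgs h t) η) (𝓕 (hgs h s) η) : ℂ) = 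
     (((𝓕 (hgs h t) η).re * (𝓕 (hgs h s) η).re : ℝ) : ℂ) := by
    intro η
    apply Complex.ext <;> simp [(A η).1, (B η).1, mul_comm]
  have e2 : ∀ x, (inner ℂ (hgs h t x) (hgs h s x) : ℂ) = 
     ((‖h x‖^2 * (Real.exp (-(Real.pi * t) * ‖x‖^2) * Real.exp (-(Real.pi * s) * ‖x‖^2)) : ℝ) : ℂ) := by
    intro x
    rw [hgs_apply h ht, hgs_apply h hs, RCLike.inner_apply, map_mul, Complex.conj_ofReal,
      Complex.ofReal_mul, Complex.ofReal_pow, ← Complex.mul_conj', Complex.ofReal_mul]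
    ring
  simp only [e1, e2, integral_complex_ofReal, Complex.ofReal_inj] at P
  have i1 : Integrable fun η => (𝓕 (hgs h t) η).re * (𝓕 (hgs h s) η).re :=
    ((𝓕 (hgs h t)).memLp 2).re.integrable_mul ((𝓕 (hgs h s)).memLp 2).re
  have i2 : Integrable fun x => ‖h x‖^2 * (Real.exp (-(Real.pi * t) * ‖x‖^2) * Real.exp (-(Real.pi * s) * ‖x‖^2)) := by
    have := ((hgs h t).memLp 2).norm.integrable_mul ((hgs h s).memLp 2).norm
    refine this.congr (ae_of_all _ fun x => ?_)
    simp only [Pi.mul_apply]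
    rw [hgs_apply h ht, hgs_apply h hs, norm_mul, norm_mul, Complex.norm_real, Complex.norm_real,
      Real.norm_of_nonneg (Real.exp_nonneg _), Real.norm_of_nonneg (Real.exp_nonneg _)]
    ring
  calc _ = ∫⁻ η, ENNReal.ofReal ((𝓕 (hgs h t) η).re * (𝓕 (hgs h s) η).re) := by
        congr 1; ext η; rw [(A η).2.2, (B η).2.2, ENNReal.ofReal_mul (A η).2.1]
    _ = _ := by
        rw [← ofReal_integral_eq_lintegral_ofReal i1
          (ae_of_all _ fun η => mul_nonneg (A η).2.1 (B η).2.1), P,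
          ofReal_integral_eq_lintegral_ofReal i2 (ae_of_all _ fun η => by positivity)]
        congr 1; ext x
        rw [ENNReal.ofReal_mul (by positivity), ENNReal.ofReal_mul (by positivity),
          ENNReal.ofReal_pow (by positivity), ofReal_norm]
lemma core (h : SchwartzMap (EuclideanSpace ℝ (Fin 3)) ℂ) 
    (him : ∀ ξ, (𝓕 h ξ).im = 0) (hre : ∀ ξ, 0 ≤ (𝓕 h ξ).re) :
    ∫⁻ z : EuclideanSpace ℝ (Fin 3) × EuclideanSpace ℝ (Fin 3) × EuclideanSpace ℝ (Fin 3),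
        ENNReal.ofReal ((𝓕 h z.2.1).re * (𝓕 h z.2.2).re /
          (‖z.1 - z.2.1‖ ^ 2 * ‖z.1 - z.2.2‖ ^ 2))
     ≤ ENNReal.ofReal (Real.pi ^ 2) * ∫⁻ x, ‖h x‖ₑ ^ 2 * (‖x‖ₑ⁻¹) ^ 2 := by
  have hHm : Measurable fun ξ => ENNReal.ofReal (𝓕 h ξ).re := by
    have : Continuous fun ξ => (𝓕 h ξ).re := by fun_prop
    exact this.measurable.ennreal_ofReal
  have hHm' : Measurable fun ξ => (𝓕 h ξ).re := by
    have : Continuous fun ξ => (𝓕 h ξ).re := by fun_prop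
    exact this.measurable
  have hhm : Measurable fun x => ‖h x‖ₑ ^ 2 := (h.continuous.enorm.measurable).pow_const 2
  set F : EuclideanSpace ℝ (Fin 3) → EuclideanSpace ℝ (Fin 3) → ℝ≥0∞ := fun η ξ =>
    ENNReal.ofReal (𝓕 h ξ).re * ENNReal.ofReal (1 / ‖η - ξ‖^2) with hF
  have hFm : ∀ η, Measurable (F η) := fun η => by
    refine hHm.mul ?_
    fun_prop
  set a : ℝ → EuclideanSpace ℝ (Fin 3) → ℝ≥0∞ := fun t η =>
    ∫⁻ ξ, ENNReal.ofReal (𝓕 h ξ).re * ENNReal.ofReal (t ^ (-3/2:ℝ) * Real.exp (-Real.pi * ‖η - ξ‖^2 / t)) with ha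
  have ham : Measurable fun p : ℝ × EuclideanSpace ℝ (Fin 3) => a p.1 p.2 := by
    apply Measurable.lintegral_prod_right' (f := fun q : (ℝ × EuclideanSpace ℝ (Fin 3)) × EuclideanSpace ℝ (Fin 3) =>
      ENNReal.ofReal (𝓕 h q.2).re * ENNReal.ofReal (q.1.1 ^ (-3/2:ℝ) * Real.exp (-Real.pi * ‖q.1.2 - q.2‖^2 / q.1.1)))
    refine (hHm.comp measurable_snd).mul ?_
    fun_prop
  set w : ℝ → ℝ≥0∞ := fun t => ENNReal.ofReal (t ^ (-1/2:ℝ)) with hw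
  have hwm : Measurable w := by fun_prop
  have hwa : Measurable fun p : ℝ × EuclideanSpace ℝ (Fin 3) => w p.1 * a p.1 p.2 :=
    (hwm.comp measurable_fst).mul ham
  have hwa1 : ∀ η, Measurable fun t => w t * a t η := fun η =>
    hwa.comp (measurable_id.prodMk measurable_const)
  have step2 : ∀ η, ∫⁻ ξ, F η ξ ≤ ENNReal.ofReal Real.pi * ∫⁻ t in Ioi (0:ℝ), w t * a t η := by
    intro η
    calc ∫⁻ ξ, F η ξ ≤ ∫⁻ ξ, ENNReal.ofReal Real.pi * ∫⁻ t in Ioi (0:ℝ), w t * 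
          (ENNReal.ofReal (𝓕 h ξ).re * ENNReal.ofReal (t ^ (-3/2:ℝ) * Real.exp (-Real.pi * ‖η - ξ‖^2 / t))) := by
          refine lintegral_mono fun ξ => ?_
          refine (mul_le_mul_right (int_four (η - ξ)) (ENNReal.ofReal (𝓕 h ξ).re)).trans (le_of_eq ?_)
          rw [mul_left_comm, ← lintegral_const_mul]
          · congr 2; ext t; simp only [hw]; ring
          · fun_prop
      _ = _ := by
          have hm : Measurable fun p : EuclideanSpace ℝ (Fin 3) × ℝ => w p.2 * 
            (ENNReal.ofReal (𝓕 h p.1).re * ENNReal.ofReal (p.2 ^ (-3/2:ℝ) * Real.exp (-Real.pi * ‖η - p.1‖^2 / p.2))) := by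
            refine (hwm.comp measurable_snd).mul ((hHm.comp measurable_fst).mul ?_)
            fun_prop
          rw [lintegral_const_mul _ hm.lintegral_prod_right', lintegral_lintegral_swap hm.aemeasurable]
          congr 2; ext t
          dsimp only
          rw [lintegral_const_mul]
          refine hHm.mul ?_
          fun_prop
  have hm3 : Measurable fun p : (EuclideanSpace ℝ (Fin 3) × ℝ) × ℝ => 
      (w p.1.2 * a p.1.2 p.1.1) * (w p.2 * a p.2 p.1.1) :=
    (hwa.comp (f := fun p : (EuclideanSpace ℝ (Fin 3) × ℝ) × ℝ => (p.1.2, p.1.1)) (by fun_prop)).mul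
      (hwa.comp (f := fun p : (EuclideanSpace ℝ (Fin 3) × ℝ) × ℝ => (p.2, p.1.1)) (by fun_prop))
  have hg3 : Measurable fun p : (EuclideanSpace ℝ (Fin 3) × ℝ) × ℝ => ‖h p.1.1‖ₑ ^ 2 *
      ((w p.1.2 * ENNReal.ofReal (Real.exp (-(Real.pi * p.1.2) * ‖p.1.1‖^2))) *
       (w p.2 * ENNReal.ofReal (Real.exp (-(Real.pi * p.2) * ‖p.1.1‖^2)))) := by
    refine (hhm.comp (measurable_fst.comp measurable_fst)).mul ?_
    fun_prop
  have swap3 : ∀ f : EuclideanSpace ℝ (Fin 3) → ℝ → ℝ → ℝ≥0∞,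
      Measurable (fun p : (EuclideanSpace ℝ (Fin 3) × ℝ) × ℝ => f p.1.1 p.1.2 p.2) →
      ∫⁻ η, ∫⁻ t in Ioi (0:ℝ), ∫⁻ s in Ioi (0:ℝ), f η t s =
      ∫⁻ t in Ioi (0:ℝ), ∫⁻ s in Ioi (0:ℝ), ∫⁻ η, f η t s := by
    intro f hf
    rw [lintegral_lintegral_swap]
    · congr 1; ext t
      rw [lintegral_lintegral_swap]
      exact (hf.comp (f := fun p : EuclideanSpace ℝ (Fin 3) × ℝ => ((p.1, t), p.2)) (by fun_prop)).aemeasurable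
    · exact (hf.lintegral_prod_right').aemeasurable
  have sq_int : ∀ g : ℝ → ℝ≥0∞, Measurable g → (∫⁻ t in Ioi (0:ℝ), g t) ^ 2 =
      ∫⁻ t in Ioi (0:ℝ), ∫⁻ s in Ioi (0:ℝ), g t * g s := by
    intro g hg
    rw [sq, ← lintegral_mul_const _ hg]
    congr 1; ext t
    rw [lintegral_const_mul _ hg]
  have h0 : ∀ᵐ x : EuclideanSpace ℝ (Fin 3), x ≠ 0 := by
    simp [ae_iff]
  calc _ = ∫⁻ η, (∫⁻ ξ, F η ξ) ^ 2 := by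
        rw [Measure.volume_eq_prod, lintegral_prod]
        · congr 1; ext η
          rw [sq, ← lintegral_prod_mul (hFm η).aemeasurable (hFm η).aemeasurable, Measure.volume_eq_prod]
          congr 1; ext z
          simp only [hF]
          rw [← ENNReal.ofReal_mul (hre _), ← ENNReal.ofReal_mul (hre _), ← ENNReal.ofReal_mul]
          · congr 1
            rw [mul_one_div, mul_one_div, div_mul_div_comm]
          · have := hre z.1
            positivity
        · refine (Measurable.ennreal_ofReal ?_).aemeasurable
          refine ((hHm'.comp (measurable_fst.comp measurable_snd)).mul (hHm'.comp (measurable_snd.comp measurable_snd))).div ?_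
          fun_prop
    _ ≤ ∫⁻ η, ENNReal.ofReal (Real.pi ^ 2) * (∫⁻ t in Ioi (0:ℝ), w t * a t η) ^ 2 := by
        refine lintegral_mono fun η => ?_
        rw [ENNReal.ofReal_pow Real.pi_nonneg, ← mul_pow]
        exact pow_le_pow_left' (step2 η) 2
    _ = ENNReal.ofReal (Real.pi ^ 2) * ∫⁻ η, ∫⁻ t in Ioi (0:ℝ), ∫⁻ s in Ioi (0:ℝ), 
          (w t * a t η) * (w s * a s η) := by
        rw [lintegral_const_mul' _ _ ENNReal.ofReal_ne_top]
        congr 2; ext η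
        exact sq_int _ (hwa1 η)
    _ = ENNReal.ofReal (Real.pi ^ 2) * ∫⁻ x, ∫⁻ t in Ioi (0:ℝ), ∫⁻ s in Ioi (0:ℝ), ‖h x‖ₑ ^ 2 *
      ((w t * ENNReal.ofReal (Real.exp (-(Real.pi * t) * ‖x‖^2))) *
       (w s * ENNReal.ofReal (Real.exp (-(Real.pi * s) * ‖x‖^2)))) := by
        rw [swap3 _ hm3, swap3 _ hg3]
        congr 1
        refine setLIntegral_congr_fun measurableSet_Ioi fun t ht => ?_
        refine setLIntegral_congr_fun measurableSet_Ioi fun s hs => ?_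
        have P := planch h him hre (t := t) (s := s) ht hs
        have l : ∀ η, (w t * a t η) * (w s * a s η) = (w t * w s) * (a t η * a s η) := fun η => by ring
        have l2 : ∀ x, ‖h x‖ₑ ^ 2 *
           ((w t * ENNReal.ofReal (Real.exp (-(Real.pi * t) * ‖x‖^2))) *
           (w s * ENNReal.ofReal (Real.exp (-(Real.pi * s) * ‖x‖^2)))) = (w t * w s) * (‖h x‖ₑ ^ 2 *
           (ENNReal.ofReal (Real.exp (-(Real.pi * t) * ‖x‖^2)) *
           ENNReal.ofReal (Real.exp (-(Real.pi * s) * ‖x‖^2)))) := fun x => by ring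
        have hne : w t * w s ≠ ⊤ := ENNReal.mul_ne_top ENNReal.ofReal_ne_top ENNReal.ofReal_ne_top
        simp only [l, l2]
        rw [lintegral_const_mul' _ _ hne, lintegral_const_mul' _ _ hne, P]
    _ = _ := by
        congr 1
        refine lintegral_congr_ae ?_
        filter_upwards [h0] with x hx
        rw [← int_phys x hx, sq_int _ (by fun_prop), ← lintegral_const_mul' _ _ (by simp)]
        congr 1; ext t
        rw [← lintegral_const_mul' _ _ (by simp)]

/-- For a Schwartz `h : ℝ³ → ℂ` whose Fourier transform `ĥ` (with the convention
`ĥ(k) = (2π)^{−3/2} ∫ e^{−ik·x} h(x) dx`) is real and nonnegative,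
`∫∫∫ ĥ(k)ĥ(k')/(|p−k|²|p−k'|²) dp dk dk' ≤ 16π⁴ (‖h‖²_{L²} + ‖∇h‖²_{L²})`. -/
theorem stmt_5 (h : SchwartzMap (EuclideanSpace ℝ (Fin 3)) ℂ)
    (hhat : EuclideanSpace ℝ (Fin 3) → ℂ)
    (hdef : ∀ k, hhat k = ((2 * Real.pi : ℝ) ^ (-(3 : ℝ) / 2)) •
      ∫ x : EuclideanSpace ℝ (Fin 3),
        Complex.exp (-Complex.I * Complex.ofReal (inner ℝ k x : ℝ)) * h x)
    (hreal : ∀ k, (hhat k).im = 0) (hpos : ∀ k, 0 ≤ (hhat k).re) :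
    ∫⁻ z : EuclideanSpace ℝ (Fin 3) × EuclideanSpace ℝ (Fin 3) × EuclideanSpace ℝ (Fin 3),
        ENNReal.ofReal ((hhat z.2.1).re * (hhat z.2.2).re /
          (‖z.1 - z.2.1‖ ^ 2 * ‖z.1 - z.2.2‖ ^ 2))
      ≤ ENNReal.ofReal (16 * Real.pi ^ 4 *
          ((∫ x : EuclideanSpace ℝ (Fin 3), ‖h x‖ ^ 2) +
            ∫ x : EuclideanSpace ℝ (Fin 3), ‖fderiv ℝ (⇑h) x‖ ^ 2)) := by
  have hpi : 0 < 2 * Real.pi := by positivity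
  set c : ℝ := (2 * Real.pi : ℝ) ^ (-(3 : ℝ) / 2) with hc
  have hc0 : 0 < c := by positivity
  have hc2 : c * c = ((2 * Real.pi) ^ 3)⁻¹ := by
    rw [hc, ← Real.rpow_add hpi, ← Real.rpow_natCast, ← Real.rpow_neg hpi.le]; norm_num
  have hk : ∀ k, hhat k = c • 𝓕 h ((2 * Real.pi)⁻¹ • k) := by
    intro k
    have e3 : 𝓕 h ((2 * Real.pi)⁻¹ • k) = 𝓕 (⇑h) ((2 * Real.pi)⁻¹ • k) := by
      rw [SchwartzMap.fourier_coe]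
    rw [hdef, e3, Real.fourier_eq']
    congr 2; ext x
    rw [smul_eq_mul, inner_smul_right, real_inner_comm]
    congr 2
    have : (Real.pi : ℂ) ≠ 0 := by exact_mod_cast Real.pi_ne_zero
    push_cast; field_simp
  have hre : ∀ ξ, (𝓕 h ξ).re = c⁻¹ * (hhat ((2 * Real.pi) • ξ)).re := by
    intro ξ
    rw [hk, inv_smul_smul₀ hpi.ne', Complex.smul_re, smul_eq_mul, inv_mul_cancel_left₀ hc0.ne']
  have hre0 : ∀ ξ, 0 ≤ (𝓕 h ξ).re := by
    intro ξ; rw [hre]; have := hpos ((2 * Real.pi) • ξ); positivity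
  have him : ∀ ξ, (𝓕 h ξ).im = 0 := by
    intro ξ
    have := hreal ((2 * Real.pi) • ξ)
    rw [hk, inv_smul_smul₀ hpi.ne', Complex.smul_im, smul_eq_mul] at this
    exact (mul_eq_zero.1 this).resolve_left hc0.ne'
  have hHm' : Measurable fun ξ => (𝓕 h ξ).re := by
    have : Continuous fun ξ => (𝓕 h ξ).re := by fun_prop
    exact this.measurable
  set g : EuclideanSpace ℝ (Fin 3) × EuclideanSpace ℝ (Fin 3) × EuclideanSpace ℝ (Fin 3) → ℝ≥0∞ := fun z =>
    ENNReal.ofReal ((𝓕 h z.2.1).re * (𝓕 h z.2.2).re /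
          (‖z.1 - z.2.1‖ ^ 2 * ‖z.1 - z.2.2‖ ^ 2)) with hg
  have hgm : Measurable g := by
    refine Measurable.ennreal_ofReal ?_
    refine ((hHm'.comp (measurable_fst.comp measurable_snd)).mul (hHm'.comp (measurable_snd.comp measurable_snd))).div ?_
    fun_prop
  have hfr : Module.finrank ℝ (EuclideanSpace ℝ (Fin 3) × EuclideanSpace ℝ (Fin 3) × EuclideanSpace ℝ (Fin 3)) = 9 := by
    simp
  have hfg : ∀ z : EuclideanSpace ℝ (Fin 3) × EuclideanSpace ℝ (Fin 3) × EuclideanSpace ℝ (Fin 3),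
    ENNReal.ofReal ((hhat z.2.1).re * (hhat z.2.2).re /
          (‖z.1 - z.2.1‖ ^ 2 * ‖z.1 - z.2.2‖ ^ 2)) =
     ENNReal.ofReal (((2 * Real.pi) ^ 7)⁻¹) * g ((2 * Real.pi)⁻¹ • z) := by
    intro z
    simp only [hg, Prod.smul_fst, Prod.smul_snd]
    rw [← ENNReal.ofReal_mul (by positivity), ← smul_sub, ← smul_sub, norm_smul, norm_smul, hk, hk,
      Complex.smul_re, Complex.smul_re, smul_eq_mul, smul_eq_mul, Real.norm_of_nonneg (by positivity)]
    congr 1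
    rw [mul_mul_mul_comm, hc2]
    field_simp
  have hder : Integrable fun x => ‖fderiv ℝ (⇑h) x‖ ^ 2 := by
    have := ((SchwartzMap.fderivCLM ℝ (EuclideanSpace ℝ (Fin 3)) ℂ h).memLp 2).integrable_norm_pow (by norm_num)
    simpa using this
  have hderl : ∫⁻ x, ‖fderiv ℝ (⇑h) x‖ₑ ^ 2 = ENNReal.ofReal (∫ x, ‖fderiv ℝ (⇑h) x‖ ^ 2) := by
    rw [ofReal_integral_eq_lintegral_ofReal hder (ae_of_all _ fun x => by positivity)]
    congr 1; ext x
    rw [ENNReal.ofReal_pow (by positivity), ofReal_norm]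
  have inst1 : (volume : Measure (EuclideanSpace ℝ (Fin 3) × EuclideanSpace ℝ (Fin 3))).IsAddHaarMeasure :=
    Measure.prod.instIsAddHaarMeasure _ _
  have inst2 : (volume : Measure (EuclideanSpace ℝ (Fin 3) × EuclideanSpace ℝ (Fin 3) ×
      EuclideanSpace ℝ (Fin 3))).IsAddHaarMeasure :=
    Measure.prod.instIsAddHaarMeasure _ _
  simp only [hfg]
  rw [lintegral_const_mul' _ _ ENNReal.ofReal_ne_top, lint_scale _ _ (by positivity) g hgm, hfr]
  calc _ ≤ ENNReal.ofReal (((2 * Real.pi) ^ 7)⁻¹) * (ENNReal.ofReal ((((2 * Real.pi)⁻¹) ^ 9)⁻¹) *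
        (ENNReal.ofReal (Real.pi ^ 2) * (4 * ENNReal.ofReal (∫ x, ‖fderiv ℝ (⇑h) x‖ ^ 2)))) := by
        gcongr
        refine (core h him hre0).trans ?_
        gcongr
        exact (hardy h).trans_eq (by rw [hderl])
    _ = ENNReal.ofReal (16 * Real.pi ^ 4 * ∫ x, ‖fderiv ℝ (⇑h) x‖ ^ 2) := by
        have h4 : (4 : ℝ≥0∞) = ENNReal.ofReal 4 := by norm_num
        rw [h4, ← ENNReal.ofReal_mul (by norm_num), ← ENNReal.ofReal_mul (by positivity),
          ← ENNReal.ofReal_mul (by positivity), ← ENNReal.ofReal_mul (by positivity)]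
        congr 1
        field_simp
        norm_num
        ring
    _ ≤ _ := by
        apply ENNReal.ofReal_le_ofReal
        gcongr
        exact le_add_of_nonneg_left (integral_nonneg fun x => by positivity)
end

section
/- Let λ > 0 and x₁, x₂ ∈ ℝ³ with x₁ ≠ x₂, and set R = |x₁ − x₂|. Then ∫_{ℝ³} |g^λ(x − x₂) − g^λ(x − x₁)|² dx = 16 ∫_0^∞ p²/(p² + λ)² · (1 − sin(pR)/(pR)) dp. -/
open MeasureTheory

open Filter Topology in
lemma erf_lim : ∃ Φ : ℝ → ℝ, (∀ x, HasDerivAt Φ (Real.exp (-x^2)) x) ∧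
    Tendsto Φ atTop (𝓝 (√Real.pi/2)) ∧ Tendsto Φ atBot (𝓝 (-(√Real.pi/2))) := by
  have hc : Continuous (fun u : ℝ => Real.exp (-u^2)) := by fun_prop
  have hi : Integrable (fun u : ℝ => Real.exp (-u^2)) := by
    simpa using integrable_exp_neg_mul_sq (b := 1) one_pos
  have h0 : ∫ u in Set.Ioi (0:ℝ), Real.exp (-u^2) = √Real.pi/2 := by
    simpa using integral_gaussian_Ioi 1
  have h1 : Tendsto (fun x : ℝ => ∫ u in (0:ℝ)..x, Real.exp (-u^2)) atTop (𝓝 (√Real.pi/2)) := by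
    rw [← h0]
    exact intervalIntegral_tendsto_integral_Ioi 0 hi.integrableOn tendsto_id
  refine ⟨fun x => ∫ u in (0:ℝ)..x, Real.exp (-u^2), fun x => ?_, h1, ?_⟩
  · exact intervalIntegral.integral_hasDerivAt_right (hc.intervalIntegrable _ _)
      (hc.stronglyMeasurableAtFilter _ _) hc.continuousAt
  · have h2 := (h1.comp tendsto_neg_atBot_atTop).neg
    refine h2.congr fun x => ?_
    have := intervalIntegral.integral_comp_neg (a := 0) (b := x) (fun u : ℝ => Real.exp (-u^2))
    simp only [neg_sq, neg_zero] at this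
    simp only [Function.comp]
    rw [this, intervalIntegral.integral_symm, neg_neg]

open Filter Topology in
lemma subord (a r : ℝ) (ha : 0 < a) (hr : 0 < r) :
    ∫⁻ t in Set.Ioi (0:ℝ), ENNReal.ofReal
      (1/(2*√Real.pi) * (1/√t^3) * Real.exp (-r^2/(4*t) - a^2*t)) =
    ENNReal.ofReal (Real.exp (-a*r)/r) := by
  obtain ⟨Φ, hd, hT, hB⟩ := erf_lim
  have hpi : 0 < √Real.pi := Real.sqrt_pos.2 Real.pi_pos
  set F : ℝ → ℝ := fun t => 1/(2*√Real.pi) * ((2/r) * (Real.exp (-a*r) * Φ (a*√t - r/2*(√t)⁻¹)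
    - Real.exp (a*r) * Φ (a*√t + r/2*(√t)⁻¹))) with hF
  set l0 : ℝ := 1/(2*√Real.pi) * ((2/r) * (Real.exp (-a*r) * (-(√Real.pi/2))
    - Real.exp (a*r) * (√Real.pi/2)))
  set l1 : ℝ := 1/(2*√Real.pi) * ((2/r) * (Real.exp (-a*r) * (√Real.pi/2)
    - Real.exp (a*r) * (√Real.pi/2)))
  have s0 : Tendsto (fun t => √t) (𝓝[>] (0:ℝ)) (𝓝[>] 0) := by
    rw [tendsto_nhdsWithin_iff]
    constructor
    · have : Tendsto (fun t => √t) (𝓝 (0:ℝ)) (𝓝 √0) := Real.continuous_sqrt.tendsto 0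
      rw [Real.sqrt_zero] at this
      exact this.mono_left nhdsWithin_le_nhds
    · filter_upwards [self_mem_nhdsWithin] with t ht using Real.sqrt_pos.2 ht
  have si0 : Tendsto (fun t => r/2*(√t)⁻¹) (𝓝[>] (0:ℝ)) atTop :=
    (tendsto_inv_nhdsGT_zero.comp s0).const_mul_atTop (by positivity)
  have sa0 : Tendsto (fun t => a*√t) (𝓝[>] (0:ℝ)) (𝓝 (a*0)) :=
    (s0.mono_right nhdsWithin_le_nhds).const_mul a
  have s1 : Tendsto (fun t => a*√t) atTop atTop := Real.tendsto_sqrt_atTop.const_mul_atTop ha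
  have si1 : Tendsto (fun t => r/2*(√t)⁻¹) atTop (𝓝 (r/2*0)) :=
    (tendsto_inv_atTop_zero.comp Real.tendsto_sqrt_atTop).const_mul _
  have L0 : Tendsto F (𝓝[>] 0) (𝓝 l0) := by
    have e1 : Tendsto (fun t => a*√t - r/2*(√t)⁻¹) (𝓝[>] (0:ℝ)) atBot := by
      simpa [sub_eq_add_neg] using sa0.add_atBot (tendsto_neg_atTop_atBot.comp si0)
    have e2 : Tendsto (fun t => a*√t + r/2*(√t)⁻¹) (𝓝[>] (0:ℝ)) atTop := sa0.add_atTop si0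
    exact ((((hB.comp e1).const_mul _).sub ((hT.comp e2).const_mul _)).const_mul _).const_mul _
  have L1 : Tendsto F atTop (𝓝 l1) := by
    have e1 : Tendsto (fun t => a*√t - r/2*(√t)⁻¹) atTop atTop := by
      simpa [sub_eq_add_neg] using s1.atTop_add si1.neg
    have e2 : Tendsto (fun t => a*√t + r/2*(√t)⁻¹) atTop atTop := s1.atTop_add si1
    exact ((((hT.comp e1).const_mul _).sub ((hT.comp e2).const_mul _)).const_mul _).const_mul _
  have hder : ∀ t ∈ Set.Ioi (0:ℝ), HasDerivAt F
      (1/(2*√Real.pi) * (1/√t^3) * Real.exp (-r^2/(4*t) - a^2*t)) t := by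
    intro t ht
    have ht : 0 < t := ht
    have hs : 0 < √t := Real.sqrt_pos.2 ht
    have d1 := Real.hasDerivAt_sqrt ht.ne'
    have d2 := d1.inv hs.ne'
    have d3 := (hd (a*√t - r/2*(√t)⁻¹)).comp t ((d1.const_mul a).sub (d2.const_mul (r/2)))
    have d4 := (hd (a*√t + r/2*(√t)⁻¹)).comp t ((d1.const_mul a).add (d2.const_mul (r/2)))
    have d5 := (((d3.const_mul (Real.exp (-a*r))).sub (d4.const_mul (Real.exp (a*r)))).const_mul
      (2/r)).const_mul (1/(2*√Real.pi))
    refine d5.congr_deriv ?_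
    have hsq : √t^2 = t := Real.sq_sqrt ht.le
    have x1 : Real.exp (-(a*√t - r/2*(√t)⁻¹)^2) =
        Real.exp (a*r) * Real.exp (-r^2/(4*t) - a^2*t) := by
      rw [← Real.exp_add]; congr 1; rw [← hsq]; simp only [Real.sqrt_sq hs.le]; field_simp; ring
    have x2 : Real.exp (-(a*√t + r/2*(√t)⁻¹)^2) =
        Real.exp (-a*r) * Real.exp (-r^2/(4*t) - a^2*t) := by
      rw [← Real.exp_add]; congr 1; rw [← hsq]; simp only [Real.sqrt_sq hs.le]; field_simp; ring
    have x3 : Real.exp (-a*r) = (Real.exp (a*r))⁻¹ := by rw [← Real.exp_neg]; ring_nf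
    rw [x1, x2, x3]
    have := Real.exp_pos (a*r)
    field_simp
    ring
  set G := Function.update F 0 l0
  have hG : ContinuousWithinAt G (Set.Ici 0) 0 := by
    rw [continuousWithinAt_update_same]
    simpa using L0
  have hGd : ∀ t ∈ Set.Ioi (0:ℝ), HasDerivAt G
      (1/(2*√Real.pi) * (1/√t^3) * Real.exp (-r^2/(4*t) - a^2*t)) t := by
    intro t ht
    refine (hder t ht).congr_of_eventuallyEq ?_
    filter_upwards [lt_mem_nhds ht] with y hy
    exact Function.update_of_ne (ne_of_gt hy) _ _
  have hGl : Tendsto G atTop (𝓝 l1) := by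
    refine L1.congr' ?_
    filter_upwards [eventually_gt_atTop 0] with y hy
    exact (Function.update_of_ne (ne_of_gt hy) _ _).symm
  have hpos : ∀ t ∈ Set.Ioi (0:ℝ), 0 ≤ 
      (1/(2*√Real.pi) * (1/√t^3) * Real.exp (-r^2/(4*t) - a^2*t)) := fun t _ => by positivity
  have hint := integrableOn_Ioi_deriv_of_nonneg hG hGd hpos hGl
  have hval := integral_Ioi_of_hasDerivAt_of_nonneg hG hGd hpos hGl
  rw [← ofReal_integral_eq_lintegral_ofReal hint
    (by filter_upwards with t; positivity), hval]
  congr 1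
  simp only [G, Function.update_self, l0, l1]
  field_simp
  ring

lemma tonelli {X : Type*} [MeasurableSpace X] (ν : Measure X) [SFinite ν] (μ : Measure ℝ) [SFinite μ]
    (k1 k2 : ℝ → X → ENNReal) (W : X → ENNReal)
    (h1 : Measurable (Function.uncurry k1)) (h2 : Measurable (Function.uncurry k2))
    (hW : Measurable W) :
    ∫⁻ x, (∫⁻ t, k1 t x ∂μ) * (∫⁻ s, k2 s x ∂μ) * W x ∂ν =
    ∫⁻ t, ∫⁻ s, ∫⁻ x, k1 t x * k2 s x * W x ∂ν ∂μ ∂μ := by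
  have m1 : ∀ x, Measurable (fun t => k1 t x) := fun x => h1.comp (measurable_id.prodMk measurable_const)
  have m2 : ∀ x, Measurable (fun t => k2 t x) := fun x => h2.comp (measurable_id.prodMk measurable_const)
  have e : ∀ x, (∫⁻ t, k1 t x ∂μ) * (∫⁻ s, k2 s x ∂μ) * W x =
      ∫⁻ z, k1 z.1 x * k2 z.2 x * W x ∂(μ.prod μ) := by
    intro x
    rw [lintegral_mul_const _ (by have := m1 x; have := m2 x; fun_prop), lintegral_prod_mul (m1 x).aemeasurable (m2 x).aemeasurable]
  have hm : Measurable (Function.uncurry fun (x : X) (z : ℝ × ℝ) => k1 z.1 x * k2 z.2 x * W x) := by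
    have q1 : Measurable (fun p : X × ℝ × ℝ => k1 p.2.1 p.1) := h1.comp (by fun_prop : Measurable fun p : X × ℝ × ℝ => (p.2.1, p.1))
    have q2 : Measurable (fun p : X × ℝ × ℝ => k2 p.2.2 p.1) := h2.comp (by fun_prop : Measurable fun p : X × ℝ × ℝ => (p.2.2, p.1))
    exact (q1.mul q2).mul (hW.comp measurable_fst)
  simp_rw [e]
  rw [lintegral_lintegral_swap hm.aemeasurable]
  rw [lintegral_prod]
  exact (Measurable.lintegral_prod_left' hm).aemeasurable

lemma intA (u : ℝ) (hu : 0 < u) :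
    IntegrableOn (fun p : ℝ => p^2 * Real.exp (-u*p^2)) (Set.Ioi 0) ∧
    ∫ p in Set.Ioi (0:ℝ), p^2 * Real.exp (-u*p^2) = √Real.pi/4 * (1/√u^3) := by
  constructor
  · have := integrable_rpow_mul_exp_neg_mul_sq hu (s := 2) (by norm_num)
    simpa using this.integrableOn
  · have := integral_rpow_mul_exp_neg_mul_rpow (p := 2) (q := 2) (b := u) (by norm_num) (by norm_num) hu
    simp only [Real.rpow_two] at this
    rw [this]
    have g : Real.Gamma ((2+1)/2) = √Real.pi/2 := by
      rw [show ((2:ℝ)+1)/2 = 1/2+1 by norm_num, Real.Gamma_add_one (by norm_num), Real.Gamma_one_half_eq]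
      ring
    have h : u ^ (-((2:ℝ)+1)/2) = 1/√u^3 := by
      rw [Real.sqrt_eq_rpow, ← Real.rpow_natCast, ← Real.rpow_mul hu.le, one_div, ← Real.rpow_neg hu.le]
      norm_num
    rw [g, h]; ring

lemma intCos (u R : ℝ) (hu : 0 < u) :
    Integrable (fun p : ℝ => Real.cos (p*R) * Real.exp (-u*p^2)) ∧
    ∫ p : ℝ, Real.cos (p*R) * Real.exp (-u*p^2) = √Real.pi/√u * Real.exp (-R^2/(4*u)) := by
  have hi : Integrable (fun p : ℝ => Real.cos (p*R) * Real.exp (-u*p^2)) := by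
    refine (integrable_exp_neg_mul_sq hu).mono' (by fun_prop) ?_
    filter_upwards with p
    rw [norm_mul, Real.norm_eq_abs, Real.norm_eq_abs, abs_of_pos (Real.exp_pos _)]
    exact mul_le_of_le_one_left (Real.exp_pos _).le (Real.abs_cos_le_one _)
  refine ⟨hi, ?_⟩
  have h := fourierIntegral_gaussian (b := (u:ℂ)) (by simpa using hu) (R:ℂ)
  have hI : Integrable (fun x : ℝ => Complex.exp (Complex.I * R * x) * Complex.exp (-u * x^2)) := by
    have := integrable_cexp_quadratic (b := (u:ℂ)) (by simpa using hu) (Complex.I*R) 0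
    refine this.congr ?_
    filter_upwards with x
    rw [← Complex.exp_add]; ring_nf
  have h2 := congrArg Complex.re h
  have h3 := integral_re hI
  simp only [RCLike.re_to_complex] at h3
  rw [← h3] at h2
  have e1 : ∀ x : ℝ, (Complex.exp (Complex.I * R * x) * Complex.exp (-u * x^2)).re =
      Real.cos (x*R) * Real.exp (-u*x^2) := by
    intro x
    have : Complex.exp (-u * x^2) = ((Real.exp (-u*x^2) : ℝ) : ℂ) := by push_cast; rfl
    rw [this, Complex.re_mul_ofReal, show Complex.I * R * x = ((x*R : ℝ):ℂ) * Complex.I by push_cast; ring,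
      Complex.exp_ofReal_mul_I_re]
  simp_rw [e1] at h2
  rw [h2]
  have e2 : ((Real.pi:ℂ)/u)^(1/2:ℂ) = ((√Real.pi/√u : ℝ) : ℂ) := by
    rw [← Real.sqrt_div Real.pi_pos.le, Real.sqrt_eq_rpow, Complex.ofReal_cpow (by positivity)]
    push_cast; rfl
  have e3 : Complex.exp (-(R:ℂ)^2/(4*u)) = ((Real.exp (-R^2/(4*u)) : ℝ):ℂ) := by push_cast; rfl
  rw [e2, e3, ← Complex.ofReal_mul, Complex.ofReal_re]

lemma intB (u R : ℝ) (hu : 0 < u) :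
    IntegrableOn (fun p : ℝ => p * Real.sin (p*R) * Real.exp (-u*p^2)) (Set.Ioi 0) ∧
    ∫ p in Set.Ioi (0:ℝ), p * Real.sin (p*R) * Real.exp (-u*p^2) =
      R * (√Real.pi/4 * (1/√u^3) * Real.exp (-R^2/(4*u))) := by
  obtain ⟨hc, hcv⟩ := intCos u R hu
  have hi : Integrable (fun p : ℝ => p * Real.sin (p*R) * Real.exp (-u*p^2)) := by
    refine (integrable_mul_exp_neg_mul_sq hu).norm.mono' (by fun_prop) ?_
    filter_upwards with p
    rw [norm_mul, norm_mul, norm_mul]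
    gcongr
    exact mul_le_of_le_one_right (norm_nonneg _) (Real.abs_sin_le_one _)
  refine ⟨hi.integrableOn, ?_⟩
  have hs : Integrable (fun p : ℝ => Real.sin (p*R) * Real.exp (-u*p^2)) := by
    refine (integrable_exp_neg_mul_sq hu).mono' (by fun_prop) ?_
    filter_upwards with p
    rw [norm_mul, Real.norm_eq_abs, Real.norm_eq_abs, abs_of_pos (Real.exp_pos _)]
    exact mul_le_of_le_one_left (Real.exp_pos _).le (Real.abs_sin_le_one _)
  have hd : ∀ p : ℝ, HasDerivAt (fun p : ℝ => Real.sin (p*R) * Real.exp (-u*p^2))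
      (R * (Real.cos (p*R) * Real.exp (-u*p^2)) - 2*u * (p * Real.sin (p*R) * Real.exp (-u*p^2))) p := by
    intro p
    have d1 := ((hasDerivAt_id p).mul_const R).sin
    have d2 := (((hasDerivAt_id p).pow 2).const_mul (-u)).exp
    refine (d1.mul d2).congr_deriv ?_
    simp
    ring
  have hz := integral_eq_zero_of_hasDerivAt_of_integrable hd
    ((hc.const_mul R).sub (hi.const_mul (2*u))) hs
  rw [integral_sub (hc.const_mul R) (hi.const_mul (2*u)), integral_const_mul, integral_const_mul, hcv] at hz
  have he := integral_comp_abs (f := fun p : ℝ => p * Real.sin (p*R) * Real.exp (-u*p^2))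
  have e1 : ∀ p : ℝ, |p| * Real.sin (|p| * R) * Real.exp (-u*|p|^2) =
      p * Real.sin (p*R) * Real.exp (-u*p^2) := by
    intro p
    rcases abs_choice p with h | h <;> rw [h] <;> simp
  simp_rw [e1] at he
  rw [he] at hz
  have hsu : 0 < √u := Real.sqrt_pos.2 hu
  have hsq : √u^2 = u := Real.sq_sqrt hu.le
  set J := ∫ p in Set.Ioi (0:ℝ), p * Real.sin (p*R) * Real.exp (-u*p^2)
  set E := Real.exp (-R^2/(4*u))
  have hJ : J = R * (√Real.pi / √u * E) / (4 * u) := by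
    field_simp at hz ⊢; linarith
  rw [hJ, ← hsq]; simp only [Real.sqrt_sq hsu.le]; field_simp

lemma gauss2 (a t s : ℝ) (ht : 0 < t) (hs : 0 < s) (x y : EuclideanSpace ℝ (Fin 3)) :
    ∫⁻ z : EuclideanSpace ℝ (Fin 3),
      ENNReal.ofReal (1/(2*√Real.pi) * (1/√t^3) * Real.exp (-‖z-x‖^2/(4*t) - a^2*t)) *
      ENNReal.ofReal (1/(2*√Real.pi) * (1/√s^3) * Real.exp (-‖z-y‖^2/(4*s) - a^2*s)) * 1 =
    ENNReal.ofReal (2*√Real.pi * ((1/√(t+s)^3) * Real.exp (-(a^2*(t+s))) * Real.exp (-‖x-y‖^2/(4*(t+s))))) := by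
  set b := (t+s)/(4*t*s) with hb
  have hbp : 0 < b := by positivity
  set m : EuclideanSpace ℝ (Fin 3) := (s/(t+s)) • x + (t/(t+s)) • y with hm
  have hpi : 0 < √Real.pi := Real.sqrt_pos.2 Real.pi_pos
  have hst : 0 < √t := Real.sqrt_pos.2 ht
  have hss : 0 < √s := Real.sqrt_pos.2 hs
  have hsts : 0 < √(t+s) := Real.sqrt_pos.2 (by positivity)
  have key : ∀ z : EuclideanSpace ℝ (Fin 3), -‖z-x‖^2/(4*t) - a^2*t + (-‖z-y‖^2/(4*s) - a^2*s) =
      -b * ‖z-m‖^2 + (-(a^2*(t+s)) + -‖x-y‖^2/(4*(t+s))) := by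
    intro z
    simp only [EuclideanSpace.real_norm_sq_eq, Fin.sum_univ_three, hm, hb, PiLp.sub_apply, PiLp.add_apply,
      PiLp.smul_apply, smul_eq_mul]
    field_simp
    ring
  set C := 1/(2*√Real.pi) * (1/√t^3) * (1/(2*√Real.pi) * (1/√s^3)) *
    (Real.exp (-(a^2*(t+s))) * Real.exp (-‖x-y‖^2/(4*(t+s)))) with hC
  have hC0 : 0 ≤ C := by positivity
  have e1 : ∀ z : EuclideanSpace ℝ (Fin 3),
      ENNReal.ofReal (1/(2*√Real.pi) * (1/√t^3) * Real.exp (-‖z-x‖^2/(4*t) - a^2*t)) *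
      ENNReal.ofReal (1/(2*√Real.pi) * (1/√s^3) * Real.exp (-‖z-y‖^2/(4*s) - a^2*s)) * 1 =
      ENNReal.ofReal C * ENNReal.ofReal (Real.exp (-b*‖z-m‖^2)) := by
    intro z
    rw [mul_one, ← ENNReal.ofReal_mul (by positivity), ← ENNReal.ofReal_mul hC0]
    congr 1
    rw [hC, ← Real.exp_add (-(a^2*(t+s))), mul_assoc _ (Real.exp _) (Real.exp _), ← Real.exp_add,
      add_comm _ (-b * ‖z-m‖^2), ← key z, Real.exp_add]
    ring
  simp_rw [e1]
  rw [lintegral_const_mul' _ _ ENNReal.ofReal_ne_top,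
    lintegral_sub_right_eq_self (fun z : EuclideanSpace ℝ (Fin 3) => ENNReal.ofReal (Real.exp (-b*‖z‖^2))) m]
  have hg := GaussianFourier.integral_rexp_neg_mul_sq_norm (V := EuclideanSpace ℝ (Fin 3)) hbp
  have hgi : Integrable (fun z : EuclideanSpace ℝ (Fin 3) => Real.exp (-b*‖z‖^2)) := by
    by_contra H
    rw [integral_undef H] at hg
    have : 0 < (Real.pi / b) ^ ((Module.finrank ℝ (EuclideanSpace ℝ (Fin 3)) : ℝ)/2) := by positivity
    linarith
  rw [← ofReal_integral_eq_lintegral_ofReal hgi (by filter_upwards with z; positivity), hg,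
    ← ENNReal.ofReal_mul hC0]
  congr 1
  have e2 : (Real.pi / b) ^ ((Module.finrank ℝ (EuclideanSpace ℝ (Fin 3)) : ℝ)/2) =
      (2 * √Real.pi * √t * √s / √(t+s))^3 := by
    have : √(Real.pi / b) = 2 * √Real.pi * √t * √s / √(t+s) := by
      rw [Real.sqrt_eq_iff_mul_self_eq (by positivity) (by positivity)]
      have q1 := Real.sq_sqrt Real.pi_pos.le
      have q2 := Real.sq_sqrt ht.le
      have q3 := Real.sq_sqrt hs.le
      have q4 := Real.sq_sqrt (show 0 ≤ t+s by positivity)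
      rw [← pow_two, div_pow, mul_pow, mul_pow, mul_pow, q1, q2, q3, q4, hb]
      field_simp; norm_num
    rw [← this, Real.sqrt_eq_rpow, ← Real.rpow_natCast, ← Real.rpow_mul (by positivity)]
    simp; norm_num
  rw [e2, hC]
  field_simp

lemma conv (a : ℝ) (ha : 0 < a) (x y : EuclideanSpace ℝ (Fin 3)) :
    ∫⁻ z : EuclideanSpace ℝ (Fin 3), ENNReal.ofReal (Real.exp (-a*‖z-x‖)/‖z-x‖) *
      ENNReal.ofReal (Real.exp (-a*‖z-y‖)/‖z-y‖) =
    ENNReal.ofReal (2*√Real.pi) * ∫⁻ t in Set.Ioi (0:ℝ), ∫⁻ s in Set.Ioi (0:ℝ),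
      ENNReal.ofReal ((1/√(t+s)^3) * Real.exp (-(a^2*(t+s))) * Real.exp (-‖x-y‖^2/(4*(t+s)))) := by
  have T := tonelli (volume : Measure (EuclideanSpace ℝ (Fin 3))) (volume.restrict (Set.Ioi (0:ℝ)))
    (fun t z => ENNReal.ofReal (1/(2*√Real.pi) * (1/√t^3) * Real.exp (-‖z-x‖^2/(4*t) - a^2*t)))
    (fun t z => ENNReal.ofReal (1/(2*√Real.pi) * (1/√t^3) * Real.exp (-‖z-y‖^2/(4*t) - a^2*t)))
    (fun _ => 1) (by unfold Function.uncurry; fun_prop) (by unfold Function.uncurry; fun_prop) (by fun_prop)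
  have hL : ∫⁻ z : EuclideanSpace ℝ (Fin 3), ENNReal.ofReal (Real.exp (-a*‖z-x‖)/‖z-x‖) *
      ENNReal.ofReal (Real.exp (-a*‖z-y‖)/‖z-y‖) = ∫⁻ z : EuclideanSpace ℝ (Fin 3),
      (∫⁻ t in Set.Ioi (0:ℝ), ENNReal.ofReal (1/(2*√Real.pi) * (1/√t^3) * Real.exp (-‖z-x‖^2/(4*t) - a^2*t)))
      * (∫⁻ t in Set.Ioi (0:ℝ), ENNReal.ofReal (1/(2*√Real.pi) * (1/√t^3) * Real.exp (-‖z-y‖^2/(4*t) - a^2*t))) * 1 := by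
    refine lintegral_congr_ae ?_
    have h1 : ∀ᵐ z : EuclideanSpace ℝ (Fin 3), z ≠ x := by simp [ae_iff, measure_singleton]
    have h2 : ∀ᵐ z : EuclideanSpace ℝ (Fin 3), z ≠ y := by simp [ae_iff, measure_singleton]
    filter_upwards [h1, h2] with z hx hy
    rw [subord a _ ha (norm_pos_iff.2 (sub_ne_zero.2 hx)), subord a _ ha (norm_pos_iff.2 (sub_ne_zero.2 hy)), mul_one]
  rw [hL, T, ← lintegral_const_mul' _ _ ENNReal.ofReal_ne_top]
  refine setLIntegral_congr_fun measurableSet_Ioi fun t ht => ?_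
  try simp only
  rw [← lintegral_const_mul' _ _ ENNReal.ofReal_ne_top]
  refine setLIntegral_congr_fun measurableSet_Ioi fun s hs => ?_
  try simp only
  rw [gauss2 a t s ht hs, ENNReal.ofReal_mul (by positivity)]

lemma expl (c : ℝ) (hc : 0 < c) :
    ∫⁻ t in Set.Ioi (0:ℝ), ENNReal.ofReal (Real.exp (-c*t)) = ENNReal.ofReal (1/c) := by
  rw [← ofReal_integral_eq_lintegral_ofReal (integrableOn_exp_mul_Ioi (by linarith) 0)
    (by filter_upwards with t; positivity), integral_exp_mul_Ioi (by linarith)]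
  congr 1
  simp

lemma pside (a : ℝ) (ha : 0 < a) (W V : ℝ → ℝ) (hW : Measurable W) (hW0 : ∀ p, 0 < p → 0 ≤ W p)
    (hV : ∀ u, 0 < u → IntegrableOn (fun p => W p * Real.exp (-u*p^2)) (Set.Ioi 0) ∧
      ∫ p in Set.Ioi (0:ℝ), W p * Real.exp (-u*p^2) = √Real.pi/4 * (1/√u^3) * V u) :
    ∫⁻ p in Set.Ioi (0:ℝ), ENNReal.ofReal (W p / (p^2+a^2)^2) =
    ENNReal.ofReal (√Real.pi/4) * ∫⁻ t in Set.Ioi (0:ℝ), ∫⁻ s in Set.Ioi (0:ℝ),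
      ENNReal.ofReal ((1/√(t+s)^3) * Real.exp (-(a^2*(t+s))) * V (t+s)) := by
  have T := tonelli (volume.restrict (Set.Ioi (0:ℝ))) (volume.restrict (Set.Ioi (0:ℝ)))
    (fun t p => ENNReal.ofReal (Real.exp (-(p^2+a^2)*t)))
    (fun t p => ENNReal.ofReal (Real.exp (-(p^2+a^2)*t)))
    (fun p => ENNReal.ofReal (W p)) (by unfold Function.uncurry; fun_prop) (by unfold Function.uncurry; fun_prop) (by fun_prop)
  have hL : ∫⁻ p in Set.Ioi (0:ℝ), ENNReal.ofReal (W p / (p^2+a^2)^2) = 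
     ∫⁻ p in Set.Ioi (0:ℝ), (∫⁻ t in Set.Ioi (0:ℝ), ENNReal.ofReal (Real.exp (-(p^2+a^2)*t))) *
       (∫⁻ t in Set.Ioi (0:ℝ), ENNReal.ofReal (Real.exp (-(p^2+a^2)*t))) * ENNReal.ofReal (W p) := by
    refine setLIntegral_congr_fun measurableSet_Ioi fun p hp => ?_
    try simp only
    rw [expl _ (by positivity), ← ENNReal.ofReal_mul (by positivity), ← ENNReal.ofReal_mul (by positivity)]
    congr 1
    field_simp
  rw [hL, T, ← lintegral_const_mul' _ _ ENNReal.ofReal_ne_top]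
  refine setLIntegral_congr_fun measurableSet_Ioi fun t ht => ?_
  try simp only
  rw [← lintegral_const_mul' _ _ ENNReal.ofReal_ne_top]
  refine setLIntegral_congr_fun measurableSet_Ioi fun s hs => ?_
  try simp only
  have hu : 0 < t + s := add_pos ht hs
  obtain ⟨hi, hv⟩ := hV (t+s) hu
  rw [← ENNReal.ofReal_mul (by positivity)]
  have e : √Real.pi/4 * ((1/√(t+s)^3) * Real.exp (-(a^2*(t+s))) * V (t+s)) =
      ∫ p in Set.Ioi (0:ℝ), Real.exp (-(a^2*(t+s))) * (W p * Real.exp (-(t+s)*p^2)) := by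
    rw [integral_const_mul, hv]; ring
  rw [e, ofReal_integral_eq_lintegral_ofReal (hi.const_mul _)]
  · refine setLIntegral_congr_fun measurableSet_Ioi fun p hp => ?_
    try simp only
    rw [← ENNReal.ofReal_mul (by positivity), ← ENNReal.ofReal_mul (by positivity)]
    congr 1
    rw [← Real.exp_add, mul_comm (W p), ← mul_assoc, ← Real.exp_add]
    congr 2; ring
  · filter_upwards [ae_restrict_mem measurableSet_Ioi] with p hp
    have := hW0 p hp
    positivity

theorem stmt_6 (lam : ℝ) (hlam : 0 < lam)
    (x₁ x₂ : EuclideanSpace ℝ (Fin 3)) (hne : x₁ ≠ x₂)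
    (g : EuclideanSpace ℝ (Fin 3) → ℝ)
    (hg : ∀ x, g x = Real.exp (-Real.sqrt lam * ‖x‖) / ‖x‖)
    (R : ℝ) (hR : R = ‖x₁ - x₂‖) :
    ∫ x : EuclideanSpace ℝ (Fin 3), (g (x - x₂) - g (x - x₁)) ^ 2
      = 16 * ∫ p in Set.Ioi (0 : ℝ),
          p ^ 2 / (p ^ 2 + lam) ^ 2 * (1 - Real.sin (p * R) / (p * R)) := by
  have hRp : 0 < R := by rw [hR]; exact norm_pos_iff.2 (sub_ne_zero.2 hne)
  set a := Real.sqrt lam with haD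
  have ha : 0 < a := Real.sqrt_pos.2 hlam
  have hal : lam = a^2 := (Real.sq_sqrt hlam.le).symm
  rw [hal]
  have hgm : Measurable g := by
    rw [funext hg]; fun_prop
  have hg0 : ∀ x, 0 ≤ g x := fun x => by rw [hg]; positivity
  set D : ℝ → ENNReal := fun R => ∫⁻ t in Set.Ioi (0:ℝ), ∫⁻ s in Set.Ioi (0:ℝ),
      ENNReal.ofReal ((1/√(t+s)^3) * Real.exp (-(a^2*(t+s))) * Real.exp (-R^2/(4*(t+s)))) with hD
  set DD : ENNReal := ∫⁻ t in Set.Ioi (0:ℝ), ∫⁻ s in Set.Ioi (0:ℝ),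
      ENNReal.ofReal ((1/√(t+s)^3) * Real.exp (-(a^2*(t+s))) * (1 - Real.exp (-R^2/(4*(t+s))))) with hDD
  have hconv : ∀ x y, ∫⁻ z, ENNReal.ofReal (g (z-x)) * ENNReal.ofReal (g (z-y)) =
      ENNReal.ofReal (2*√Real.pi) * D ‖x-y‖ := by
    intro x y
    simp_rw [hg]
    exact conv a ha x y
  have hsum : DD + D R = D 0 := by
    simp only [hD, hDD]
    rw [← lintegral_add_left (by fun_prop)]
    refine setLIntegral_congr_fun measurableSet_Ioi fun t ht => ?_
    try simp only
    rw [← lintegral_add_left (by fun_prop)]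
    refine setLIntegral_congr_fun measurableSet_Ioi fun s hs => ?_
    try simp only
    have hu : 0 < t + s := add_pos ht hs
    have : Real.exp (-R^2/(4*(t+s))) ≤ 1 := by
      rw [Real.exp_le_one_iff]
      exact div_nonpos_of_nonpos_of_nonneg (by nlinarith [sq_nonneg R]) (by positivity)
    rw [← ENNReal.ofReal_add (mul_nonneg (by positivity) (by linarith)) (by positivity)]
    congr 1
    simp
    ring
  have hP0 := pside a ha (fun p => p^2) (fun u => Real.exp (-0^2/(4*u))) (by fun_prop) (fun p _ => sq_nonneg p)
    (fun u hu => by simpa using intA u hu)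
  have hfin : D 0 ≠ ⊤ := by
    intro h
    rw [show (∫⁻ t in Set.Ioi (0:ℝ), ∫⁻ s in Set.Ioi (0:ℝ),
      ENNReal.ofReal ((1/√(t+s)^3) * Real.exp (-(a^2*(t+s))) * Real.exp (-0^2/(4*(t+s))))) = D 0 from rfl, h,
      ENNReal.mul_top (by simpa using Real.pi_pos)] at hP0
    have hi : Integrable (fun p : ℝ => (a^2)⁻¹ * (1 + (p/a)^2)⁻¹) :=
      (integrable_inv_one_add_sq.comp_div ha.ne').const_mul _
    have hlt := hi.integrableOn (s := Set.Ioi 0) |>.lintegral_lt_top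
    refine (lt_of_le_of_lt ?_ hlt).ne hP0
    refine lintegral_mono fun p => ENNReal.ofReal_le_ofReal ?_
    have : (a^2)⁻¹ * (1 + (p/a)^2)⁻¹ = 1/(p^2+a^2) := by field_simp; ring
    rw [this, div_le_div_iff₀ (by positivity) (by positivity)]
    nlinarith [sq_nonneg p, sq_nonneg a, mul_nonneg (sq_nonneg p) (sq_nonneg a), mul_nonneg (sq_nonneg a) (sq_nonneg a)]
  have hsinc : ∀ p : ℝ, 0 < p → 0 ≤ 1 - Real.sin (p*R)/(p*R) := by
    intro p hp
    rw [sub_nonneg, div_le_one (by positivity)]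
    exact Real.sin_le (by positivity)
  have hP := pside a ha (fun p => p^2 * (1 - Real.sin (p*R)/(p*R))) (fun u => 1 - Real.exp (-R^2/(4*u))) (by fun_prop)
    (fun p hp => mul_nonneg (sq_nonneg p) (hsinc p hp))
    (fun u hu => by
      obtain ⟨a1, a2⟩ := intA u hu
      obtain ⟨b1, b2⟩ := intB u R hu
      have e : Set.EqOn (fun p : ℝ => p^2 * Real.exp (-u*p^2) - R⁻¹ * (p * Real.sin (p*R) * Real.exp (-u*p^2)))
        (fun p => p^2 * (1 - Real.sin (p*R)/(p*R)) * Real.exp (-u*p^2)) (Set.Ioi 0) := by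
        intro p hp
        have hp : 0 < p := hp
        try simp only
        field_simp
      refine ⟨IntegrableOn.congr_fun (a1.sub (b1.const_mul _)) e measurableSet_Ioi, ?_⟩
      rw [← setIntegral_congr_fun measurableSet_Ioi e, integral_sub a1 (b1.const_mul _), integral_const_mul, a2, b2]
      field_simp)
  rw [← hDD] at hP
  have hL : ∫⁻ x, ENNReal.ofReal ((g (x - x₂) - g (x - x₁)) ^ 2) = ENNReal.ofReal (4*√Real.pi) * DD := by
    have h12 := hconv x₁ x₂
    have h11 := hconv x₁ x₁
    have h22 := hconv x₂ x₂
    rw [← hR] at h12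
    rw [sub_self, norm_zero] at h11 h22
    have hadd : (∫⁻ x, ENNReal.ofReal ((g (x - x₂) - g (x - x₁)) ^ 2))
        + 2 * (ENNReal.ofReal (2*√Real.pi) * D R) = 2 * (ENNReal.ofReal (2*√Real.pi) * D 0) := by
      rw [two_mul (_ * D 0)]
      nth_rewrite 1 [← h11]
      rw [← h22, ← h12, ← lintegral_const_mul' _ _ (by simp), ← lintegral_add_left (by fun_prop), ← lintegral_add_left (by fun_prop)]
      refine lintegral_congr fun z => ?_
      have q1 := hg0 (z-x₁)
      have q2 := hg0 (z-x₂)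
      generalize g (z-x₁) = A at q1 ⊢
      generalize g (z-x₂) = B at q2 ⊢
      rw [← ENNReal.ofReal_mul q1, ← ENNReal.ofReal_mul q1, ← ENNReal.ofReal_mul q2,
        show (2:ENNReal) = ENNReal.ofReal 2 by simp, ← ENNReal.ofReal_mul (by norm_num),
        ← ENNReal.ofReal_add (by positivity) (by positivity), ← ENNReal.ofReal_add (by positivity) (by positivity)]
      congr 1; ring
    have hDR : D R ≠ ⊤ := by
      intro h; rw [h] at hsum; exact hfin (by rw [← hsum]; simp)
    have h4 : ENNReal.ofReal (4*√Real.pi) = 2 * ENNReal.ofReal (2*√Real.pi) := by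
      rw [show (2:ENNReal) = ENNReal.ofReal 2 by simp, ← ENNReal.ofReal_mul (by norm_num)]
      congr 1; ring
    rw [← hsum, mul_add, mul_add] at hadd
    rw [h4, mul_assoc]
    exact (ENNReal.add_left_inj (ENNReal.mul_ne_top (by simp) (ENNReal.mul_ne_top ENNReal.ofReal_ne_top hDR))).1 hadd
  rw [integral_eq_lintegral_of_nonneg_ae (by filter_upwards with x; positivity) (by fun_prop), hL,
    integral_eq_lintegral_of_nonneg_ae ?_ (by fun_prop)]
  · have : ∀ p : ℝ, p ^ 2 / (p ^ 2 + a^2) ^ 2 * (1 - Real.sin (p * R) / (p * R)) =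
      p^2 * (1 - Real.sin (p*R)/(p*R)) / (p^2+a^2)^2 := fun p => by ring
    simp_rw [this]
    rw [hP, ENNReal.toReal_mul, ENNReal.toReal_mul, ENNReal.toReal_ofReal (by positivity), ENNReal.toReal_ofReal (by positivity)]
    ring
  · filter_upwards [ae_restrict_mem measurableSet_Ioi] with p hp
    exact mul_nonneg (by positivity) (hsinc p hp)
end

section
/- Let λ > 0, let α₁, α₂ ∈ ℝ with α₁ + α₂ ≠ 0, set α = α₁α₂/(α₁ + α₂), and assume α + √λ ≠ 0. Let θ : [0,∞) → ℝ be differentiable at 0 with θ(0) = 1 and θ'(0) = 0. Set D(R) = (α₁ + √λ)(α₂ + √λ) − δ_{λ,θ}(R)². Then there exists R₀ > 0 such that D(R) ≠ 0 for all 0 < R < R₀, and the quotient ((α₁ + √λ) + (α₂ + √λ) − 2 δ_{λ,θ}(R)) / D(R) converges to 1/(α + √λ) as R → 0⁺. -/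
open Filter Topology

/-- Merging of two point interactions, case `θ'(0) = 0`: with
`δ_{λ,θ}(R) = (θ(R) − e^{−√λ R})/R` and
`D(R) = (α₁+√λ)(α₂+√λ) − δ_{λ,θ}(R)²`, if `α₁ + α₂ ≠ 0`, `α = α₁α₂/(α₁+α₂)` and
`α + √λ ≠ 0`, then `D(R) ≠ 0` near `0⁺` and
`((α₁+√λ) + (α₂+√λ) − 2δ_{λ,θ}(R))/D(R) → 1/(α+√λ)` as `R → 0⁺`. -/
theorem stmt_9 (lam : ℝ) (hlam : 0 < lam) (α₁ α₂ : ℝ) (hsum : α₁ + α₂ ≠ 0)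
    (α : ℝ) (hα : α = α₁ * α₂ / (α₁ + α₂)) (hden : α + Real.sqrt lam ≠ 0)
    (θ : ℝ → ℝ) (hθ0 : θ 0 = 1) (hθ : HasDerivWithinAt θ 0 (Set.Ici 0) 0)
    (δ D : ℝ → ℝ)
    (hδ : ∀ R, δ R = (θ R - Real.exp (-Real.sqrt lam * R)) / R)
    (hD : ∀ R, D R = (α₁ + Real.sqrt lam) * (α₂ + Real.sqrt lam) - δ R ^ 2) :
    ∃ R₀ > 0, (∀ R, 0 < R → R < R₀ → D R ≠ 0) ∧
      Tendsto (fun R : ℝ =>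
          ((α₁ + Real.sqrt lam) + (α₂ + Real.sqrt lam) - 2 * δ R) / D R)
        (𝓝[>] 0) (𝓝 (1 / (α + Real.sqrt lam))) := by
  set s := Real.sqrt lam with hs
  have hlim : Tendsto δ (𝓝[>] 0) (𝓝 s) := by
    have he : HasDerivAt (fun R : ℝ => Real.exp (-s * R)) (-s) 0 := by
      have h := ((hasDerivAt_id (0 : ℝ)).const_mul (-s)).exp
      simpa using h
    have h1 := hθ.sub (he.hasDerivWithinAt (s := Set.Ici 0))
    have h2 := h1.mono (Set.Ioi_subset_Ici_self)
    rw [hasDerivWithinAt_iff_tendsto_slope' (by simp)] at h2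
    have h3 : (0 : ℝ) - -s = s := by ring
    rw [h3] at h2
    refine h2.congr (fun R => ?_)
    rw [hδ, slope_def_field]
    simp [hθ0]
  have hDlim : Tendsto D (𝓝[>] 0) (𝓝 ((α₁ + α₂) * (α + s))) := by
    have h : (α₁ + α₂) * (α + s) = (α₁ + s) * (α₂ + s) - s ^ 2 := by
      rw [hα]; field_simp; ring
    rw [h]
    have h4 := (hlim.pow 2).const_sub ((α₁ + s) * (α₂ + s))
    exact h4.congr (fun R => (hD R).symm)
  have hne : (α₁ + α₂) * (α + s) ≠ 0 := mul_ne_zero hsum hden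
  have hev := hDlim.eventually_ne hne
  obtain ⟨R₀, hR₀, hsub⟩ := mem_nhdsGT_iff_exists_Ioo_subset.mp hev
  refine ⟨R₀, hR₀, fun R h0 h1 => hsub ⟨h0, h1⟩, ?_⟩
  have h5 := ((hlim.const_mul 2).const_sub ((α₁ + s) + (α₂ + s))).div hDlim hne
  have h6 : ((α₁ + s) + (α₂ + s) - 2 * s) / ((α₁ + α₂) * (α + s)) = 1 / (α + s) := by
    field_simp; ring
  rw [h6] at h5
  exact h5
end

section
/- Let λ > 0, let θ : [0,∞) → ℝ be differentiable at 0 with θ(0) = 1, and write c = θ'(0). Let α₁, α₂ ∈ ℝ with α₁ + α₂ − 2c ≠ 0, set α = (α₁α₂ − c²)/(α₁ + α₂ − 2c), and assume α + √λ ≠ 0. Set D(R) = (α₁ + √λ)(α₂ + √λ) − δ_{λ,θ}(R)². Then there exists R₀ > 0 such that D(R) ≠ 0 for all 0 < R < R₀, and ((α₁ + √λ) + (α₂ + √λ) − 2 δ_{λ,θ}(R)) / D(R) converges to 1/(α + √λ) as R → 0⁺. -/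
open Filter Topology

/-- Merging of two point interactions, general case `c = θ'(0)`: with
`δ_{λ,θ}(R) = (θ(R) − e^{−√λ R})/R` and
`D(R) = (α₁+√λ)(α₂+√λ) − δ_{λ,θ}(R)²`, if `α₁ + α₂ − 2c ≠ 0`,
`α = (α₁α₂ − c²)/(α₁+α₂−2c)` and `α + √λ ≠ 0`, then `D(R) ≠ 0` near `0⁺` and
`((α₁+√λ) + (α₂+√λ) − 2δ_{λ,θ}(R))/D(R) → 1/(α+√λ)` as `R → 0⁺`. -/
theorem stmt_10 (lam : ℝ) (hlam : 0 < lam)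
    (θ : ℝ → ℝ) (c : ℝ) (hθ0 : θ 0 = 1) (hθ : HasDerivWithinAt θ c (Set.Ici 0) 0)
    (α₁ α₂ : ℝ) (hsum : α₁ + α₂ - 2 * c ≠ 0)
    (α : ℝ) (hα : α = (α₁ * α₂ - c ^ 2) / (α₁ + α₂ - 2 * c))
    (hden : α + Real.sqrt lam ≠ 0)
    (δ D : ℝ → ℝ)
    (hδ : ∀ R, δ R = (θ R - Real.exp (-Real.sqrt lam * R)) / R)
    (hD : ∀ R, D R = (α₁ + Real.sqrt lam) * (α₂ + Real.sqrt lam) - δ R ^ 2) :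
    ∃ R₀ > 0, (∀ R, 0 < R → R < R₀ → D R ≠ 0) ∧
      Tendsto (fun R : ℝ =>
          ((α₁ + Real.sqrt lam) + (α₂ + Real.sqrt lam) - 2 * δ R) / D R)
        (𝓝[>] 0) (𝓝 (1 / (α + Real.sqrt lam))) := by
  set s := Real.sqrt lam with hs
  have hexp : HasDerivWithinAt (fun R : ℝ => Real.exp (-s * R)) (-s) (Set.Ici 0) 0 := by
    have h1 : HasDerivAt (fun R : ℝ => -s * R) (-s) 0 := by
      simpa using (hasDerivAt_id (0 : ℝ)).const_mul (-s)
    have h2 := h1.exp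
    simp only [mul_zero, Real.exp_zero, one_mul] at h2
    exact h2.hasDerivWithinAt
  have hdiff : HasDerivWithinAt (fun R : ℝ => θ R - Real.exp (-s * R)) (c - -s) (Set.Ici 0) 0 :=
    hθ.sub hexp
  have hδt : Tendsto δ (𝓝[>] 0) (𝓝 (c + s)) := by
    rw [hasDerivWithinAt_iff_tendsto_slope] at hdiff
    have h3 : Set.Ici (0 : ℝ) \ {0} = Set.Ioi 0 := by
      ext x
      simp only [Set.mem_diff, Set.mem_Ici, Set.mem_singleton_iff, Set.mem_Ioi]
      exact ⟨fun h => lt_of_le_of_ne h.1 (Ne.symm h.2), fun h => ⟨h.le, h.ne'⟩⟩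
    rw [h3, sub_neg_eq_add] at hdiff
    refine hdiff.congr fun R => ?_
    rw [hδ R, slope_def_field]
    simp [hθ0]
  have hlim : (α₁ + s) * (α₂ + s) - (c + s) ^ 2 = (α + s) * (α₁ + α₂ - 2 * c) := by
    have h4 : α * (α₁ + α₂ - 2 * c) = α₁ * α₂ - c ^ 2 := by
      rw [hα]
      exact div_mul_cancel₀ _ hsum
    linear_combination -h4
  have hDt : Tendsto D (𝓝[>] 0) (𝓝 ((α + s) * (α₁ + α₂ - 2 * c))) := by
    rw [← hlim, funext hD]
    exact tendsto_const_nhds.sub (hδt.pow 2)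
  have hne : (α + s) * (α₁ + α₂ - 2 * c) ≠ 0 := mul_ne_zero hden hsum
  have hev := hDt.eventually_ne hne
  obtain ⟨R₀, hR₀, hsub⟩ := mem_nhdsGT_iff_exists_Ioo_subset.1 hev
  refine ⟨R₀, hR₀, fun R h1 h2 => hsub ⟨h1, h2⟩, ?_⟩
  have hN : Tendsto (fun R => (α₁ + s) + (α₂ + s) - 2 * δ R) (𝓝[>] 0)
      (𝓝 ((α₁ + s) + (α₂ + s) - 2 * (c + s))) :=
    tendsto_const_nhds.sub (hδt.const_mul 2)
  have h5 := hN.div hDt hne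
  have h6 : ((α₁ + s) + (α₂ + s) - 2 * (c + s)) / ((α + s) * (α₁ + α₂ - 2 * c))
      = 1 / (α + s) := by
    rw [div_eq_div_iff hne hden]
    ring
  rw [h6] at h5
  exact h5
end

section
/- For every integer N ≥ 2, the infimum over η > 0 of γ̂_c(N,η) equals (2/π)·(N−2)/(N−1). -/
open Filter Topology in
theorem stmt_12_aux (N : ℕ) (hN : 2 ≤ N) (η : ℝ) (hη : 0 < η) :
    2 * (η + 1) / Real.pi * Real.arcsin (1 / (η + 1))
          - 2 * Real.sqrt (η * (η + 2)) / (Real.pi * ((N : ℝ) - 1) * (η + 1))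
    = 2 / Real.pi * ((η + 1)⁻¹⁻¹ * Real.arcsin ((η + 1)⁻¹) -
        Real.sqrt (1 - ((η + 1)⁻¹) ^ 2) / ((N : ℝ) - 1)) := by
  have hN' : (2 : ℝ) ≤ N := by exact_mod_cast hN
  have h1 : (N : ℝ) - 1 ≠ 0 := by linarith
  have hx : 0 < η + 1 := by linarith
  have hp := Real.pi_ne_zero
  have hs : Real.sqrt (η * (η + 2)) = (η + 1) * Real.sqrt (1 - ((η + 1)⁻¹) ^ 2) := by
    have : η * (η + 2) = (η + 1) ^ 2 * (1 - ((η + 1)⁻¹) ^ 2) := by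
      field_simp
      ring
    rw [this, Real.sqrt_mul (by positivity), Real.sqrt_sq hx.le]
  rw [hs, one_div, inv_inv]
  field_simp

open Filter Topology in
/-- For every integer `N ≥ 2`, the infimum over `η > 0` of
`γ̂_c(N,η) = (2(η+1)/π) arcsin(1/(η+1)) − 2√(η(η+2))/(π(N−1)(η+1))`
equals `(2/π)(N−2)/(N−1)`. -/
theorem stmt_12 (N : ℕ) (hN : 2 ≤ N) :
    IsGLB ((fun η : ℝ =>
        2 * (η + 1) / Real.pi * Real.arcsin (1 / (η + 1))
          - 2 * Real.sqrt (η * (η + 2)) / (Real.pi * ((N : ℝ) - 1) * (η + 1))) '' Set.Ioi 0)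
      (2 / Real.pi * (((N : ℝ) - 2) / ((N : ℝ) - 1))) := by
  have hN' : (2 : ℝ) ≤ N := by exact_mod_cast hN
  have h1 : 0 < (N : ℝ) - 1 := by linarith
  have hv : ((N : ℝ) - 2) / ((N : ℝ) - 1) = 1 - 1 / ((N : ℝ) - 1) := by
    field_simp
    ring
  rw [hv]
  constructor
  · rintro _ ⟨η, hη, rfl⟩
    have hη' : 0 < η := hη
    simp only
    rw [stmt_12_aux N hN η hη]
    have hs : 0 < (η + 1)⁻¹ := by positivity
    have hs1 : (η + 1)⁻¹ ≤ 1 := inv_le_one_of_one_le₀ (by linarith)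
    generalize (η + 1)⁻¹ = s at hs hs1
    have hpi := Real.pi_gt_three
    have ha : s ≤ Real.arcsin s := by
      rw [Real.le_arcsin_iff_sin_le ⟨by linarith, by linarith⟩ ⟨by linarith, by linarith⟩]
      exact Real.sin_le hs.le
    have hb : Real.sqrt (1 - s ^ 2) ≤ 1 := by
      rw [Real.sqrt_le_one]
      nlinarith
    have hc : 1 ≤ s⁻¹ * Real.arcsin s := by
      calc 1 = s⁻¹ * s := by field_simp
        _ ≤ _ := by gcongr
    gcongr
  · intro b hb
    have ht0 : Tendsto (fun η : ℝ => (η + 1)⁻¹) atTop (𝓝 0) :=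
      tendsto_inv_atTop_zero.comp (tendsto_atTop_add_const_right _ 1 tendsto_id)
    have ht : Tendsto (fun η : ℝ => (η + 1)⁻¹) atTop (𝓝[≠] 0) := by
      refine tendsto_nhdsWithin_iff.2 ⟨ht0, ?_⟩
      filter_upwards [eventually_gt_atTop 0] with η hη
      have : 0 < (η + 1)⁻¹ := by positivity
      exact this.ne'
    have hd : Tendsto (fun s : ℝ => s⁻¹ * Real.arcsin s) (𝓝[≠] 0) (𝓝 1) := by
      have := (Real.hasDerivAt_arcsin (x := 0) (by norm_num) (by norm_num)).tendsto_slope_zero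
      simpa using this
    have hq : Tendsto (fun s : ℝ => Real.sqrt (1 - s ^ 2)) (𝓝 0) (𝓝 1) := by
      have : Continuous (fun s : ℝ => Real.sqrt (1 - s ^ 2)) := by fun_prop
      simpa using this.tendsto 0
    have hl := (((hd.comp ht).sub ((hq.comp ht0).div_const ((N : ℝ) - 1))).const_mul
      (2 / Real.pi))
    refine ge_of_tendsto hl ?_
    filter_upwards [eventually_gt_atTop 0] with η hη
    have := hb ⟨η, hη, rfl⟩
    simp only at this
    rw [stmt_12_aux N hN η hη] at this
    exact this
end

section
/- Let n ≥ 0 be an integer, λ > 0, and let v ∈ L²(ℝ³ × ℝⁿ; ℂ). Then lim_{η→0⁺} ∫_{ℝ³×ℝ³×ℝⁿ} |v(p + q, P)|² · ( 1/(|p|² + η|q|² + η|P|² + λ) − 1/(|p|² + λ) )² dp dq dP = 0, and for every η ≥ 0 the integrand is integrable over ℝ³ × ℝ³ × ℝⁿ. -/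
open MeasureTheory Filter Topology

set_option maxHeartbeats 1000000 in
/-- Convergence of the potential generated by an `L²` charge in the infinite-mass limit,
Fourier side: for `v ∈ L²(ℝ³ × ℝⁿ)` (`n ≥ 0`) and `λ > 0`, the function
`(p,q,P) ↦ |v(p+q,P)|² (1/(|p|²+η|q|²+η|P|²+λ) − 1/(|p|²+λ))²` is integrable on
`ℝ³ × ℝ³ × ℝⁿ` for every `η ≥ 0`, and its integral tends to `0` as `η → 0⁺`. -/
theorem stmt_16 (n : ℕ) (lam : ℝ) (hlam : 0 < lam)
    (v : EuclideanSpace ℝ (Fin 3) × EuclideanSpace ℝ (Fin n) → ℂ)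
    (hv : MemLp v 2 (volume : Measure (EuclideanSpace ℝ (Fin 3) × EuclideanSpace ℝ (Fin n)))) :
    (∀ η : ℝ, 0 ≤ η → Integrable
      (fun w : EuclideanSpace ℝ (Fin 3) × EuclideanSpace ℝ (Fin 3) × EuclideanSpace ℝ (Fin n) =>
        ‖v (w.1 + w.2.1, w.2.2)‖ ^ 2 *
          (1 / (‖w.1‖ ^ 2 + η * ‖w.2.1‖ ^ 2 + η * ‖w.2.2‖ ^ 2 + lam)
            - 1 / (‖w.1‖ ^ 2 + lam)) ^ 2)) ∧
    Tendsto (fun η : ℝ =>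
        ∫ w : EuclideanSpace ℝ (Fin 3) × EuclideanSpace ℝ (Fin 3) × EuclideanSpace ℝ (Fin n),
          ‖v (w.1 + w.2.1, w.2.2)‖ ^ 2 *
            (1 / (‖w.1‖ ^ 2 + η * ‖w.2.1‖ ^ 2 + η * ‖w.2.2‖ ^ 2 + lam)
              - 1 / (‖w.1‖ ^ 2 + lam)) ^ 2)
      (𝓝[>] 0) (𝓝 0) := by
  have hdec : Integrable (fun p : EuclideanSpace ℝ (Fin 3) => (1 / (‖p‖ ^ 2 + lam)) ^ 2) := by
    have h0 : Integrable (fun p : EuclideanSpace ℝ (Fin 3) => (1 + ‖p‖ ^ 2) ^ (-(4:ℝ) / 2)) :=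
      integrable_rpow_neg_one_add_norm_sq (by simp; norm_num)
    refine (h0.const_mul ((1 + 1 / lam) ^ 2)).mono' ?_ ?_
    · exact (by fun_prop : Measurable _).aestronglyMeasurable
    · refine Eventually.of_forall fun p => ?_
      have e : (1 + ‖p‖ ^ 2) ^ (-(4:ℝ) / 2) = (1 / (1 + ‖p‖ ^ 2)) ^ 2 := by
        rw [show (-(4:ℝ) / 2) = -((2:ℕ):ℝ) by norm_num, Real.rpow_neg (by positivity),
          Real.rpow_natCast]
        simp
      rw [e, Real.norm_of_nonneg (by positivity), ← mul_pow]
      gcongr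
      rw [mul_one_div, div_le_div_iff₀ (by positivity) (by positivity)]
      have : (1 + 1 / lam) * (‖p‖ ^ 2 + lam) = ‖p‖ ^ 2 + lam + ‖p‖ ^ 2 / lam + 1 := by
        field_simp
        ring
      rw [this]
      have : 0 ≤ ‖p‖ ^ 2 / lam := by positivity
      linarith
  have hv2 : Integrable (fun x => ‖v x‖ ^ 2) := hv.integrable_norm_pow (by norm_num)
  have hmp : MeasurePreserving
      (fun w : EuclideanSpace ℝ (Fin 3) × EuclideanSpace ℝ (Fin 3) × EuclideanSpace ℝ (Fin n) =>
        (w.1, (w.1 + w.2.1, w.2.2))) volume volume := by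
    refine MeasurePreserving.skew_product (μa := volume) (μb := volume) (μc := volume)
      (μd := volume) (f := id)
      (g := fun (p : EuclideanSpace ℝ (Fin 3))
        (x : EuclideanSpace ℝ (Fin 3) × EuclideanSpace ℝ (Fin n)) => (p + x.1, x.2))
      (MeasurePreserving.id _) ?_ ?_
    · unfold Function.uncurry
      fun_prop
    · refine Eventually.of_forall fun p => ?_
      exact ((measurePreserving_add_left volume p).prod (MeasurePreserving.id volume)).map_eq
  have hG : Integrable
      (fun w : EuclideanSpace ℝ (Fin 3) × EuclideanSpace ℝ (Fin 3) × EuclideanSpace ℝ (Fin n) =>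
        (1 / (‖w.1‖ ^ 2 + lam)) ^ 2 * ‖v (w.1 + w.2.1, w.2.2)‖ ^ 2) :=
    hmp.integrable_comp_of_integrable (hdec.mul_prod hv2)
  have hvm : AEStronglyMeasurable
      (fun w : EuclideanSpace ℝ (Fin 3) × EuclideanSpace ℝ (Fin 3) × EuclideanSpace ℝ (Fin n) =>
        ‖v (w.1 + w.2.1, w.2.2)‖ ^ 2) := by
    have h1 : AEStronglyMeasurable (fun w : EuclideanSpace ℝ (Fin 3) ×
        EuclideanSpace ℝ (Fin 3) × EuclideanSpace ℝ (Fin n) => ‖v w.2‖ ^ 2) volume :=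
      hv2.aestronglyMeasurable.comp_quasiMeasurePreserving Measure.quasiMeasurePreserving_snd
    exact h1.comp_quasiMeasurePreserving hmp.quasiMeasurePreserving
  have hmeas : ∀ η : ℝ, AEStronglyMeasurable
      (fun w : EuclideanSpace ℝ (Fin 3) × EuclideanSpace ℝ (Fin 3) × EuclideanSpace ℝ (Fin n) =>
        ‖v (w.1 + w.2.1, w.2.2)‖ ^ 2 *
          (1 / (‖w.1‖ ^ 2 + η * ‖w.2.1‖ ^ 2 + η * ‖w.2.2‖ ^ 2 + lam)
            - 1 / (‖w.1‖ ^ 2 + lam)) ^ 2) := fun η =>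
    hvm.mul (by fun_prop : Measurable _).aestronglyMeasurable
  have hbd : ∀ η : ℝ, 0 ≤ η →
      ∀ w : EuclideanSpace ℝ (Fin 3) × EuclideanSpace ℝ (Fin 3) × EuclideanSpace ℝ (Fin n),
      ‖‖v (w.1 + w.2.1, w.2.2)‖ ^ 2 *
          (1 / (‖w.1‖ ^ 2 + η * ‖w.2.1‖ ^ 2 + η * ‖w.2.2‖ ^ 2 + lam)
            - 1 / (‖w.1‖ ^ 2 + lam)) ^ 2‖ ≤
        (1 / (‖w.1‖ ^ 2 + lam)) ^ 2 * ‖v (w.1 + w.2.1, w.2.2)‖ ^ 2 := by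
    intro η hη w
    rw [Real.norm_of_nonneg (by positivity), mul_comm]
    refine mul_le_mul_of_nonneg_right ?_ (by positivity)
    have h1 : 0 ≤ 1 / (‖w.1‖ ^ 2 + η * ‖w.2.1‖ ^ 2 + η * ‖w.2.2‖ ^ 2 + lam) := by positivity
    have h2 : 1 / (‖w.1‖ ^ 2 + η * ‖w.2.1‖ ^ 2 + η * ‖w.2.2‖ ^ 2 + lam)
        ≤ 1 / (‖w.1‖ ^ 2 + lam) := by
      apply one_div_le_one_div_of_le (by positivity)
      have : 0 ≤ η * ‖w.2.1‖ ^ 2 := by positivity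
      have : 0 ≤ η * ‖w.2.2‖ ^ 2 := by positivity
      linarith
    apply sq_le_sq'
    · linarith
    · linarith
  refine ⟨fun η hη => hG.mono' (hmeas η) (Eventually.of_forall (hbd η hη)), ?_⟩
  have hlim := tendsto_integral_filter_of_dominated_convergence (μ := volume) (l := 𝓝[>] (0:ℝ))
    (F := fun (η : ℝ)
      (w : EuclideanSpace ℝ (Fin 3) × EuclideanSpace ℝ (Fin 3) × EuclideanSpace ℝ (Fin n)) =>
        ‖v (w.1 + w.2.1, w.2.2)‖ ^ 2 *
          (1 / (‖w.1‖ ^ 2 + η * ‖w.2.1‖ ^ 2 + η * ‖w.2.2‖ ^ 2 + lam)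
            - 1 / (‖w.1‖ ^ 2 + lam)) ^ 2) (f := fun _ => 0) _
    (Eventually.of_forall hmeas)
    (by
      filter_upwards [self_mem_nhdsWithin] with η hη
      exact Eventually.of_forall (hbd η (le_of_lt hη))) hG
    (by
      refine Eventually.of_forall fun w => ?_
      have hc : ContinuousAt (fun η : ℝ => ‖v (w.1 + w.2.1, w.2.2)‖ ^ 2 *
          (1 / (‖w.1‖ ^ 2 + η * ‖w.2.1‖ ^ 2 + η * ‖w.2.2‖ ^ 2 + lam)
            - 1 / (‖w.1‖ ^ 2 + lam)) ^ 2) 0 := by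
        have hne : ‖w.1‖ ^ 2 + 0 * ‖w.2.1‖ ^ 2 + 0 * ‖w.2.2‖ ^ 2 + lam ≠ 0 := by positivity
        have hd : ContinuousAt (fun η : ℝ =>
            ‖w.1‖ ^ 2 + η * ‖w.2.1‖ ^ 2 + η * ‖w.2.2‖ ^ 2 + lam) 0 := by fun_prop
        have hq : ContinuousAt (fun η : ℝ =>
            1 / (‖w.1‖ ^ 2 + η * ‖w.2.1‖ ^ 2 + η * ‖w.2.2‖ ^ 2 + lam)) 0 :=
          continuousAt_const.div hd hne
        exact continuousAt_const.mul ((hq.sub continuousAt_const).pow 2)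
      have := hc.tendsto.mono_left (nhdsWithin_le_nhds (s := Set.Ioi (0:ℝ)))
      simpa using this)
  simpa using hlim
end
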